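/- arXiv:math/0607264 — 5 statements merged into one kernel-verified Lean document; each statement's English description precedes it below -/
import Mathlib

section
/- There is a computable Boolean algebra B on carrier ℕ such that the set {e : ℕ | e codes a computable Boolean algebra isomorphic to B} is Σ¹₁-complete; that is, this set is Σ¹₁, and every Σ¹₁ subset of ℕ is many-one reducible to it. -/
/-- `evalCode e` is the `e`-th partial computable function, via Mathlib's
`Nat.Partrec.Code` numbering. -/
def evalCode (e : ℕ) : ℕ →. ℕ := (Denumerable.ofNat Nat.Partrec.Code e).eval

/-- `A ⊆ ℕ` is `Σ¹₁`. -/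
def Sigma11 (A : Set ℕ) : Prop :=
  ∃ R : ℕ → List ℕ → Bool, Computable₂ R ∧
    A = {n | ∃ f : ℕ → ℕ, ∀ k, R n ((List.range k).map f) = true}

/-- `A` is `Σ¹₁`-complete. -/
def Sigma11Complete (A : Set ℕ) : Prop :=
  Sigma11 A ∧ ∀ B : Set ℕ, Sigma11 B → ManyOneReducible (· ∈ B) (· ∈ A)

/-- The operations `sup`, `inf`, `compl` admit `⊥`, `⊤` making `ℕ` a Boolean algebra. -/
def IsBAOps (sup inf : ℕ → ℕ → ℕ) (compl : ℕ → ℕ) : Prop :=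
  ∃ B : BooleanAlgebra ℕ,
    (∀ a b : ℕ, B.sup a b = sup a b) ∧
    (∀ a b : ℕ, B.inf a b = inf a b) ∧
    (∀ a : ℕ, B.compl a = compl a)

/-- The index `e` codes, via `Nat.pair` and the `Nat.Partrec.Code` numbering, three total
partial computable functions whose values are the given operations. -/
def CodesOps (e : ℕ) (sup inf : ℕ → ℕ → ℕ) (compl : ℕ → ℕ) : Prop :=
  (∀ a b : ℕ, evalCode (Nat.unpair e).1 (Nat.pair a b) = Part.some (sup a b)) ∧
  (∀ a b : ℕ, evalCode (Nat.unpair (Nat.unpair e).2).1 (Nat.pair a b) = Part.some (inf a b)) ∧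
  (∀ a : ℕ, evalCode (Nat.unpair (Nat.unpair e).2).2 a = Part.some (compl a))

/-- The two coded structures on `ℕ` are isomorphic Boolean algebras: a bijection of `ℕ`
carrying sup, inf and complement of one to those of the other. -/
def BAIso (s₁ i₁ : ℕ → ℕ → ℕ) (c₁ : ℕ → ℕ) (s₂ i₂ : ℕ → ℕ → ℕ) (c₂ : ℕ → ℕ) : Prop :=
  ∃ π : ℕ ≃ ℕ,
    (∀ a b : ℕ, π (s₁ a b) = s₂ (π a) (π b)) ∧
    (∀ a b : ℕ, π (i₁ a b) = i₂ (π a) (π b)) ∧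
    (∀ a : ℕ, π (c₁ a) = c₂ (π a))

/-! ### Trees on `ℕ` given by a parent function, and their Boolean algebras of cones -/

/-- A rooted tree on `ℕ` with root `0` in which every other node has a smaller parent. -/
structure ParentTree where
  /-- The parent of a node; the root is its own parent. -/
  parent : ℕ → ℕ
  parent_zero : parent 0 = 0
  parent_lt : ∀ i, 0 < i → parent i < i

/-- The natural number whose binary digits are `f 0, …, f (n - 1)`. -/
def natOfBits (f : ℕ → Bool) (n : ℕ) : ℕ :=
  n.rec 0 fun k ih => 2 ^ k * (f k).toNat + ih

theorem natOfBits_lt (f : ℕ → Bool) (n : ℕ) : natOfBits f n < 2 ^ n := by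
  induction n with
  | zero => simp [natOfBits]
  | succ n ih =>
    change 2 ^ n * (f n).toNat + natOfBits f n < 2 ^ (n + 1)
    have : 2 ^ n * (f n).toNat ≤ 2 ^ n * 1 := Nat.mul_le_mul_left _ (Bool.toNat_le _)
    rw [pow_succ]
    omega

theorem testBit_natOfBits (f : ℕ → Bool) (n k : ℕ) :
    (natOfBits f n).testBit k = (decide (k < n) && f k) := by
  induction n with
  | zero => simp [natOfBits]
  | succ n ih =>
    change (2 ^ n * (f n).toNat + natOfBits f n).testBit k = _
    rw [Nat.testBit_two_pow_mul_add _ (natOfBits_lt f n), ih]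
    rcases lt_trichotomy k n with h | rfl | h
    · simp [h, Nat.lt_succ_of_lt h]
    · cases f k <;> simp
    · obtain ⟨d, rfl⟩ : ∃ d, k = n + (d + 1) := ⟨k - n - 1, by omega⟩
      cases f n <;> simp [Nat.testBit_succ]

namespace ParentTree

variable (T : ParentTree)

/-- The value at `x` of the clopen set coded by `a`: the parity of the number of
binary digits of `a` lying on the path from the root to `x`. -/
def val (T : ParentTree) (a : ℕ) : ℕ → Bool
  | 0 => a.testBit 0
  | x + 1 => a.testBit (x + 1) ^^ val T a (T.parent (x + 1))
decreasing_by exact T.parent_lt _ x.succ_pos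

/-- The number coding the combination of `a` and `b` by a binary Boolean operation. -/
def lift₂ (o : Bool → Bool → Bool) (a b : ℕ) : ℕ :=
  natOfBits (fun x => o (T.val a x) (T.val b x) ^^
    (decide (0 < x) && o (T.val a (T.parent x)) (T.val b (T.parent x)))) (a + b + 1)

theorem val_zero (a : ℕ) : T.val a 0 = a.testBit 0 := by rw [val]

theorem val_pos (a : ℕ) {x : ℕ} (hx : 0 < x) :
    T.val a x = (a.testBit x ^^ T.val a (T.parent x)) := by
  obtain ⟨y, rfl⟩ := Nat.exists_eq_succ_of_ne_zero hx.ne'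
  rw [val]

theorem testBit_eq_val (a : ℕ) {x : ℕ} (hx : 0 < x) :
    a.testBit x = (T.val a x ^^ T.val a (T.parent x)) := by
  rw [T.val_pos a hx]
  simp

theorem val_eq_val_parent {a x : ℕ} (h : a < x) : T.val a x = T.val a (T.parent x) := by
  rw [T.val_pos a (by omega), Nat.testBit_lt_two_pow (h.trans Nat.lt_two_pow_self)]
  simp

theorem val_injective : Function.Injective T.val := by
  intro a b h
  refine Nat.eq_of_testBit_eq fun i => ?_
  rcases Nat.eq_zero_or_pos i with rfl | hi
  · rw [← T.val_zero, ← T.val_zero, h]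
  · rw [T.testBit_eq_val a hi, T.testBit_eq_val b hi, h]

theorem val_lift₂ (o : Bool → Bool → Bool) (a b x : ℕ) :
    T.val (T.lift₂ o a b) x = o (T.val a x) (T.val b x) := by
  induction x using Nat.strong_induction_on with
  | _ x ih =>
    rcases Nat.eq_zero_or_pos x with rfl | hx
    · rw [val_zero, lift₂, testBit_natOfBits]
      simp
    · rw [T.val_pos _ hx, ih _ (T.parent_lt x hx), lift₂, testBit_natOfBits]
      by_cases h : x < a + b + 1
      · simp [h, hx]
      · rw [T.val_eq_val_parent (a := a) (x := x) (by omega),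
          T.val_eq_val_parent (a := b) (x := x) (by omega)]
        simp [h]

/-- Union of clopen sets. -/
def sup : ℕ → ℕ → ℕ := T.lift₂ or

/-- Intersection of clopen sets. -/
def inf : ℕ → ℕ → ℕ := T.lift₂ and

/-- Complement of a clopen set. -/
def compl (a : ℕ) : ℕ := T.lift₂ (fun b _ => !b) a a

theorem val_sup (a b x : ℕ) : T.val (T.sup a b) x = (T.val a x || T.val b x) := T.val_lift₂ ..

theorem val_inf (a b x : ℕ) : T.val (T.inf a b) x = (T.val a x && T.val b x) := T.val_lift₂ ..

theorem val_compl (a x : ℕ) : T.val (T.compl a) x = !T.val a x := T.val_lift₂ ..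

end ParentTree

theorem isBAOps_of_injective {α : Type*} [BooleanAlgebra α] (f : ℕ → α)
    (hf : Function.Injective f) {s i : ℕ → ℕ → ℕ} {c : ℕ → ℕ}
    (hs : ∀ a b, f (s a b) = f a ⊔ f b) (hi : ∀ a b, f (i a b) = f a ⊓ f b)
    (hc : ∀ a, f (c a) = (f a)ᶜ) : IsBAOps s i c := by
  let B : BooleanAlgebra ℕ :=
    @Function.Injective.booleanAlgebra ℕ α ⟨s⟩ ⟨i⟩ ⟨fun a b => f a ≤ f b⟩ ⟨fun a b => f a < f b⟩
      ⟨s 0 (c 0)⟩ ⟨i 0 (c 0)⟩ ⟨c⟩ ⟨fun a b => i a (c b)⟩ ⟨fun a b => s b (c a)⟩ _ f hf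
      Iff.rfl Iff.rfl hs hi ((hs _ _).trans (by simp [hc])) ((hi _ _).trans (by simp [hc])) hc
      (fun a b => (hi _ _).trans (by simp [hc, sdiff_eq]))
      (fun a b => (hs _ _).trans (by simp [hc, himp_eq]))
  exact ⟨B, fun _ _ => rfl, fun _ _ => rfl, fun _ => rfl⟩

theorem BAIso.isBAOps {s₁ i₁ : ℕ → ℕ → ℕ} {c₁ : ℕ → ℕ} {s₂ i₂ : ℕ → ℕ → ℕ} {c₂ : ℕ → ℕ}
    (h : BAIso s₁ i₁ c₁ s₂ i₂ c₂) (h₂ : IsBAOps s₂ i₂ c₂) : IsBAOps s₁ i₁ c₁ := by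
  obtain ⟨π, hs, hi, hc⟩ := h
  obtain ⟨B, hBs, hBi, hBc⟩ := h₂
  exact @isBAOps_of_injective ℕ B π π.injective _ _ _
    (fun a b => (hs a b).trans (hBs _ _).symm) (fun a b => (hi a b).trans (hBi _ _).symm)
    (fun a => (hc a).trans (hBc _).symm)

namespace ParentTree

theorem isBAOps (T : ParentTree) : IsBAOps T.sup T.inf T.compl :=
  isBAOps_of_injective T.val T.val_injective (fun a b => funext (T.val_sup a b))
    (fun a b => funext (T.val_inf a b)) (fun a => funext (T.val_compl a))

/-- An isomorphism of trees induces an isomorphism of their Boolean algebras. -/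
theorem baIso_of_equiv {T T' : ParentTree} (π : ℕ ≃ ℕ) (h0 : π 0 = 0)
    (hπ : ∀ i, π (T.parent i) = T'.parent (π i)) :
    BAIso T.sup T.inf T.compl T'.sup T'.inf T'.compl := by
  let P : ℕ ≃ ℕ := Finset.equivBitIndices.trans
    (π.finsetCongr.trans Finset.equivBitIndices.symm)
  have hbit : ∀ a i, (P a).testBit (π i) = a.testBit i := by
    intro a i
    have h : Finset.equivBitIndices (P a) = (Finset.equivBitIndices a).map π.toEmbedding := by
      simp only [P, Equiv.trans_apply, Equiv.apply_symm_apply, Equiv.finsetCongr_apply]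
    have h' := congrArg (π i ∈ ·) h
    simpa [← Bool.eq_iff_iff] using h'
  have hval : ∀ a x, T'.val (P a) (π x) = T.val a x := by
    intro a x
    induction x using Nat.strong_induction_on with
    | _ x ih =>
      rcases Nat.eq_zero_or_pos x with rfl | hx
      · rw [T.val_zero, ← hbit, h0, T'.val_zero]
      · have hx' : 0 < π x := Nat.pos_of_ne_zero fun h => hx.ne' (π.injective (h.trans h0.symm))
        rw [T.val_pos a hx, T'.val_pos _ hx', hbit, ← hπ, ih _ (T.parent_lt x hx)]
  refine ⟨P, fun a b => T'.val_injective ?_, fun a b => T'.val_injective ?_,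
    fun a => T'.val_injective ?_⟩
  all_goals
    funext y
    obtain ⟨x, rfl⟩ := π.surjective y
  · rw [T'.val_sup, hval, hval, hval, T.val_sup]
  · rw [T'.val_inf, hval, hval, hval, T.val_inf]
  · rw [T'.val_compl, hval, hval, T.val_compl]

end ParentTree

theorem exists_inverse_maps {A B : Set ℕ} (h : (A = ∅ ∧ B = ∅) ∨ (A.Infinite ∧ B.Infinite)) :
    ∃ f g : ℕ → ℕ, (∀ i ∈ A, f i ∈ B ∧ g (f i) = i) ∧ ∀ j ∈ B, g j ∈ A ∧ f (g j) = j := by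
  classical
  rcases h with ⟨rfl, rfl⟩ | ⟨hA, hB⟩
  · exact ⟨id, id, by simp, by simp⟩
  · have := hA.to_subtype
    have := hB.to_subtype
    obtain ⟨dA⟩ := nonempty_denumerable A
    obtain ⟨dB⟩ := nonempty_denumerable B
    let e : A ≃ B := Denumerable.equiv₂ A B
    refine ⟨fun i => if h : i ∈ A then e ⟨i, h⟩ else 0,
      fun j => if h : j ∈ B then e.symm ⟨j, h⟩ else 0, fun i hi => ?_, fun j hj => ?_⟩
    · simp [hi]
    · simp [hj]

/-- The map between trees built from maps `F u v` matching the children of `u` with those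
of `v`. -/
def ParentTree.extend (T : ParentTree) (F : ℕ → ℕ → ℕ → ℕ) : ℕ → ℕ
  | 0 => 0
  | i + 1 => F (T.parent (i + 1)) (T.extend F (T.parent (i + 1))) (i + 1)
decreasing_by exact T.parent_lt _ i.succ_pos

theorem ParentTree.extend_pos (T : ParentTree) (F : ℕ → ℕ → ℕ → ℕ) {i : ℕ} (hi : 0 < i) :
    T.extend F i = F (T.parent i) (T.extend F (T.parent i)) i := by
  obtain ⟨y, rfl⟩ := Nat.exists_eq_succ_of_ne_zero hi.ne'
  rw [extend]

theorem ParentTree.extend_spec {Λ : Type*} {T T' : ParentTree} {l l' : ℕ → Λ}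
    (h0 : l 0 = l' 0) {F G : ℕ → ℕ → ℕ → ℕ}
    (hFG : ∀ u v, l u = l' v → ∀ i, 0 < i → T.parent i = u →
      0 < F u v i ∧ T'.parent (F u v i) = v ∧ l' (F u v i) = l i ∧ G v u (F u v i) = i) (i : ℕ) :
    l i = l' (T.extend F i) ∧ T'.extend G (T.extend F i) = i ∧
      T.extend F (T.parent i) = T'.parent (T.extend F i) := by
  induction i using Nat.strong_induction_on with
  | _ i ih =>
    rcases Nat.eq_zero_or_pos i with rfl | hi
    · simp [T.parent_zero, extend, T'.parent_zero, h0]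
    · obtain ⟨h1, h2, -⟩ := ih _ (T.parent_lt i hi)
      obtain ⟨k1, k2, k3, k4⟩ := hFG _ _ h1 i hi rfl
      rw [T.extend_pos F hi]
      refine ⟨k3.symm, ?_, k2.symm⟩
      rw [T'.extend_pos G k1, k2, h2, k4]

/-- Two labelled trees are isomorphic if nodes with equal labels have, for every label, either
no children or infinitely many children with that label. -/
theorem ParentTree.exists_equiv {Λ : Type*} {T T' : ParentTree} {l l' : ℕ → Λ} (h0 : l 0 = l' 0)
    (h : ∀ u v, l u = l' v → ∀ t,
      ({i | 0 < i ∧ T.parent i = u ∧ l i = t} = ∅ ∧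
        {i | 0 < i ∧ T'.parent i = v ∧ l' i = t} = ∅) ∨
      ({i | 0 < i ∧ T.parent i = u ∧ l i = t}.Infinite ∧
        {i | 0 < i ∧ T'.parent i = v ∧ l' i = t}.Infinite)) :
    ∃ π : ℕ ≃ ℕ, π 0 = 0 ∧ ∀ i, π (T.parent i) = T'.parent (π i) := by
  have h' : ∀ u v, ∃ f g : Λ → ℕ → ℕ, l u = l' v → ∀ t,
      (∀ i, 0 < i ∧ T.parent i = u ∧ l i = t →
        (0 < f t i ∧ T'.parent (f t i) = v ∧ l' (f t i) = t) ∧ g t (f t i) = i) ∧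
      (∀ i, 0 < i ∧ T'.parent i = v ∧ l' i = t →
        (0 < g t i ∧ T.parent (g t i) = u ∧ l (g t i) = t) ∧ f t (g t i) = i) := by
    intro u v
    by_cases huv : l u = l' v
    · choose f g hf hg using fun t => exists_inverse_maps (h u v huv t)
      exact ⟨f, g, fun _ t => ⟨hf t, hg t⟩⟩
    · exact ⟨fun _ => id, fun _ => id, fun h => absurd h huv⟩
  choose F G H using h'
  have e₁ := ParentTree.extend_spec (F := fun u v i => F u v (l i) i)
    (G := fun v u i => G u v (l' i) i) h0 (by
      intro u v huv i hi hu
      obtain ⟨⟨a, b, c⟩, d⟩ := (H u v huv (l i)).1 i ⟨hi, hu, rfl⟩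
      exact ⟨a, b, c, by simp only [c]; exact d⟩)
  have e₂ := ParentTree.extend_spec (F := fun v u i => G u v (l' i) i)
    (G := fun u v i => F u v (l i) i) h0.symm (by
      intro v u huv i hi hu
      obtain ⟨⟨a, b, c⟩, d⟩ := (H u v huv.symm (l' i)).2 i ⟨hi, hu, rfl⟩
      exact ⟨a, b, c, by simp only [c]; exact d⟩)
  exact ⟨⟨_, _, fun i => (e₁ i).2.1, fun i => (e₂ i).2.1⟩, by simp [extend],
    fun i => (e₁ i).2.2⟩


/-! ### Homomorphisms to the two-element algebra -/

/-- `φ` is a homomorphism to the two-element Boolean algebra. -/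
structure IsBoolHom (s i : ℕ → ℕ → ℕ) (c : ℕ → ℕ) (φ : ℕ → Bool) : Prop where
  map_sup : ∀ a b, φ (s a b) = (φ a || φ b)
  map_inf : ∀ a b, φ (i a b) = (φ a && φ b)
  map_compl : ∀ a, φ (c a) = !φ a

namespace ParentTree

variable {T : ParentTree}

theorem val_zero_left (x : ℕ) : T.val 0 x = false := by
  induction x using Nat.strong_induction_on with
  | _ x ih =>
    rcases Nat.eq_zero_or_pos x with rfl | hx
    · simp [val_zero]
    · simp [T.val_pos 0 hx, ih _ (T.parent_lt x hx)]

theorem val_xor (a b x : ℕ) : T.val (a ^^^ b) x = (T.val a x ^^ T.val b x) := by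
  induction x using Nat.strong_induction_on with
  | _ x ih =>
    rcases Nat.eq_zero_or_pos x with rfl | hx
    · rw [val_zero, val_zero, val_zero, Nat.testBit_xor]
    · rw [T.val_pos _ hx, T.val_pos _ hx, T.val_pos _ hx, ih _ (T.parent_lt x hx), Nat.testBit_xor]
      cases a.testBit x <;> cases b.testBit x <;> simp

theorem val_two_pow_of_lt {c x : ℕ} (h : x < c) : T.val (2 ^ c) x = false := by
  induction x using Nat.strong_induction_on with
  | _ x ih =>
    rcases Nat.eq_zero_or_pos x with rfl | hx
    · simp [val_zero, h.ne']
    · have := T.parent_lt x hx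
      simp [T.val_pos _ hx, h.ne', ih _ this (this.trans h)]

theorem val_two_pow_self (c : ℕ) : T.val (2 ^ c) c = true := by
  rcases Nat.eq_zero_or_pos c with rfl | hc
  · simp [val_zero]
  · simp [T.val_pos _ hc, val_two_pow_of_lt (T.parent_lt c hc)]

theorem val_two_pow_of_ne {c x : ℕ} (h : x ≠ c) (hx : 0 < x) :
    T.val (2 ^ c) x = T.val (2 ^ c) (T.parent x) := by
  simp [T.val_pos _ hx, h.symm]

theorem val_one (x : ℕ) : T.val (2 ^ 0) x = true := by
  induction x using Nat.strong_induction_on with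
  | _ x ih =>
    rcases Nat.eq_zero_or_pos x with rfl | hx
    · exact val_two_pow_self 0
    · rw [val_two_pow_of_ne hx.ne' hx, ih _ (T.parent_lt x hx)]

theorem IsBoolHom.map_zero {φ : ℕ → Bool} (hφ : IsBoolHom T.sup T.inf T.compl φ) :
    φ 0 = false := by
  have : T.inf 0 (T.compl 0) = 0 :=
    T.val_injective (funext fun x => by simp [val_inf, val_compl, val_zero_left])
  rw [← this, hφ.map_inf, hφ.map_compl]
  simp

theorem IsBoolHom.map_one {φ : ℕ → Bool} (hφ : IsBoolHom T.sup T.inf T.compl φ) :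
    φ (2 ^ 0) = true := by
  have : T.sup 0 (T.compl 0) = 2 ^ 0 :=
    T.val_injective (funext fun x => by rw [val_one]; simp [val_sup, val_compl])
  rw [← this, hφ.map_sup, hφ.map_compl]
  simp

theorem IsBoolHom.exists_testBit {φ : ℕ → Bool} (hφ : IsBoolHom T.sup T.inf T.compl φ) {w : ℕ}
    (hw : φ w = true) : ∃ i, w.testBit i = true ∧ φ (2 ^ i) = true := by
  suffices H : ∀ n w, φ w = true → (∀ j, n ≤ j → w.testBit j = false) →
      ∃ i, w.testBit i = true ∧ φ (2 ^ i) = true from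
    H w w hw fun j hj => Nat.testBit_lt_two_pow (hj.trans_lt Nat.lt_two_pow_self)
  intro n
  induction n with
  | zero =>
    intro w hw h
    have : w = 0 := Nat.eq_of_testBit_eq fun i => by simp [h i]
    rw [this, IsBoolHom.map_zero hφ] at hw
    exact absurd hw Bool.false_ne_true
  | succ n ih =>
    intro w hw h
    by_cases hn : w.testBit n = true
    · have hle : T.inf w (T.sup (w ^^^ 2 ^ n) (2 ^ n)) = w :=
        T.val_injective (funext fun x => by
          rw [val_inf, val_sup, val_xor]
          cases T.val w x <;> simp)
      rw [← hle, hφ.map_inf, hφ.map_sup] at hw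
      by_cases h2 : φ (2 ^ n) = true
      · exact ⟨n, hn, h2⟩
      · rw [Bool.not_eq_true] at h2
        rw [h2, Bool.or_false, Bool.and_eq_true] at hw
        obtain ⟨i, hi, hi'⟩ := ih (w ^^^ 2 ^ n) hw.2
          fun j hj => by
            rcases hj.eq_or_lt with rfl | hj
            · simp [Nat.testBit_xor, hn]
            · simp [Nat.testBit_xor, h j hj, hj.ne]
        refine ⟨i, ?_, hi'⟩
        by_cases hin : n = i
        · exact hin ▸ hn
        · simpa [Nat.testBit_xor, Nat.testBit_two_pow, hin] using hi
    · refine ih w hw fun j hj => ?_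
      rcases hj.eq_or_lt with rfl | hj
      · simpa using hn
      · exact h j hj

/-- In a well-founded tree every homomorphism to the two-element algebra is the evaluation at
some node. -/
theorem IsBoolHom.exists_eq_val
    (hT : WellFounded fun j i => 0 < j ∧ T.parent j = i) {φ : ℕ → Bool}
    (hφ : IsBoolHom T.sup T.inf T.compl φ) : ∃ m, φ = (T.val · m) := by
  by_contra! hne
  suffices H : ∀ m, φ (2 ^ m) = false by
    have := H 0
    rw [IsBoolHom.map_one hφ] at this
    exact absurd this.symm Bool.false_ne_true
  intro m
  induction m using hT.transGen.induction with
  | _ m ih =>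
    by_contra hm
    rw [Bool.not_eq_false] at hm
    obtain ⟨a, ha, ha'⟩ : ∃ a, φ a = false ∧ T.val a m = true := by
      obtain ⟨a, ha⟩ := Function.ne_iff.1 (hne m)
      rcases h : φ a
      · exact ⟨a, h, by simpa [h] using ha⟩
      · exact ⟨T.compl a, by simp [hφ.map_compl, h], by simpa [h, val_compl] using ha⟩
    obtain ⟨i, hi, hi'⟩ := IsBoolHom.exists_testBit hφ (w := T.inf (2 ^ m) (T.compl a))
      (by simp [hφ.map_inf, hφ.map_compl, hm, ha])
    have him : i ≠ m := by
      rintro rfl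
      rcases Nat.eq_zero_or_pos i with rfl | hi0
      · rw [← T.val_zero, val_inf, val_compl, ha'] at hi
        simp at hi
      · rw [T.testBit_eq_val _ hi0, val_inf, val_inf, val_compl, ha',
          val_two_pow_of_lt (T.parent_lt i hi0)] at hi
        simp at hi
    have hval : T.val (2 ^ m) i = true := by
      rcases Nat.eq_zero_or_pos i with rfl | hi0
      · rw [← T.val_zero, val_inf] at hi
        exact (Bool.and_eq_true _ _ ▸ hi).1
      · rw [T.testBit_eq_val _ hi0, val_inf, val_inf, ← val_two_pow_of_ne him hi0] at hi
        by_contra h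
        rw [Bool.not_eq_true] at h
        rw [h] at hi
        simp at hi
    suffices hlt : ∀ i, i ≠ m → T.val (2 ^ m) i = true →
        Relation.TransGen (fun j i => 0 < j ∧ T.parent j = i) i m by
      rw [ih i (hlt i him hval)] at hi'
      exact absurd hi' Bool.false_ne_true
    intro i
    induction i using Nat.strong_induction_on with
    | _ i ihi =>
      intro him hval
      rcases Nat.eq_zero_or_pos i with rfl | hi0
      · rw [val_two_pow_of_lt (Nat.pos_of_ne_zero him.symm)] at hval
        exact absurd hval Bool.false_ne_true
      · by_cases hpm : T.parent i = m
        · exact .single ⟨hi0, hpm⟩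
        · rw [val_two_pow_of_ne him hi0] at hval
          exact .head ⟨hi0, rfl⟩ (ihi _ (T.parent_lt i hi0) hpm hval)

/-- The cones above two distinct siblings are disjoint. -/
theorem inf_two_pow_eq_zero {c d : ℕ} (hc : 0 < c) (hd : 0 < d) (hcd : c ≠ d)
    (h : T.parent c = T.parent d) : T.inf (2 ^ c) (2 ^ d) = 0 := by
  refine T.val_injective (funext fun x => ?_)
  rw [val_inf, val_zero_left]
  induction x using Nat.strong_induction_on with
  | _ x ih =>
    by_cases hxc : x = c
    · rw [hxc, val_two_pow_of_ne hcd hc, h, val_two_pow_of_lt (T.parent_lt d hd), Bool.and_false]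
    by_cases hxd : x = d
    · rw [hxd, val_two_pow_of_ne hcd.symm hd, ← h, val_two_pow_of_lt (T.parent_lt c hc),
        Bool.false_and]
    rcases Nat.eq_zero_or_pos x with rfl | hx
    · rw [val_two_pow_of_lt hc, Bool.false_and]
    · rw [val_two_pow_of_ne hxc hx, val_two_pow_of_ne hxd hx, ih _ (T.parent_lt x hx)]

/-- If a tree contains a full binary tree, no sequence of homomorphisms from its algebra to the
two-element algebra exhausts them. -/
theorem exists_isBoolHom_forall_ne {P : ℕ → Prop} (h0 : ∃ x, P x)
    (hP : ∀ x, P x → ∃ c d, P c ∧ P d ∧ 0 < c ∧ 0 < d ∧ c ≠ d ∧ T.parent c = x ∧ T.parent d = x)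
    (h : ℕ → ℕ → Bool) (hh : ∀ n, IsBoolHom T.sup T.inf T.compl (h n)) :
    ∃ ψ, IsBoolHom T.sup T.inf T.compl ψ ∧ ∀ n, ψ ≠ h n := by
  have hstep : ∀ (n : ℕ) (x : {x // P x}), ∃ y : {x // P x},
      0 < y.1 ∧ T.parent y.1 = x.1 ∧ h n (2 ^ y.1) = false := by
    rintro n ⟨x, hx⟩
    obtain ⟨c, d, hPc, hPd, hc, hd, hcd, hcx, hdx⟩ := hP x hx
    have := (hh n).map_inf (2 ^ c) (2 ^ d)
    rw [inf_two_pow_eq_zero hc hd hcd (hcx.trans hdx.symm), IsBoolHom.map_zero (hh n)] at this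
    rcases hhc : h n (2 ^ c)
    · exact ⟨⟨c, hPc⟩, hc, hcx, hhc⟩
    · exact ⟨⟨d, hPd⟩, hd, hdx, by simpa [hhc] using this.symm⟩
  choose next hpos hpar hfalse using hstep
  obtain ⟨x₀, hx₀⟩ := h0
  let X : ℕ → {x // P x} := fun n => n.rec ⟨x₀, hx₀⟩ next
  have hXpos : ∀ n, 0 < (X (n + 1)).1 := fun n => hpos n (X n)
  have hXpar : ∀ n, T.parent (X (n + 1)).1 = (X n).1 := fun n => hpar n (X n)
  have hXfalse : ∀ n, h n (2 ^ (X (n + 1)).1) = false := fun n => hfalse n (X n)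
  have hmono : StrictMono fun n => (X n).1 :=
    strictMono_nat_of_lt_succ fun n => by
      have := T.parent_lt _ (hXpos n)
      rwa [hXpar] at this
  have hconst : ∀ a k, T.val a (X (a + k)).1 = T.val a (X a).1 := by
    intro a k
    induction k with
    | zero => rfl
    | succ k ih =>
      rw [← ih, ← hXpar (a + k)]
      exact T.val_eq_val_parent
        ((Nat.lt_succ_of_le (Nat.le_add_right a k)).trans_le (hmono.le_apply (x := a + k + 1)))
  have hψ : ∀ a N, a ≤ N → T.val a (X a).1 = T.val a (X N).1 := by
    intro a N h
    obtain ⟨k, rfl⟩ := Nat.exists_eq_add_of_le h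
    exact (hconst a k).symm
  refine ⟨fun a => T.val a (X a).1, ⟨fun a b => ?_, fun a b => ?_, fun a => ?_⟩, fun n hn => ?_⟩
  · have h1 := hψ a (a + b + T.sup a b) (by omega)
    have h2 := hψ b (a + b + T.sup a b) (by omega)
    have h3 := hψ (T.sup a b) (a + b + T.sup a b) (by omega)
    rw [h1, h2, h3, val_sup]
  · have h1 := hψ a (a + b + T.inf a b) (by omega)
    have h2 := hψ b (a + b + T.inf a b) (by omega)
    have h3 := hψ (T.inf a b) (a + b + T.inf a b) (by omega)
    rw [h1, h2, h3, val_inf]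
  · have h1 := hψ a (a + T.compl a) (by omega)
    have h3 := hψ (T.compl a) (a + T.compl a) (by omega)
    rw [h1, h3, val_compl]
  · have h1 := congrFun hn (2 ^ (X (n + 1)).1)
    rw [hXfalse] at h1
    have h2 : ∀ k, T.val (2 ^ (X (n + 1)).1) (X (n + 1 + k)).1 = true := by
      intro k
      induction k with
      | zero => exact val_two_pow_self _
      | succ k ih =>
        rw [← ih, ← hXpar (n + 1 + k)]
        exact val_two_pow_of_ne (hmono (show n + 1 < n + 1 + k + 1 by omega)).ne' (hXpos _)
    have h3 : n + 1 ≤ 2 ^ (X (n + 1)).1 := (hmono.le_apply (x := n + 1)).trans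
      Nat.lt_two_pow_self.le
    obtain ⟨k, hk⟩ := Nat.exists_eq_add_of_le h3
    have h4 := h2 k
    rw [← hk] at h4
    exact Bool.false_ne_true (h1.symm.trans h4)

theorem not_baIso_of_wellFounded {T' : ParentTree}
    (hT : WellFounded fun j i => 0 < j ∧ T.parent j = i) {P : ℕ → Prop} (h0 : ∃ x, P x)
    (hP : ∀ x, P x →
      ∃ c d, P c ∧ P d ∧ 0 < c ∧ 0 < d ∧ c ≠ d ∧ T'.parent c = x ∧ T'.parent d = x) :
    ¬ BAIso T.sup T.inf T.compl T'.sup T'.inf T'.compl := by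
  rintro ⟨π, hs, hi, hc⟩
  have hs' : ∀ a b, π.symm (T'.sup a b) = T.sup (π.symm a) (π.symm b) := fun a b => by
    simp [Equiv.symm_apply_eq, hs]
  have hi' : ∀ a b, π.symm (T'.inf a b) = T.inf (π.symm a) (π.symm b) := fun a b => by
    simp [Equiv.symm_apply_eq, hi]
  have hc' : ∀ a, π.symm (T'.compl a) = T.compl (π.symm a) := fun a => by
    simp [Equiv.symm_apply_eq, hc]
  obtain ⟨ψ, hψ, hne⟩ := exists_isBoolHom_forall_ne (T := T') h0 hP
    (fun n b => T.val (π.symm b) n)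
    fun n => ⟨fun a b => by rw [hs', val_sup], fun a b => by rw [hi', val_inf],
      fun a => by rw [hc', val_compl]⟩
  have hφ : IsBoolHom T.sup T.inf T.compl fun a => ψ (π a) :=
    ⟨fun a b => by rw [hs, hψ.map_sup], fun a b => by rw [hi, hψ.map_inf],
      fun a => by rw [hc, hψ.map_compl]⟩
  obtain ⟨m, hm⟩ := IsBoolHom.exists_eq_val hT hφ
  refine hne m (funext fun b => ?_)
  have := congrFun hm (π.symm b)
  simpa using this

end ParentTree

/-! ### Trees of states -/

section StateTree

variable {σ : Type*} [Denumerable σ] (r : σ → σ → Bool) (L : σ)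

/-- The state at a node of the tree generated by the successor relation `r`. Below the root there
are infinitely many nodes with state `L`, and below a node with state `x` there are infinitely
many nodes with state `y` for each `y` with `r x y`. -/
def stateAt : ℕ → σ
  | 0 => L
  | m + 1 =>
    if 0 < m.unpair.1 ∧ r (stateAt m.unpair.1) (Denumerable.ofNat σ m.unpair.2.unpair.1) = true
    then Denumerable.ofNat σ m.unpair.2.unpair.1 else L
decreasing_by exact Nat.lt_succ_of_le (Nat.unpair_left_le m)

/-- The node `m + 1` is attached below the node that `m` codes. -/
def IsAttached (m : ℕ) : Prop :=
  0 < m.unpair.1 ∧ r (stateAt r L m.unpair.1) (Denumerable.ofNat σ m.unpair.2.unpair.1) = true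

instance : DecidablePred (IsAttached r L) := fun _ => inferInstanceAs (Decidable (_ ∧ _))

theorem stateAt_succ (m : ℕ) : stateAt r L (m + 1) =
    if IsAttached r L m then Denumerable.ofNat σ m.unpair.2.unpair.1 else L := by
  rw [stateAt]
  rfl

/-- The tree generated by the successor relation `r` from the state `L`. -/
def stateTree : ParentTree where
  parent i := i.casesOn 0 fun m => if IsAttached r L m then m.unpair.1 else 0
  parent_zero := rfl
  parent_lt i hi := by
    obtain ⟨m, rfl⟩ := Nat.exists_eq_succ_of_ne_zero hi.ne'
    change (if IsAttached r L m then m.unpair.1 else 0) < m + 1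
    split_ifs
    · exact Nat.lt_succ_of_le (Nat.unpair_left_le m)
    · exact m.succ_pos

theorem stateTree_parent_succ (m : ℕ) :
    (stateTree r L).parent (m + 1) = if IsAttached r L m then m.unpair.1 else 0 := rfl

variable {r L}

theorem stateTree_child {j : ℕ} {M : σ} (hj : 0 < j) (h : r (stateAt r L j) M = true) (k : ℕ) :
    (stateTree r L).parent (Nat.pair j (Nat.pair (Encodable.encode M) k) + 1) = j ∧
      stateAt r L (Nat.pair j (Nat.pair (Encodable.encode M) k) + 1) = M := by
  have : IsAttached r L (Nat.pair j (Nat.pair (Encodable.encode M) k)) := by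
    simp [IsAttached, hj, h]
  rw [stateTree_parent_succ, stateAt_succ, if_pos this, if_pos this]
  simp

theorem stateTree_child_zero (k : ℕ) :
    (stateTree r L).parent (Nat.pair 0 k + 1) = 0 ∧ stateAt r L (Nat.pair 0 k + 1) = L := by
  have : ¬ IsAttached r L (Nat.pair 0 k) := by simp [IsAttached]
  rw [stateTree_parent_succ, stateAt_succ, if_neg this, if_neg this]
  exact ⟨rfl, rfl⟩

theorem stateAt_of_parent_eq_zero {i : ℕ} (h : (stateTree r L).parent i = 0) :
    stateAt r L i = L := by
  cases i with
  | zero => rw [stateAt]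
  | succ m =>
    rw [stateTree_parent_succ] at h
    rw [stateAt_succ]
    by_cases hm : IsAttached r L m
    · rw [if_pos hm] at h
      exact absurd h hm.1.ne'
    · rw [if_neg hm]

theorem rel_stateAt {i : ℕ} (h : 0 < (stateTree r L).parent i) :
    r (stateAt r L ((stateTree r L).parent i)) (stateAt r L i) = true := by
  cases i with
  | zero => exact absurd h (lt_irrefl 0)
  | succ m =>
    rw [stateTree_parent_succ] at h ⊢
    rw [stateAt_succ]
    by_cases hm : IsAttached r L m
    · rw [if_pos hm, if_pos hm]
      exact hm.2
    · rw [if_neg hm] at h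
      exact absurd h (lt_irrefl 0)

theorem stateTree_children {Λ : Type*} (lab : σ → Λ) (t : Option Λ) (u : ℕ) :
    let C := {i | 0 < i ∧ (stateTree r L).parent i = u ∧
      (if i = 0 then none else some (lab (stateAt r L i))) = t}
    ((∃ M, (if u = 0 then M = L else r (stateAt r L u) M = true) ∧ t = some (lab M)) →
      C.Infinite) ∧
    ((¬ ∃ M, (if u = 0 then M = L else r (stateAt r L u) M = true) ∧ t = some (lab M)) →
      C = ∅) := by
  intro C
  constructor
  · rintro ⟨M, hM, rfl⟩
    rcases Nat.eq_zero_or_pos u with rfl | hu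
    · rw [if_pos rfl] at hM
      subst hM
      refine Set.infinite_of_injective_forall_mem (f := fun k => Nat.pair 0 k + 1) ?_ fun k => ?_
      · intro a b hab
        exact (Nat.pair_eq_pair.1 (Nat.succ.inj hab)).2
      · obtain ⟨h1, h2⟩ := stateTree_child_zero (r := r) (L := M) k
        exact ⟨Nat.succ_pos _, h1, by rw [if_neg (Nat.succ_ne_zero _), h2]⟩
    · rw [if_neg hu.ne'] at hM
      refine Set.infinite_of_injective_forall_mem
        (f := fun k => Nat.pair u (Nat.pair (Encodable.encode M) k) + 1) ?_ fun k => ?_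
      · intro a b hab
        exact (Nat.pair_eq_pair.1 (Nat.pair_eq_pair.1 (Nat.succ.inj hab)).2).2
      · obtain ⟨h1, h2⟩ := stateTree_child hu hM k
        exact ⟨Nat.succ_pos _, h1, by rw [if_neg (Nat.succ_ne_zero _), h2]⟩
  · intro h
    refine Set.eq_empty_of_forall_notMem fun i hi => h ?_
    obtain ⟨hi, rfl, rfl⟩ := hi
    refine ⟨stateAt r L i, ?_, by rw [if_neg hi.ne']⟩
    split_ifs with h0
    · exact stateAt_of_parent_eq_zero h0
    · exact rel_stateAt (Nat.pos_of_ne_zero h0)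

/-- States with the same label for a labelling that is a bisimulation generate isomorphic
Boolean algebras. -/
theorem baIso_stateTree {Λ : Type*} {lab : σ → Λ}
    (hlab : ∀ x x' y, lab x = lab x' → r x y = true → ∃ y', r x' y' = true ∧ lab y' = lab y)
    {L' : σ} (hL : lab L = lab L') :
    BAIso (stateTree r L).sup (stateTree r L).inf (stateTree r L).compl
      (stateTree r L').sup (stateTree r L').inf (stateTree r L').compl := by
  obtain ⟨π, h0, hπ⟩ := ParentTree.exists_equiv (T := stateTree r L) (T' := stateTree r L')
    (l := fun i => if i = 0 then none else some (lab (stateAt r L i)))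
    (l' := fun i => if i = 0 then none else some (lab (stateAt r L' i))) (by simp) (by
      intro u v huv t
      obtain ⟨h1, h2⟩ := stateTree_children (r := r) (L := L) lab t u
      obtain ⟨h1', h2'⟩ := stateTree_children (r := r) (L := L') lab t v
      have key : (∃ M, (if u = 0 then M = L else r (stateAt r L u) M = true) ∧ t = some (lab M)) ↔
          ∃ M, (if v = 0 then M = L' else r (stateAt r L' v) M = true) ∧ t = some (lab M) := by
        by_cases hu : u = 0 <;> by_cases hv : v = 0
        · simp [hu, hv, hL]
        · simp [hu, hv] at huv
        · simp [hu, hv] at huv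
        · simp only [hu, hv, if_false, Option.some.injEq] at huv ⊢
          constructor
          · rintro ⟨M, hM, rfl⟩
            obtain ⟨M', hM', h⟩ := hlab _ _ M huv hM
            exact ⟨M', hM', by rw [h]⟩
          · rintro ⟨M, hM, rfl⟩
            obtain ⟨M', hM', h⟩ := hlab _ _ M huv.symm hM
            exact ⟨M', hM', by rw [h]⟩
      by_cases h : ∃ M, (if u = 0 then M = L else r (stateAt r L u) M = true) ∧ t = some (lab M)
      · exact .inr ⟨h1 h, h1' (key.1 h)⟩
      · exact .inl ⟨h2 h, h2' fun h' => h (key.2 h')⟩)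
  exact ParentTree.baIso_of_equiv π h0 hπ

/-- A state without infinite descent and a state that is its own successor generate
non-isomorphic Boolean algebras. -/
theorem not_baIso_stateTree {M : σ} (hL : Acc (fun y x => r x y = true) L) (hM : r M M = true) :
    ¬ BAIso (stateTree r L).sup (stateTree r L).inf (stateTree r L).compl
      (stateTree r M).sup (stateTree r M).inf (stateTree r M).compl := by
  have hacc : ∀ x, Acc (fun y x => r x y = true) x → ∀ i, 0 < i → stateAt r L i = x →
      Acc (fun j i => 0 < j ∧ (stateTree r L).parent j = i) i := by
    intro x hx
    induction hx with
    | intro x _ ih =>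
      rintro i hi rfl
      refine ⟨i, ?_⟩
      rintro j ⟨hj, rfl⟩
      exact ih _ (rel_stateAt hi) j hj rfl
  have hstate : ∀ i, Acc (fun y x => r x y = true) (stateAt r L i) := by
    intro i
    induction i using Nat.strong_induction_on with
    | _ i ih =>
      rcases Nat.eq_zero_or_pos i with rfl | hi
      · rwa [stateAt_of_parent_eq_zero rfl]
      · rcases Nat.eq_zero_or_pos ((stateTree r L).parent i) with h | h
        · rwa [stateAt_of_parent_eq_zero h]
        · exact (ih _ ((stateTree r L).parent_lt i hi)).inv (rel_stateAt h)
  refine ParentTree.not_baIso_of_wellFounded ⟨fun i => ?_⟩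
    (P := fun x => 0 < x ∧ stateAt r M x = M)
    ⟨_, Nat.succ_pos _, (stateTree_child_zero 0).2⟩ ?_
  · rcases Nat.eq_zero_or_pos i with rfl | hi
    · refine ⟨0, ?_⟩
      rintro j ⟨hj, -⟩
      exact hacc _ (hstate j) j hj rfl
    · exact hacc _ (hstate i) i hi rfl
  · rintro x ⟨hx, hxM⟩
    have h := stateTree_child (r := r) (L := M) (M := M) hx (by rw [hxM, hM])
    refine ⟨_, _, ⟨Nat.succ_pos _, (h 0).2⟩, ⟨Nat.succ_pos _, (h 1).2⟩, Nat.succ_pos _,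
      Nat.succ_pos _, ?_, (h 0).1, (h 1).1⟩
    simp

end StateTree

/-! ### Finite collections of states and their ranks -/

/-- Each state in `L` has a successor in `M`. -/
def Steps {β : Type*} (b : β → β → Prop) (L M : List β) : Prop :=
  ∀ x ∈ L, ∃ y ∈ M, b x y

section Steps

variable {β : Type*} {b : β → β → Prop}

theorem Steps.trans (hb : ∀ x y z, b x y → b y z → b x z) {L M N : List β} (h : Steps b L M)
    (h' : Steps b M N) : Steps b L N := by
  intro x hx
  obtain ⟨y, hy, hxy⟩ := h x hx
  obtain ⟨z, hz, hyz⟩ := h' y hy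
  exact ⟨z, hz, hb _ _ _ hxy hyz⟩

theorem Steps.append {L L' M M' : List β} (h : Steps b L M) (h' : Steps b L' M') :
    Steps b (L ++ L') (M ++ M') := by
  intro x hx
  rcases List.mem_append.1 hx with hx | hx
  · obtain ⟨y, hy, hxy⟩ := h x hx
    exact ⟨y, List.mem_append_left _ hy, hxy⟩
  · obtain ⟨y, hy, hxy⟩ := h' x hx
    exact ⟨y, List.mem_append_right _ hy, hxy⟩

/-- A list of states without accessible elements steps to another such list. -/
theorem exists_steps_of_forall_not_acc {L : List β} (hL : ∀ x ∈ L, ¬ Acc (fun y x => b x y) x) :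
    ∃ M, Steps b L M ∧ ∀ y ∈ M, ¬ Acc (fun y x => b x y) y := by
  have h : ∀ x, ∃ y, x ∈ L → b x y ∧ ¬ Acc (fun y x => b x y) y := by
    intro x
    by_cases hx : x ∈ L
    · by_contra! h
      exact hL x hx ⟨x, fun y hy => by_contra fun hn => hn ((h y).2 hy)⟩
    · exact ⟨x, fun h => absurd h hx⟩
  choose f hf using h
  refine ⟨L.map f, fun x hx => ⟨f x, List.mem_map_of_mem hx, (hf x hx).1⟩, fun y hy => ?_⟩
  obtain ⟨x, hx, rfl⟩ := List.mem_map.1 hy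
  exact (hf x hx).2

theorem acc_steps_iff {L : List β} :
    Acc (fun M L => Steps b L M) L ↔ ∃ x ∈ L, Acc (fun y x => b x y) x := by
  constructor
  · intro h
    induction h with
    | intro L _ ih =>
      by_contra! hL
      obtain ⟨M, hM, hM'⟩ := exists_steps_of_forall_not_acc hL
      obtain ⟨y, hy, hy'⟩ := ih M hM
      exact hM' y hy hy'
  · rintro ⟨x, hx, hacc⟩
    induction hacc generalizing L with
    | intro x _ ih =>
      refine ⟨L, fun M hM => ?_⟩
      obtain ⟨y, hy, hxy⟩ := hM x hx
      exact ih y hxy hy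

theorem Acc.rank_le_of_forall {α : Type*} {r : α → α → Prop} {x : α} (hx : Acc r x)
    {o : Ordinal} (h : ∀ y (hy : r y x), (hx.inv hy).rank < o) : hx.rank ≤ o := by
  rw [hx.rank_eq, Ordinal.iSup_le_iff]
  rintro ⟨y, hy⟩
  exact Order.succ_le_of_lt (h y hy)

theorem Acc.exists_rank_eq {α : Type*} {r : α → α → Prop} (hr : ∀ x y z, r x y → r y z → r x z)
    {x : α} (hx : Acc r x) {o : Ordinal} (ho : o < hx.rank) :
    ∃ (y : α) (hy : r y x), (hx.inv hy).rank = o := by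
  induction hx with
  | intro x hx ih =>
    rw [Acc.rank_eq, Ordinal.lt_iSup_iff] at ho
    obtain ⟨⟨y, hy⟩, ho⟩ := ho
    rcases (Order.lt_succ_iff.1 ho).eq_or_lt with h | h
    · exact ⟨y, hy, h.symm⟩
    · obtain ⟨z, hz, h⟩ := ih y hy h
      exact ⟨z, hr _ _ _ hz hy, h⟩

/-- Adding elements without rank to a list does not change its rank. -/
theorem rank_append {K M : List β} (hK : ∀ x ∈ K, ¬ Acc (fun y x => b x y) x)
    (hM : Acc (fun M L => Steps b L M) M) (hKM : Acc (fun M L => Steps b L M) (K ++ M)) :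
    hKM.rank = hM.rank := by
  apply le_antisymm
  · refine Acc.rank_le_of_forall hKM fun N hN => ?_
    exact hM.rank_lt_of_rel fun x hx => hN x (List.mem_append_right _ hx)
  · induction hM generalizing K with
    | intro M hM ih =>
      refine Acc.rank_le_of_forall _ fun N hN => ?_
      obtain ⟨K', hKK', hK'⟩ := exists_steps_of_forall_not_acc hK
      have hN' : Steps b (K ++ M) (K' ++ N) := hKK'.append hN
      exact (ih N hN hK' (hKM.inv hN')).trans_lt (hKM.rank_lt_of_rel hN')

open Classical in
/-- The rank of a list of states, if it has one. -/
noncomputable def stepsRank (b : β → β → Prop) (L : List β) : Option Ordinal :=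
  if h : Acc (fun M L => Steps b L M) L then some h.rank else none

theorem stepsRank_of_acc {L : List β} (h : Acc (fun M L => Steps b L M) L) :
    stepsRank b L = some h.rank := dif_pos h

theorem stepsRank_of_not_acc {L : List β} (h : ¬ Acc (fun M L => Steps b L M) L) :
    stepsRank b L = none := dif_neg h

theorem exists_steps_stepsRank_eq (hb : ∀ x y z, b x y → b y z → b x z) {L L' M : List β}
    (h : stepsRank b L = stepsRank b L') (hM : Steps b L M) :
    ∃ M', Steps b L' M' ∧ stepsRank b M' = stepsRank b M := by
  by_cases hL : Acc (fun M L => Steps b L M) L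
  · have hL' : Acc (fun M L => Steps b L M) L' := by
      by_contra hL'
      rw [stepsRank_of_acc hL, stepsRank_of_not_acc hL'] at h
      exact Option.some_ne_none _ h
    rw [stepsRank_of_acc hL, stepsRank_of_acc hL', Option.some.injEq] at h
    have hlt : (hL.inv hM).rank < hL'.rank := (hL.rank_lt_of_rel hM).trans_eq h
    obtain ⟨M', hM', h'⟩ := Acc.exists_rank_eq (r := fun M L => Steps b L M)
      (fun _ _ _ h h' => Steps.trans hb h' h) hL' hlt
    exact ⟨M', hM', by rw [stepsRank_of_acc (hL.inv hM), stepsRank_of_acc (hL'.inv hM'), h']⟩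
  · have hL' : ¬ Acc (fun M L => Steps b L M) L' := by
      intro hL'
      rw [stepsRank_of_acc hL', stepsRank_of_not_acc hL] at h
      exact Option.some_ne_none _ h.symm
    obtain ⟨K, hK, hK'⟩ := exists_steps_of_forall_not_acc (b := b) (L := L')
      fun x hx hacc => hL' (acc_steps_iff.2 ⟨x, hx, hacc⟩)
    by_cases hM' : Acc (fun M L => Steps b L M) M
    · have hKM : Acc (fun M L => Steps b L M) (K ++ M) := by
        obtain ⟨x, hx, hacc⟩ := acc_steps_iff.1 hM'
        exact acc_steps_iff.2 ⟨x, List.mem_append_right _ hx, hacc⟩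
      refine ⟨K ++ M, fun x hx => ?_, ?_⟩
      · obtain ⟨y, hy, hxy⟩ := hK x hx
        exact ⟨y, List.mem_append_left _ hy, hxy⟩
      · rw [stepsRank_of_acc hM', stepsRank_of_acc hKM, rank_append hK' hM' hKM]
    · refine ⟨K, hK, ?_⟩
      rw [stepsRank_of_not_acc hM', stepsRank_of_not_acc]
      intro hacc
      obtain ⟨x, hx, hx'⟩ := acc_steps_iff.1 hacc
      exact hK' x hx hx'

end Steps

/-! ### A universal relation -/

/-- `Extends x y`: the codes of `x` and `y` agree, the sequence of `y` properly extends that of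
`x`, and the code is not seen to reject an initial segment of the sequence of `y`. -/
def Extends (x y : Nat.Partrec.Code × List ℕ) : Prop :=
  x.1 = y.1 ∧ x.2 = y.2.take x.2.length ∧ x.2.length < y.2.length ∧
    ∀ i < y.2.length + 1, y.1.evaln y.2.length (Encodable.encode (y.2.take i)) ≠ some 0

instance : DecidableRel Extends := fun x y =>
  have : Decidable (x.1 = y.1) := Encodable.decidableEqOfEncodable _ _ _
  inferInstanceAs (Decidable (_ ∧ _ ∧ _ ∧ _))

theorem Extends.trans (x y z : Nat.Partrec.Code × List ℕ) (h : Extends x y) (h' : Extends y z) :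
    Extends x z := by
  obtain ⟨h1, h2, h3, -⟩ := h
  obtain ⟨h1', h2', h3', h4'⟩ := h'
  refine ⟨h1.trans h1', ?_, h3.trans h3', h4'⟩
  have := h2
  rw [h2', List.take_take, min_eq_left h3.le] at this
  exact this

/-- A code accepting or rejecting every finite sequence accepts all initial segments of some
infinite sequence exactly if the empty sequence has an infinite descent of extensions. -/
theorem not_acc_extends_iff {c : Nat.Partrec.Code} {R : List ℕ → Bool}
    (hc : ∀ l, c.eval (Encodable.encode l) = Part.some (Encodable.encode (R l))) :
    (¬ Acc (fun y x => Extends x y) (c, [])) ↔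
      ∃ f : ℕ → ℕ, ∀ k, R ((List.range k).map f) = true := by
  rw [not_acc_iff_exists_descending_chain]
  have htake : ∀ (f : ℕ → ℕ) {i n : ℕ}, i ≤ n →
      ((List.range n).map f).take i = (List.range i).map f := by
    intro f i n h
    rw [← List.map_take, List.take_range, min_eq_left h]
  constructor
  · rintro ⟨g, h0, hg⟩
    have hcode : ∀ n, (g n).1 = c := by
      intro n
      induction n with
      | zero => rw [h0]
      | succ n ih => rw [← (hg n).1, ih]
    have hlen : StrictMono fun n => (g n).2.length := strictMono_nat_of_lt_succ fun n => (hg n).2.2.1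
    have hpre : ∀ n k, (g n).2 = (g (n + k)).2.take (g n).2.length := by
      intro n k
      induction k with
      | zero => simp
      | succ k ih =>
        rw [(hg (n + k)).2.1, List.take_take,
          min_eq_left (hlen.monotone (Nat.le_add_right n k))] at ih
        exact ih
    have hpre' : ∀ m n i, i ≤ (g m).2.length → i ≤ (g n).2.length →
        (g m).2.take i = (g n).2.take i := by
      intro m n i hm hn
      rw [hpre m n, hpre n m, List.take_take, List.take_take, min_eq_left hm, min_eq_left hn,
        Nat.add_comm]
    refine ⟨fun i => (g (i + 1)).2.getD i 0, fun k => ?_⟩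
    have hf : ∀ n, (List.range k).map (fun i => (g (i + 1)).2.getD i 0) = (g (k + n)).2.take k := by
      intro n
      have hk : k ≤ (g (k + n)).2.length := (Nat.le_add_right k n).trans hlen.le_apply
      refine List.ext_getElem (by simp [hk]) fun i h1 h2 => ?_
      have hi : i < k := by simpa using h1
      have hi' : i < (g (i + 1)).2.length := hlen.le_apply (x := i + 1)
      have := congrArg (·[i]?) (hpre' (i + 1) (k + n) (i + 1) hi' (hi.trans_le hk))
      simp only [List.getElem?_take, Nat.lt_succ_self, if_true] at this
      rw [List.getElem_map, List.getElem_range, List.getElem_take, List.getD_eq_getElem?_getD, this,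
        List.getElem?_eq_getElem (hi.trans_le hk), Option.getD_some]
    by_contra hR
    have hev : 0 ∈ c.eval (Encodable.encode
        ((List.range k).map fun i => (g (i + 1)).2.getD i 0)) := by
      rw [hc, Bool.eq_false_iff.2 hR]
      exact Part.mem_some _
    obtain ⟨m, hm⟩ := Nat.Partrec.Code.evaln_complete.1 hev
    have hle : k + (m + 1) ≤ (g (k + (m + 1))).2.length := hlen.le_apply
    have := (hg (k + m)).2.2.2 k (by rw [Nat.add_assoc]; omega)
    rw [hcode, Nat.add_assoc, ← hf (m + 1)] at this
    exact this (Nat.Partrec.Code.evaln_mono (by omega) hm)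
  · rintro ⟨f, hf⟩
    refine ⟨fun n => (c, (List.range n).map f), rfl, fun n => ⟨rfl, ?_, ?_, fun i hi h => ?_⟩⟩
    · simp only [List.length_map, List.length_range]
      rw [htake f n.le_succ]
    · simp
    · simp only [List.length_map, List.length_range] at hi h
      have := Nat.Partrec.Code.evaln_sound h
      rw [htake f (Nat.le_of_lt_succ hi), hc, hf] at this
      simp at this

/-- The decidable form of `Steps Extends`. -/
def stepsExtends (L M : List (Nat.Partrec.Code × List ℕ)) : Bool :=
  decide (∀ x ∈ L, ∃ y ∈ M, Extends x y)

theorem stepsExtends_iff {L M : List (Nat.Partrec.Code × List ℕ)} :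
    stepsExtends L M = true ↔ Steps Extends L M := decide_eq_true_iff

theorem baIso_stateTree_stepsExtends_iff {L : List (Nat.Partrec.Code × List ℕ)} :
    BAIso (stateTree stepsExtends L).sup (stateTree stepsExtends L).inf
        (stateTree stepsExtends L).compl (stateTree stepsExtends []).sup
        (stateTree stepsExtends []).inf (stateTree stepsExtends []).compl ↔
      ∀ x ∈ L, ¬ Acc (fun y x => Extends x y) x := by
  have hnil : ¬ Acc (fun M L => Steps Extends L M) [] := by simp [acc_steps_iff]
  have hL : (∀ x ∈ L, ¬ Acc (fun y x => Extends x y) x) ↔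
      ¬ Acc (fun M L => Steps Extends L M) L := by
    rw [acc_steps_iff]
    push Not
    rfl
  rw [hL]
  constructor
  · intro h hacc
    refine not_baIso_stateTree (r := stepsExtends) ?_ ?_ h
    · simpa only [stepsExtends_iff] using hacc
    · simp [stepsExtends]
  · intro h
    refine baIso_stateTree (lab := stepsRank Extends) ?_ ?_
    · simp only [stepsExtends_iff]
      exact fun _ _ _ => exists_steps_stepsRank_eq Extends.trans
    · rw [stepsRank_of_not_acc h, stepsRank_of_not_acc hnil]

/-! ### Computability of the Boolean algebras -/

theorem primrec_pow : Primrec₂ fun a b : ℕ => a ^ b :=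
  Primrec₂.unpaired'.1 Nat.Primrec.pow

theorem primrec_testBit : Primrec₂ Nat.testBit := by
  refine Primrec₂.of_eq (f := fun a n => decide (a / 2 ^ n % 2 = 1)) ?_
    fun a n => Nat.testBit_eq_decide_div_mod_eq.symm
  exact (Primrec.eq.comp (Primrec.nat_mod.comp (Primrec.nat_div.comp Primrec.fst
    (primrec_pow.comp (Primrec.const 2) Primrec.snd)) (Primrec.const 2)) (Primrec.const 1)).decide

theorem primrec_natOfBits {α : Type*} [Primcodable α] {f : α → ℕ → Bool} {n : α → ℕ}
    (hf : Primrec₂ f) (hn : Primrec n) : Primrec fun a => natOfBits (f a) (n a) := by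
  refine Primrec.nat_rec' (h := fun a p => 2 ^ p.1 * (f a p.1).toNat + p.2) hn
    (Primrec.const 0) ?_
  have hk : Primrec fun q : α × ℕ × ℕ => q.2.1 := Primrec.fst.comp Primrec.snd
  exact Primrec.nat_add.comp (Primrec.nat_mul.comp (primrec_pow.comp (Primrec.const 2) hk)
    ((Primrec.dom_bool Bool.toNat).comp (hf.comp Primrec.fst hk)))
    (Primrec.snd.comp Primrec.snd)

section StateTree

variable {σ : Type*} [Denumerable σ] {r : σ → σ → Bool}

theorem primrec_stateAt (hr : Primrec₂ r) : Primrec₂ (stateAt r) := by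
  have hm : Primrec fun p : σ × List σ => p.2.length - 1 :=
    Primrec.nat_sub.comp (Primrec.list_length.comp Primrec.snd) (Primrec.const 1)
  have hj := Primrec.fst.comp (Primrec.unpair.comp hm)
  have hM : Primrec fun p : σ × List σ =>
      Denumerable.ofNat σ (p.2.length - 1).unpair.2.unpair.1 :=
    (Primrec.ofNat σ).comp
      (Primrec.fst.comp (Primrec.unpair.comp (Primrec.snd.comp (Primrec.unpair.comp hm))))
  have hs := Primrec.option_getD.comp (Primrec.list_getElem?.comp Primrec.snd hj)
    (Primrec.fst (α := σ) (β := List σ))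
  refine Primrec.nat_strong_rec (stateAt r)
    (g := fun L l => some (bif decide (0 < (l.length - 1).unpair.1) &&
      r ((l[(l.length - 1).unpair.1]?).getD L)
        (Denumerable.ofNat σ (l.length - 1).unpair.2.unpair.1)
      then Denumerable.ofNat σ (l.length - 1).unpair.2.unpair.1 else L)) ?_ ?_
  · exact Primrec.option_some.comp (Primrec.cond
      (Primrec.and.comp (Primrec.nat_lt.comp (Primrec.const 0) hj).decide (hr.comp hs hM))
      hM Primrec.fst)
  · intro L n
    cases n with
    | zero => simp [stateAt]
    | succ m =>
      have h : m.unpair.1 < m + 1 := Nat.lt_succ_of_le (Nat.unpair_left_le m)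
      rw [stateAt]
      simp only [List.length_map, List.length_range, Nat.add_sub_cancel, List.getElem?_map,
        List.getElem?_range h, Option.map_some, Option.getD_some, cond_eq_ite, Bool.and_eq_true,
        decide_eq_true_eq]

theorem primrec_stateTree_parent (hr : Primrec₂ r) :
    Primrec₂ fun L i => (stateTree r L).parent i := by
  have hm : Primrec fun p : σ × ℕ => p.2 - 1 :=
    Primrec.nat_sub.comp Primrec.snd (Primrec.const 1)
  have hj := Primrec.fst.comp (Primrec.unpair.comp hm)
  have hM : Primrec fun p : σ × ℕ => Denumerable.ofNat σ (p.2 - 1).unpair.2.unpair.1 :=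
    (Primrec.ofNat σ).comp
      (Primrec.fst.comp (Primrec.unpair.comp (Primrec.snd.comp (Primrec.unpair.comp hm))))
  have h := Primrec.cond (Primrec.and.comp (Primrec.nat_lt.comp (Primrec.const 0) hj).decide
    (hr.comp ((primrec_stateAt hr).comp Primrec.fst hj) hM)) hj (Primrec.const 0)
  refine Primrec.of_eq h fun ⟨L, i⟩ => ?_
  cases i with
  | zero => simp [(stateTree r L).parent_zero]
  | succ m =>
    simp only [stateTree_parent_succ, IsAttached, cond_eq_ite, Nat.add_sub_cancel,
      Bool.and_eq_true, decide_eq_true_eq]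
    congr

theorem primrec_stateTree_val (hr : Primrec₂ r) :
    Primrec₂ fun (p : σ × ℕ) n => (stateTree r p.1).val p.2 n := by
  have hn : Primrec fun q : (σ × ℕ) × List Bool => q.2.length :=
    Primrec.list_length.comp Primrec.snd
  have hp := (primrec_stateTree_parent hr).comp (Primrec.fst.comp Primrec.fst) hn
  refine Primrec.nat_strong_rec _ (g := fun p l => some ((p.2.testBit l.length) ^^
    (decide (0 < l.length) && (l[(stateTree r p.1).parent l.length]?).getD false))) ?_ ?_
  · exact Primrec.option_some.comp ((Primrec.dom_bool₂ _).comp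
      (primrec_testBit.comp (Primrec.snd.comp Primrec.fst) hn)
      (Primrec.and.comp (Primrec.nat_lt.comp (Primrec.const 0) hn).decide
        (Primrec.option_getD.comp (Primrec.list_getElem?.comp Primrec.snd hp)
          (Primrec.const false))))
  · rintro ⟨L, a⟩ n
    rcases Nat.eq_zero_or_pos n with rfl | hn
    · simp [ParentTree.val_zero]
    · simp [(stateTree r L).val_pos a hn, hn, (stateTree r L).parent_lt n hn]

theorem primrec_stateTree_lift₂ (hr : Primrec₂ r) (o : Bool → Bool → Bool) :
    Primrec fun p : σ × ℕ × ℕ => (stateTree r p.1).lift₂ o p.2.1 p.2.2 := by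
  have ha : Primrec fun p : (σ × ℕ × ℕ) × ℕ => (p.1.1, p.1.2.1) :=
    Primrec.pair (Primrec.fst.comp Primrec.fst)
      (Primrec.fst.comp (Primrec.snd.comp Primrec.fst))
  have hb : Primrec fun p : (σ × ℕ × ℕ) × ℕ => (p.1.1, p.1.2.2) :=
    Primrec.pair (Primrec.fst.comp Primrec.fst)
      (Primrec.snd.comp (Primrec.snd.comp Primrec.fst))
  have hx : Primrec fun p : (σ × ℕ × ℕ) × ℕ => p.2 := Primrec.snd
  have hpx := (primrec_stateTree_parent hr).comp (Primrec.fst.comp ha) hx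
  have hv := primrec_stateTree_val hr
  refine primrec_natOfBits (Primrec₂.mk ?_) (Primrec.nat_add.comp (Primrec.nat_add.comp
    (Primrec.fst.comp Primrec.snd) (Primrec.snd.comp Primrec.snd)) (Primrec.const 1))
  exact (Primrec.dom_bool₂ _).comp
    ((Primrec.dom_bool₂ o).comp (hv.comp ha hx) (hv.comp hb hx))
    (Primrec.and.comp (Primrec.nat_lt.comp (Primrec.const 0) hx).decide
      ((Primrec.dom_bool₂ o).comp (hv.comp ha hpx) (hv.comp hb hpx)))

end StateTree

theorem primrecRel_extends : PrimrecRel Extends := by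
  have h1 : Primrec fun p : (Nat.Partrec.Code × List ℕ) × Nat.Partrec.Code × List ℕ => p.1.1 :=
    Primrec.fst.comp Primrec.fst
  have h2 : Primrec fun p : (Nat.Partrec.Code × List ℕ) × Nat.Partrec.Code × List ℕ => p.1.2 :=
    Primrec.snd.comp Primrec.fst
  have h3 : Primrec fun p : (Nat.Partrec.Code × List ℕ) × Nat.Partrec.Code × List ℕ => p.2.1 :=
    Primrec.fst.comp Primrec.snd
  have h4 : Primrec fun p : (Nat.Partrec.Code × List ℕ) × Nat.Partrec.Code × List ℕ => p.2.2 :=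
    Primrec.snd.comp Primrec.snd
  have hlen := Primrec.list_length (α := ℕ)
  have hacc : PrimrecRel fun (i : ℕ) (y : Nat.Partrec.Code × List ℕ) =>
      y.1.evaln y.2.length (Encodable.encode (y.2.take i)) ≠ some 0 := by
    have hl : Primrec fun p : ℕ × Nat.Partrec.Code × List ℕ => p.2.2 :=
      Primrec.snd.comp Primrec.snd
    exact (Primrec.eq.comp (Nat.Partrec.Code.primrec_evaln.comp
      (((hlen.comp hl).pair (Primrec.fst.comp Primrec.snd)).pair
        (Primrec.encode.comp (Primrec.list_take.comp Primrec.fst hl))))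
      (Primrec.const (some 0))).not
  have hall : PrimrecPred fun y : Nat.Partrec.Code × List ℕ => ∀ i < y.2.length + 1,
      y.1.evaln y.2.length (Encodable.encode (y.2.take i)) ≠ some 0 := by
    refine ((PrimrecRel.forall_mem_list hacc).comp (Primrec.list_range.comp
      (Primrec.succ.comp (hlen.comp Primrec.snd))) Primrec.id).of_eq fun y => ?_
    simp
  refine PrimrecPred.and (Primrec.eq.comp h1 h3) (PrimrecPred.and (Primrec.eq.comp h2
    (Primrec.list_take.comp (hlen.comp h2) h4)) (PrimrecPred.and
    (Primrec.nat_lt.comp (hlen.comp h2) (hlen.comp h4)) (hall.comp Primrec.snd)))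

theorem primrec_stepsExtends : Primrec₂ stepsExtends := by
  have h : PrimrecRel fun (M : List (Nat.Partrec.Code × List ℕ)) x => ∃ y ∈ M, Extends x y :=
    PrimrecRel.exists_mem_list (R := fun y x => Extends x y)
      (PrimrecRel.comp primrecRel_extends Primrec.snd Primrec.fst)
  have h' : PrimrecRel fun x (M : List (Nat.Partrec.Code × List ℕ)) => ∃ y ∈ M, Extends x y :=
    PrimrecRel.comp h Primrec.snd Primrec.fst
  exact PrimrecPred.decide (PrimrecRel.forall_mem_list h')

/-! ### The isomorphism problem is `Σ¹₁` -/

section IsoCheck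

variable (s i : ℕ → ℕ → ℕ) (c : ℕ → ℕ) (e : ℕ) (F : ℕ → ℕ)

/-- An index below which `F` has to be known for checking at `n` whether `F` is an isomorphism. -/
def isoBound (n : ℕ) : ℕ :=
  n + (F n).unpair.1 + (F n).unpair.2.unpair.1 +
    s (F n.unpair.1).unpair.1 (F n.unpair.2).unpair.1 +
    i (F n.unpair.1).unpair.1 (F n.unpair.2).unpair.1 + c (F n).unpair.1

/-- The values of `F` are triples consisting of the values of a map, of its inverse, and of a
bound on running times. These data show at the argument `n` that the map is an isomorphism from
the structure with index `e`. -/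
def IsoCheck (n : ℕ) : Prop :=
  (F (F n).unpair.1).unpair.2.unpair.1 = n ∧
  (F (F n).unpair.2.unpair.1).unpair.1 = n ∧
  (Denumerable.ofNat Nat.Partrec.Code e.unpair.1).evaln (F n).unpair.2.unpair.2 n =
    some (F (s (F n.unpair.1).unpair.1 (F n.unpair.2).unpair.1)).unpair.2.unpair.1 ∧
  (Denumerable.ofNat Nat.Partrec.Code e.unpair.2.unpair.1).evaln (F n).unpair.2.unpair.2 n =
    some (F (i (F n.unpair.1).unpair.1 (F n.unpair.2).unpair.1)).unpair.2.unpair.1 ∧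
  (Denumerable.ofNat Nat.Partrec.Code e.unpair.2.unpair.2).evaln (F n).unpair.2.unpair.2 n =
    some (F (c (F n).unpair.1)).unpair.2.unpair.1

instance (n : ℕ) : Decidable (IsoCheck s i c e F n) :=
  inferInstanceAs (Decidable (_ ∧ _ ∧ _ ∧ _ ∧ _))

variable {s i c e F}

theorem isoBound_congr {G : ℕ → ℕ} {n k : ℕ} (hn : n < k) (hFG : ∀ j < k, F j = G j) :
    isoBound s i c F n = isoBound s i c G n := by
  unfold isoBound
  rw [hFG n hn, hFG _ ((Nat.unpair_left_le n).trans_lt hn),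
    hFG _ ((Nat.unpair_right_le n).trans_lt hn)]

theorem isoCheck_congr {G : ℕ → ℕ} {n k : ℕ} (hk : isoBound s i c F n < k)
    (hFG : ∀ j < k, F j = G j) : IsoCheck s i c e F n ↔ IsoCheck s i c e G n := by
  unfold isoBound at hk
  unfold IsoCheck
  rw [hFG (F n).unpair.1 (by omega), hFG (F n).unpair.2.unpair.1 (by omega),
    hFG (s _ _) (by omega), hFG (i _ _) (by omega), hFG (c _) (by omega), hFG n (by omega),
    hFG _ ((Nat.unpair_left_le n).trans_lt (by omega)),
    hFG _ ((Nat.unpair_right_le n).trans_lt (by omega))]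

theorem exists_forall_isoCheck_iff : (∃ F, ∀ n, IsoCheck s i c e F n) ↔
    ∃ (s' i' : ℕ → ℕ → ℕ) (c' : ℕ → ℕ), CodesOps e s' i' c' ∧ BAIso s' i' c' s i c := by
  constructor
  · rintro ⟨F, hF⟩
    let π : ℕ ≃ ℕ := ⟨fun n => (F n).unpair.1, fun n => (F n).unpair.2.unpair.1,
      fun n => (hF n).1, fun n => (hF n).2.1⟩
    refine ⟨fun a b => π.symm (s (π a) (π b)), fun a b => π.symm (i (π a) (π b)),
      fun a => π.symm (c (π a)), ⟨fun a b => ?_, fun a b => ?_, fun a => ?_⟩, π, ?_, ?_, ?_⟩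
    · have := Nat.Partrec.Code.evaln_sound (hF (Nat.pair a b)).2.2.1
      rw [Nat.unpair_pair] at this
      exact Part.eq_some_iff.2 this
    · have := Nat.Partrec.Code.evaln_sound (hF (Nat.pair a b)).2.2.2.1
      rw [Nat.unpair_pair] at this
      exact Part.eq_some_iff.2 this
    · exact Part.eq_some_iff.2 (Nat.Partrec.Code.evaln_sound (hF a).2.2.2.2)
    all_goals simp
  · rintro ⟨s', i', c', ⟨hs, hi, hc⟩, π, hπs, hπi, hπc⟩
    have hs' : ∀ n, ∃ t, s' n.unpair.1 n.unpair.2 ∈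
        (Denumerable.ofNat Nat.Partrec.Code e.unpair.1).evaln t n := fun n =>
      Nat.Partrec.Code.evaln_complete.1 (Part.eq_some_iff.1 (by
        have := hs n.unpair.1 n.unpair.2
        rwa [Nat.pair_unpair] at this))
    have hi' : ∀ n, ∃ t, i' n.unpair.1 n.unpair.2 ∈
        (Denumerable.ofNat Nat.Partrec.Code e.unpair.2.unpair.1).evaln t n := fun n =>
      Nat.Partrec.Code.evaln_complete.1 (Part.eq_some_iff.1 (by
        have := hi n.unpair.1 n.unpair.2
        rwa [Nat.pair_unpair] at this))
    have hc' : ∀ n, ∃ t, c' n ∈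
        (Denumerable.ofNat Nat.Partrec.Code e.unpair.2.unpair.2).evaln t n := fun n =>
      Nat.Partrec.Code.evaln_complete.1 (Part.eq_some_iff.1 (hc n))
    choose ts hts using hs'
    choose ti hti using hi'
    choose tc htc using hc'
    refine ⟨fun n => Nat.pair (π n) (Nat.pair (π.symm n) (ts n + ti n + tc n)), fun n => ?_⟩
    simp only [IsoCheck, Nat.unpair_pair]
    refine ⟨by simp, by simp, ?_, ?_, ?_⟩
    · rw [← hπs, Equiv.symm_apply_apply]
      exact Nat.Partrec.Code.evaln_mono (by omega) (hts n)
    · rw [← hπi, Equiv.symm_apply_apply]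
      exact Nat.Partrec.Code.evaln_mono (by omega) (hti n)
    · rw [← hπc, Equiv.symm_apply_apply]
      exact Nat.Partrec.Code.evaln_mono (by omega) (htc n)

theorem primrec_isoBound (hs : Primrec₂ s) (hi : Primrec₂ i) (hc : Primrec c) {α : Type*}
    [Primcodable α] {F : α → ℕ → ℕ} (hF : Primrec₂ F) {n : α → ℕ} (hn : Primrec n) :
    Primrec fun a => isoBound s i c (F a) (n a) := by
  have h1 {m : α → ℕ} (hm : Primrec m) : Primrec fun a => (m a).unpair.1 :=
    Primrec.fst.comp (Primrec.unpair.comp hm)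
  have h2 {m : α → ℕ} (hm : Primrec m) : Primrec fun a => (m a).unpair.2 :=
    Primrec.snd.comp (Primrec.unpair.comp hm)
  have hF' {m : α → ℕ} (hm : Primrec m) : Primrec fun a => F a (m a) := hF.comp Primrec.id hm
  have hadd {m m' : α → ℕ} (hm : Primrec m) (hm' : Primrec m') : Primrec fun a => m a + m' a :=
    Primrec.nat_add.comp hm hm'
  exact hadd (hadd (hadd (hadd (hadd hn (h1 (hF' hn))) (h1 (h2 (hF' hn))))
    (hs.comp (h1 (hF' (h1 hn))) (h1 (hF' (h2 hn)))))
    (hi.comp (h1 (hF' (h1 hn))) (h1 (hF' (h2 hn))))) (hc.comp (h1 (hF' hn)))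

theorem primrecPred_isoCheck (hs : Primrec₂ s) (hi : Primrec₂ i) (hc : Primrec c) {α : Type*}
    [Primcodable α] {F : α → ℕ → ℕ} (hF : Primrec₂ F) {n e : α → ℕ} (hn : Primrec n)
    (he : Primrec e) : PrimrecPred fun a => IsoCheck s i c (e a) (F a) (n a) := by
  have h1 {m : α → ℕ} (hm : Primrec m) : Primrec fun a => (m a).unpair.1 :=
    Primrec.fst.comp (Primrec.unpair.comp hm)
  have h2 {m : α → ℕ} (hm : Primrec m) : Primrec fun a => (m a).unpair.2 :=
    Primrec.snd.comp (Primrec.unpair.comp hm)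
  have hF' {m : α → ℕ} (hm : Primrec m) : Primrec fun a => F a (m a) := hF.comp Primrec.id hm
  have hev {m v : α → ℕ} (hm : Primrec m) (hv : Primrec v) :
      PrimrecPred fun a => (Denumerable.ofNat Nat.Partrec.Code (m a)).evaln
        (F a (n a)).unpair.2.unpair.2 (n a) = some (v a) :=
    Primrec.eq.comp (Nat.Partrec.Code.primrec_evaln.comp
      (((h2 (h2 (hF' hn))).pair ((Primrec.ofNat Nat.Partrec.Code).comp hm)).pair hn))
      (Primrec.option_some.comp hv)
  have hinv {m : α → ℕ} (hm : Primrec m) : Primrec fun a => (F a (m a)).unpair.2.unpair.1 :=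
    h1 (h2 (hF' hm))
  exact (Primrec.eq.comp (hinv (h1 (hF' hn))) hn).and
    ((Primrec.eq.comp (h1 (hF' (hinv hn))) hn).and
    ((hev (h1 he) (hinv (hs.comp (h1 (hF' (h1 hn))) (h1 (hF' (h2 hn)))))).and
    ((hev (h1 (h2 he)) (hinv (hi.comp (h1 (hF' (h1 hn))) (h1 (hF' (h2 hn)))))).and
    (hev (h2 (h2 he)) (hinv (hc.comp (h1 (hF' hn))))))))

/-- The set of indices of Boolean algebras isomorphic to a given primitive recursive one is
`Σ¹₁`. -/
theorem sigma11_setOf_baIso (hs : Primrec₂ s) (hi : Primrec₂ i) (hc : Primrec c)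
    (hBA : IsBAOps s i c) : Sigma11 {e | ∃ (s' i' : ℕ → ℕ → ℕ) (c' : ℕ → ℕ),
      CodesOps e s' i' c' ∧ IsBAOps s' i' c' ∧ BAIso s' i' c' s i c} := by
  refine ⟨fun e l => decide (¬ isoBound s i c (l.getD · 0) l.length.unpair.1 < l.length ∨
    IsoCheck s i c e (l.getD · 0) l.length.unpair.1), ?_, ?_⟩
  · have hlen : Primrec fun p : ℕ × List ℕ => p.2.length := Primrec.list_length.comp Primrec.snd
    have hn : Primrec fun p : ℕ × List ℕ => p.2.length.unpair.1 :=
      Primrec.fst.comp (Primrec.unpair.comp hlen)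
    have hF : Primrec₂ fun (p : ℕ × List ℕ) j => p.2.getD j 0 :=
      (Primrec.list_getD 0).comp (Primrec.snd.comp Primrec.fst) Primrec.snd
    exact Primrec.to_comp (PrimrecPred.or (Primrec.nat_lt.comp
      (primrec_isoBound hs hi hc hF hn) hlen).not
      (primrecPred_isoCheck hs hi hc hF hn Primrec.fst)).decide
  · ext e
    have h1 : e ∈ {e | ∃ (s' i' : ℕ → ℕ → ℕ) (c' : ℕ → ℕ),
        CodesOps e s' i' c' ∧ IsBAOps s' i' c' ∧ BAIso s' i' c' s i c} ↔
        ∃ F, ∀ n, IsoCheck s i c e F n := by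
      rw [exists_forall_isoCheck_iff]
      exact ⟨fun ⟨s', i', c', h, _, h'⟩ => ⟨s', i', c', h, h'⟩,
        fun ⟨s', i', c', h, h'⟩ => ⟨s', i', c', h, h'.isBAOps hBA, h'⟩⟩
    rw [h1, Set.mem_ofPred_eq]
    refine exists_congr fun F => ?_
    have hget : ∀ k, ∀ j < k, ((List.range k).map F).getD j 0 = F j := by
      intro k j hj
      simp [hj]
    simp only [decide_eq_true_eq, List.length_map, List.length_range]
    constructor
    · intro h k
      rw [or_iff_not_imp_left, not_not]
      intro hk
      exact (isoCheck_congr hk (hget k)).2 (h _)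
    · intro h n
      let k := Nat.pair n (isoBound s i c F n + 1)
      have hk : isoBound s i c F n < k := Nat.right_le_pair n _
      have hn : n < k := lt_of_le_of_lt (by unfold isoBound; omega) hk
      have hkn : k.unpair.1 = n := by simp [k]
      have hb := isoBound_congr (s := s) (i := i) (c := c) hn (hget k)
      have := h k
      rw [hkn, hb] at this
      exact (isoCheck_congr (hb ▸ hk) (hget k)).1 (this.resolve_left (not_not.2 hk))

end IsoCheck

/-! ### The isomorphism problem is complete -/

theorem exists_code_curry {σ : Type*} [Denumerable σ] {g : σ → ℕ → ℕ} (hg : Primrec₂ g) :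
    ∃ d : Nat.Partrec.Code, ∀ L x,
      evalCode (Encodable.encode (d.curry (Encodable.encode L))) x = Part.some (g L x) := by
  have hg' : Primrec fun n : ℕ => g (Denumerable.ofNat _ n.unpair.1) n.unpair.2 :=
    hg.comp ((Primrec.ofNat _).comp (Primrec.fst.comp Primrec.unpair))
      (Primrec.snd.comp Primrec.unpair)
  obtain ⟨d, hd⟩ := Nat.Partrec.Code.exists_code.1 (Partrec.nat_iff.1 hg'.to_comp.partrec)
  refine ⟨d, fun L x => ?_⟩
  rw [evalCode, Denumerable.ofNat_encode, Nat.Partrec.Code.eval_curry, hd]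
  simp

theorem exists_code_curry_pair {σ : Type*} [Denumerable σ] {g : σ → ℕ → ℕ → ℕ}
    (hg : Primrec fun p : σ × ℕ × ℕ => g p.1 p.2.1 p.2.2) : ∃ d : Nat.Partrec.Code, ∀ L a b,
      evalCode (Encodable.encode (d.curry (Encodable.encode L))) (Nat.pair a b) =
        Part.some (g L a b) := by
  obtain ⟨d, hd⟩ := exists_code_curry (g := fun L x => g L x.unpair.1 x.unpair.2)
    (hg.comp (Primrec.fst.pair (Primrec.unpair.comp Primrec.snd)))
  exact ⟨d, fun L a b => by rw [hd, Nat.unpair_pair]⟩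

theorem exists_codes_stateTree {σ : Type*} [Denumerable σ] {r : σ → σ → Bool}
    (hr : Primrec₂ r) : ∃ cs ci cc : Nat.Partrec.Code, ∀ L : σ,
      CodesOps (Nat.pair (Encodable.encode (cs.curry (Encodable.encode L)))
        (Nat.pair (Encodable.encode (ci.curry (Encodable.encode L)))
          (Encodable.encode (cc.curry (Encodable.encode L)))))
        (stateTree r L).sup (stateTree r L).inf (stateTree r L).compl := by
  have hlift : ∀ o, Primrec fun p : σ × ℕ × ℕ => (stateTree r p.1).lift₂ o p.2.1 p.2.2 :=
    primrec_stateTree_lift₂ hr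
  obtain ⟨cs, hs⟩ := exists_code_curry_pair (g := fun L => (stateTree r L).sup) (hlift or)
  obtain ⟨ci, hi⟩ := exists_code_curry_pair (g := fun L => (stateTree r L).inf) (hlift and)
  obtain ⟨cc, hc⟩ := exists_code_curry (g := fun L => (stateTree r L).compl)
    ((hlift fun b _ => !b).comp (Primrec.fst.pair (Primrec.snd.pair Primrec.snd)))
  refine ⟨cs, ci, cc, fun L => ⟨fun a b => ?_, fun a b => ?_, fun a => ?_⟩⟩
  · rw [Nat.unpair_pair, hs]
  · rw [Nat.unpair_pair, Nat.unpair_pair, hi]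
  · rw [Nat.unpair_pair, Nat.unpair_pair, hc]

theorem CodesOps.unique {e : ℕ} {s i s' i' : ℕ → ℕ → ℕ} {c c' : ℕ → ℕ} (h : CodesOps e s i c)
    (h' : CodesOps e s' i' c') : s = s' ∧ i = i' ∧ c = c' :=
  ⟨funext₂ fun a b => Part.some_injective ((h.1 a b).symm.trans (h'.1 a b)),
    funext₂ fun a b => Part.some_injective ((h.2.1 a b).symm.trans (h'.2.1 a b)),
    funext fun a => Part.some_injective ((h.2.2 a).symm.trans (h'.2.2 a))⟩

/-- Every `Σ¹₁` set is many-one reducible to non-accessibility for `Extends`. -/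
theorem Sigma11.exists_code {A : Set ℕ} (hA : Sigma11 A) : ∃ d : Nat.Partrec.Code,
    ∀ n, n ∈ A ↔ ¬ Acc (fun y x => Extends x y) (d.curry n, []) := by
  obtain ⟨R, hR, rfl⟩ := hA
  have hR' : Computable fun n : ℕ =>
      Encodable.encode (R n.unpair.1 (Denumerable.ofNat (List ℕ) n.unpair.2)) :=
    Computable.encode.comp (hR.comp (Computable.fst.comp Computable.unpair)
      ((Computable.ofNat (List ℕ)).comp (Computable.snd.comp Computable.unpair)))
  obtain ⟨d, hd⟩ := Nat.Partrec.Code.exists_code.1 (Partrec.nat_iff.1 hR'.partrec)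
  refine ⟨d, fun n => ?_⟩
  rw [not_acc_extends_iff (R := R n)]
  · rfl
  · intro l
    rw [Nat.Partrec.Code.eval_curry, hd]
    simp

/-- There is a computable Boolean algebra on `ℕ` such that the set of indices of computable
Boolean algebras isomorphic to it is `Σ¹₁`-complete. -/
theorem exists_computable_BA_isom_index_set_Sigma11_complete :
    ∃ (sup inf : ℕ → ℕ → ℕ) (compl : ℕ → ℕ),
      Computable₂ sup ∧ Computable₂ inf ∧ Computable compl ∧ IsBAOps sup inf compl ∧
      Sigma11Complete
        {e | ∃ (sup' inf' : ℕ → ℕ → ℕ) (compl' : ℕ → ℕ),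
          CodesOps e sup' inf' compl' ∧ IsBAOps sup' inf' compl' ∧
          BAIso sup' inf' compl' sup inf compl} := by
  have hlift : ∀ o, Primrec fun p : List (Nat.Partrec.Code × List ℕ) × ℕ × ℕ =>
      (stateTree stepsExtends p.1).lift₂ o p.2.1 p.2.2 :=
    primrec_stateTree_lift₂ primrec_stepsExtends
  have hs : Primrec₂ (stateTree stepsExtends []).sup :=
    (hlift or).comp ((Primrec.const []).pair (Primrec.fst.pair Primrec.snd))
  have hi : Primrec₂ (stateTree stepsExtends []).inf :=
    (hlift and).comp ((Primrec.const []).pair (Primrec.fst.pair Primrec.snd))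
  have hc : Primrec (stateTree stepsExtends []).compl :=
    (hlift fun b _ => !b).comp ((Primrec.const []).pair (Primrec.id.pair Primrec.id))
  have hBA := (stateTree stepsExtends []).isBAOps
  refine ⟨_, _, _, Primrec.to_comp hs, Primrec.to_comp hi, hc.to_comp, hBA,
    sigma11_setOf_baIso hs hi hc hBA, fun A hA => ?_⟩
  obtain ⟨cs, ci, cc, hcodes⟩ := exists_codes_stateTree primrec_stepsExtends
  obtain ⟨d, hd⟩ := hA.exists_code
  have hL : Primrec fun n => Encodable.encode [(d.curry n, ([] : List ℕ))] :=
    Primrec.encode.comp (Primrec.list_cons.comp ((Nat.Partrec.Code.primrec₂_curry.comp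
      (Primrec.const d) Primrec.id).pair (Primrec.const [])) (Primrec.const []))
  have hcurry (b : Nat.Partrec.Code) : Primrec fun n =>
      Encodable.encode (b.curry (Encodable.encode [(d.curry n, ([] : List ℕ))])) :=
    Primrec.encode.comp (Nat.Partrec.Code.primrec₂_curry.comp (Primrec.const b) hL)
  refine ⟨_, (Primrec₂.natPair.comp (hcurry cs)
    (Primrec₂.natPair.comp (hcurry ci) (hcurry cc))).to_comp, fun n => ?_⟩
  have hn := hcodes [(d.curry n, [])]
  have key := baIso_stateTree_stepsExtends_iff (L := [(d.curry n, [])])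
  rw [List.forall_mem_singleton, ← hd] at key
  constructor
  · exact fun h => ⟨_, _, _, hn, ParentTree.isBAOps _, key.2 h⟩
  · rintro ⟨s', i', c', h, -, hiso⟩
    obtain ⟨rfl, rfl, rfl⟩ := h.unique hn
    exact key.1 hiso
end

section
/- There is a computable tree T ⊆ List ℕ such that Isom(T) = {e : ℕ | e indexes a computable tree T_e with T_e ≅ T} is Σ¹₁-complete; that is, Isom(T) is Σ¹₁, and every Σ¹₁ subset of ℕ is many-one reducible to Isom(T). -/
/-- A tree is a prefix-closed set of lists of naturals. -/
def IsTree (T : Set (List ℕ)) : Prop := ∀ l ∈ T, ∀ l' : List ℕ, l' <+: l → l' ∈ T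

/-- The set of lists on which the `e`-th partial computable function returns `1`. -/
def TreeOf (e : ℕ) : Set (List ℕ) :=
  {l | evalCode e (Encodable.encode l) = Part.some 1}

/-- `e` indexes a computable tree: the `e`-th partial computable function is total with
values in `{0,1}` on codes of lists, and the resulting set is prefix-closed. -/
def IndexesTree (e : ℕ) : Prop :=
  (∀ l : List ℕ, evalCode e (Encodable.encode l) = Part.some 0 ∨
      evalCode e (Encodable.encode l) = Part.some 1) ∧
  IsTree (TreeOf e)

/-- Two trees are isomorphic: there is an order isomorphism between them, each ordered by
the prefix relation. -/
def TreeIso (S T : Set (List ℕ)) : Prop :=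
  ∃ π : S ≃ T, ∀ a b : S, (a : List ℕ) <+: (b : List ℕ) ↔
    ((π a : List ℕ)) <+: ((π b : List ℕ))

/-- `Isom T`: the indices of computable trees isomorphic to `T`. -/
def Isom (T : Set (List ℕ)) : Set ℕ := {e | IndexesTree e ∧ TreeIso (TreeOf e) T}

namespace IsomTree

open Encodable Denumerable

universe u

section Rank

variable {X : Type u} {r : X → X → Prop}

open Classical in
/-- The rank of a point under `r`, with value `⊤` at the points that are not accessible. -/
noncomputable def extRank (r : X → X → Prop) (x : X) : WithTop Ordinal.{u} :=
  if h : Acc r x then (h.rank : WithTop Ordinal.{u}) else ⊤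

theorem extRank_of_acc {x : X} (h : Acc r x) : extRank r x = (h.rank : WithTop Ordinal.{u}) :=
  dif_pos h

theorem extRank_of_not_acc {x : X} (h : ¬ Acc r x) : extRank r x = ⊤ :=
  dif_neg h

theorem acc_iff_of_extRank_eq {x y : X} (h : extRank r x = extRank r y) : Acc r x ↔ Acc r y := by
  by_cases hx : Acc r x <;> by_cases hy : Acc r y <;>
    simp_all [extRank_of_acc, extRank_of_not_acc]

theorem exists_rel_rank_eq [IsTrans X r] {x : X} (hx : Acc r x) {o : Ordinal.{u}}
    (ho : o < hx.rank) : ∃ y, ∃ h : r y x, (hx.inv h).rank = o := by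
  rw [Acc.rank_eq, Ordinal.lt_iSup_iff] at ho
  obtain ⟨⟨y, hy⟩, ho⟩ := ho
  rw [Order.lt_succ_iff] at ho
  rcases ho.eq_or_lt with rfl | ho
  · exact ⟨y, hy, rfl⟩
  · obtain ⟨z, hz, rfl⟩ : ∃ z, ∃ hz : r z y, ((hx.inv hy).inv hz).rank = o := by
      exact exists_rel_rank_eq (hx.inv hy) ho
    exact ⟨z, _root_.trans hz hy, rfl⟩
termination_by hx.rank
decreasing_by exact hx.rank_lt_of_rel hy

/-- A relation is rank-saturated if every rank occurring in its accessible part occurs below every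
inaccessible point. -/
def RankSaturated (r : X → X → Prop) : Prop :=
  ∀ x, ¬ Acc r x → ∀ z, Acc r z → ∃ y, r y x ∧ extRank r y = extRank r z

theorem RankSaturated.exists_rel [IsTrans X r] (hr : RankSaturated r) {x x' y : X}
    (h : extRank r x = extRank r x') (hy : r y x) : ∃ y', r y' x' ∧ extRank r y' = extRank r y := by
  by_cases hx : Acc r x
  · have hx' : Acc r x' := (acc_iff_of_extRank_eq h).1 hx
    rw [extRank_of_acc hx, extRank_of_acc hx', WithTop.coe_inj] at h
    obtain ⟨y', hy', e⟩ := exists_rel_rank_eq hx' (h ▸ hx.rank_lt_of_rel hy)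
    exact ⟨y', hy', by rw [extRank_of_acc (hx'.inv hy'), extRank_of_acc (hx.inv hy), e]⟩
  · have hx' : ¬ Acc r x' := fun h' => hx ((acc_iff_of_extRank_eq h).2 h')
    by_cases hy : Acc r y
    · exact hr x' hx' y hy
    · obtain ⟨y', hy', hr'⟩ := exists_not_acc_lt_of_not_acc hx'
      exact ⟨y', hr', by rw [extRank_of_not_acc hy, extRank_of_not_acc hy']⟩

end Rank

section Lists

variable {A : Type u} {b : A → A → Prop}

/-- `y` lies below `x` if some initial segment of `y` lies below `x` entry by entry. -/
def listRel (b : A → A → Prop) (y x : List A) : Prop :=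
  ∃ p q, y = p ++ q ∧ List.Forall₂ b p x

theorem listRel_of_forall₂ {p x : List A} (h : List.Forall₂ b p x) (q : List A) :
    listRel b (p ++ q) x :=
  ⟨p, q, rfl, h⟩

theorem listRel_append {p x y z : List A} (hp : List.Forall₂ b p x) (h : listRel b y z) :
    listRel b (p ++ y) (x ++ z) := by
  obtain ⟨p', q, rfl, h⟩ := h
  exact ⟨p ++ p', q, by simp, List.rel_append hp h⟩

theorem exists_of_listRel_append {w x z : List A} (h : listRel b w (x ++ z)) :
    ∃ p y, w = p ++ y ∧ List.Forall₂ b p x ∧ listRel b y z := by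
  obtain ⟨p, q, rfl, h⟩ := h
  refine ⟨p.take x.length, p.drop x.length ++ q, by simp [← List.append_assoc], ?_, _, q, rfl, ?_⟩
  · exact List.forall₂_take_append _ _ _ h
  · exact List.forall₂_drop_append _ _ _ h

theorem forall₂_trans [IsTrans A b] : ∀ {x y z : List A},
    List.Forall₂ b x y → List.Forall₂ b y z → List.Forall₂ b x z
  | _, _, _, .nil, .nil => .nil
  | _, _, _, .cons h t, .cons h' t' => .cons (_root_.trans h h') (forall₂_trans t t')

instance [IsTrans A b] : IsTrans (List A) (listRel b) where
  trans := by
    rintro _ _ x ⟨p, q, rfl, h⟩ ⟨p', q', rfl, h'⟩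
    obtain ⟨s, t, e, hs, -⟩ := exists_of_listRel_append (listRel_of_forall₂ h q)
    exact ⟨s, t, e, forall₂_trans hs h'⟩

theorem acc_append_right (x : List A) {z : List A} (hz : Acc (listRel b) z) :
    Acc (listRel b) (x ++ z) := by
  induction hz generalizing x with
  | intro z _ ih =>
    refine ⟨_, fun w hw => ?_⟩
    obtain ⟨p, y, rfl, -, hy⟩ := exists_of_listRel_append hw
    exact ih y hy p

theorem acc_append_left {x : List A} (hx : Acc (listRel b) x) (z : List A) :
    Acc (listRel b) (x ++ z) := by
  induction hx generalizing z with
  | intro x _ ih =>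
    refine ⟨_, fun w hw => ?_⟩
    obtain ⟨p, y, rfl, hp, -⟩ := exists_of_listRel_append hw
    exact ih p (by simpa using listRel_of_forall₂ hp []) y

theorem exists_forall₂_of_not_acc {x : List A} (hx : ¬ Acc (listRel b) x) :
    ∃ p, List.Forall₂ b p x ∧ ¬ Acc (listRel b) p := by
  obtain ⟨_, hy, p, q, rfl, hp⟩ := exists_not_acc_lt_of_not_acc hx
  exact ⟨p, hp, fun h => hy (acc_append_left h q)⟩

theorem rank_append_le (x : List A) {z : List A} (hz : Acc (listRel b) z) :
    (acc_append_right x hz).rank ≤ hz.rank := by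
  induction hz generalizing x with
  | intro z hz ih =>
    rw [Acc.rank_eq, Ordinal.iSup_le_iff]
    rintro ⟨w, hw⟩
    obtain ⟨p, y, rfl, -, hy⟩ := exists_of_listRel_append hw
    exact Order.succ_le_of_lt ((ih y hy p).trans_lt (Acc.rank_lt_of_rel (.intro z hz) hy))

theorem le_rank_append {x z : List A} (hx : ¬ Acc (listRel b) x) (hz : Acc (listRel b) z) :
    hz.rank ≤ (acc_append_right x hz).rank := by
  induction hz generalizing x with
  | intro z hz ih =>
    rw [Acc.rank_eq, Ordinal.iSup_le_iff]
    rintro ⟨w, hw⟩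
    obtain ⟨p, hp, hp'⟩ := exists_forall₂_of_not_acc hx
    exact Order.succ_le_of_lt ((ih w hw hp').trans_lt
      (Acc.rank_lt_of_rel (acc_append_right x (.intro z hz)) (listRel_append hp hw)))

theorem rankSaturated_listRel (b : A → A → Prop) : RankSaturated (listRel b) := by
  intro x hx z hz
  obtain ⟨p, hp, hp'⟩ := exists_forall₂_of_not_acc hx
  refine ⟨p ++ z, listRel_of_forall₂ hp z, ?_⟩
  rw [extRank_of_acc hz, extRank_of_acc (acc_append_right p hz),
    (rank_append_le p hz).antisymm (le_rank_append hp' hz)]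

theorem not_acc_listRel_nil : ¬ Acc (listRel b) [] := fun h =>
  (h.rank_lt_of_rel (listRel_of_forall₂ .nil [])).false

theorem not_acc_listRel_singleton_iff {a : A} : ¬ Acc (listRel b) [a] ↔ ¬ Acc b a := by
  refine not_congr ⟨fun h => ?_, fun h => ?_⟩
  · exact Subrelation.accessible (fun h => listRel_of_forall₂ (.cons h .nil) [])
      (InvImage.accessible (fun a => [a]) h)
  · induction h with
    | intro a _ ih =>
      refine ⟨_, ?_⟩
      rintro _ ⟨_, q, rfl, _ | ⟨h, _ | _⟩⟩
      exact acc_append_left (ih _ h) q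

end Lists

section Unraveling

variable {X V : Type*} {r : X → X → Prop} {label : ℕ → X}

/-- `l` labels a descending path starting below `x`. -/
def Path (r : X → X → Prop) (label : ℕ → X) : X → List ℕ → Prop
  | _, [] => True
  | x, m :: l => r (label m) x ∧ Path r label (label m) l

/-- The tree of descending paths starting below `x`. -/
def pathTree (r : X → X → Prop) (label : ℕ → X) (x : X) : Set (List ℕ) :=
  {l | Path r label x l}

theorem isTree_pathTree (x : X) : IsTree (pathTree r label x) := by
  rintro _ h l ⟨t, rfl⟩
  induction l generalizing x with
  | nil => trivial
  | cons m l ih => exact ⟨h.1, ih _ h.2⟩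

theorem path_iff_foldl [DecidableRel r] (x : X) (l : List ℕ) :
    Path r label x l ↔ (l.foldl (fun (s : X × Bool) m =>
      (label m, s.2 && decide (r (label m) s.1))) (x, true)).2 = true := by
  suffices ∀ t : Bool, (t = true ∧ Path r label x l) ↔ (l.foldl (fun (s : X × Bool) m =>
      (label m, s.2 && decide (r (label m) s.1))) (x, t)).2 = true by
    simpa using this true
  induction l generalizing x with
  | nil => simp [Path]
  | cons m l ih => intro t; simp [Path, ← ih, and_assoc]

/-- Transport of a path along a family of maps between labels. -/
def mapPath (label : ℕ → X) (e : X → X → ℕ → ℕ) : X → X → List ℕ → List ℕ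
  | _, _, [] => []
  | x, y, m :: l => e x y m :: mapPath label e (label m) (label (e x y m)) l

theorem mapPath_prefix (e : X → X → ℕ → ℕ) {l l' : List ℕ} (h : l <+: l') (x y : X) :
    mapPath label e x y l <+: mapPath label e x y l' := by
  obtain ⟨t, rfl⟩ := h
  induction l generalizing x y with
  | nil => exact List.nil_prefix
  | cons m l ih => exact List.cons_prefix_cons.2 ⟨rfl, ih _ _⟩

theorem path_mapPath {e : X → X → ℕ → ℕ} {v : X → V}
    (he : ∀ x y m, v x = v y → r (label m) x →
      r (label (e x y m)) y ∧ v (label (e x y m)) = v (label m)) :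
    ∀ {x y : X} {l : List ℕ}, v x = v y → Path r label x l → Path r label y (mapPath label e x y l)
  | _, _, [], _, _ => trivial
  | _, _, _ :: _, h, hl =>
    ⟨(he _ _ _ h hl.1).1, path_mapPath he (he _ _ _ h hl.1).2.symm hl.2⟩

theorem mapPath_mapPath {e e' : X → X → ℕ → ℕ} {v : X → V}
    (he : ∀ x y m, v x = v y → r (label m) x → v (label (e x y m)) = v (label m))
    (hee' : ∀ x y m, v x = v y → r (label m) x → e' y x (e x y m) = m) :
    ∀ {x y : X} {l : List ℕ}, v x = v y → Path r label x l →
      mapPath label e' y x (mapPath label e x y l) = l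
  | _, _, [], _, _ => rfl
  | x, y, m :: l, h, hl => by
    simp only [mapPath, hee' _ _ _ h hl.1]
    rw [mapPath_mapPath he hee' (he _ _ _ h hl.1).symm hl.2]

theorem treeIso_of_inverse {S T : Set (List ℕ)} (f g : List ℕ → List ℕ)
    (hf : ∀ l ∈ S, f l ∈ T) (hg : ∀ l ∈ T, g l ∈ S)
    (hgf : ∀ l ∈ S, g (f l) = l) (hfg : ∀ l ∈ T, f (g l) = l)
    (mf : ∀ l l', l <+: l' → f l <+: f l') (mg : ∀ l l', l <+: l' → g l <+: g l') :
    TreeIso S T := by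
  refine ⟨⟨fun l => ⟨f l, hf l l.2⟩, fun l => ⟨g l, hg l l.2⟩, fun l => Subtype.ext (hgf l l.2),
    fun l => Subtype.ext (hfg l l.2)⟩, fun l l' => ⟨fun h => mf _ _ h, fun h => ?_⟩⟩
  simpa [hgf l l.2, hgf l' l'.2] using mg _ _ h

/-- Two sets of naturals realising the same values, each one infinitely often, are in
value-preserving bijection. -/
theorem exists_equiv_of_infinite_fibers {S T : Set ℕ} {v : ℕ → V}
    (hST : ∀ m ∈ S, ∃ k ∈ T, v k = v m) (hTS : ∀ m ∈ T, ∃ k ∈ S, v k = v m)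
    (hS : ∀ m ∈ S, {k ∈ S | v k = v m}.Infinite) (hT : ∀ m ∈ T, {k ∈ T | v k = v m}.Infinite) :
    ∃ e : S ≃ T, ∀ m, v (e m) = v m := by
  have key : ∀ c : V, Nonempty ({m : S // v m = c} ≃ {m : T // v m = c}) := by
    intro c
    by_cases hc : ∃ m ∈ S, v m = c
    · obtain ⟨m, hm, rfl⟩ := hc
      obtain ⟨k, hk, hkm⟩ := hST m hm
      have iS : Infinite {n : S // v n = v m} := by
        have := (hS m hm).to_subtype
        exact Infinite.of_injective
          (fun n : {k ∈ S | v k = v m} => (⟨⟨n, n.2.1⟩, n.2.2⟩ : {n : S // v n = v m}))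
          (fun a b h => by simpa [Subtype.ext_iff] using h)
      have iT : Infinite {n : T // v n = v m} := by
        have := (hT k hk).to_subtype
        exact Infinite.of_injective
          (fun n : {i ∈ T | v i = v k} => (⟨⟨n, n.2.1⟩, n.2.2.trans hkm⟩ : {n : T // v n = v m}))
          (fun a b h => by simpa [Subtype.ext_iff] using h)
      exact nonempty_equiv_of_countable
    · have : IsEmpty {m : S // v m = c} := ⟨fun m => hc ⟨m, m.1.2, m.2⟩⟩
      have : IsEmpty {m : T // v m = c} := ⟨fun m => by
        obtain ⟨k, hk, h⟩ := hTS m m.1.2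
        exact hc ⟨k, hk, h.trans m.2⟩⟩
      exact ⟨Equiv.equivOfIsEmpty _ _⟩
  let E := fun c => (key c).some
  refine ⟨(Equiv.sigmaFiberEquiv fun m : S => v m).symm.trans
    ((Equiv.sigmaCongrRight E).trans (Equiv.sigmaFiberEquiv fun m : T => v m)), fun m => ?_⟩
  exact (E (v m) ⟨m, rfl⟩).2

/-- If the values realised below a point are determined by the value of that point, then the
path tree of a point is determined by its value. -/
theorem treeIso_pathTree {v : X → V} (hlabel : ∀ x, {m | label m = x}.Infinite)
    (hv : ∀ x x' y, v x = v x' → r y x → ∃ y', r y' x' ∧ v y' = v y) {x x' : X} (h : v x = v x') :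
    TreeIso (pathTree r label x) (pathTree r label x') := by
  have inf : ∀ x, ∀ m ∈ {m | r (label m) x},
      {k ∈ {k | r (label k) x} | v (label k) = v (label m)}.Infinite := fun x m hm =>
    (hlabel (label m)).mono fun k (hk : label k = label m) => by
      simpa [hk] using hm
  have sub : ∀ x x', v x = v x' → ∀ m ∈ {m | r (label m) x}, ∃ k ∈ {k | r (label k) x'},
      v (label k) = v (label m) := fun x x' h m hm => by
    obtain ⟨y, hy, e⟩ := hv x x' (label m) h hm
    obtain ⟨k, rfl⟩ := (hlabel y).nonempty
    exact ⟨k, hy, e⟩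
  have ex : ∀ x y, ∃ e e' : ℕ → ℕ, v x = v y →
      (∀ m, r (label m) x → r (label (e m)) y ∧ v (label (e m)) = v (label m) ∧ e' (e m) = m) ∧
      (∀ m, r (label m) y → r (label (e' m)) x ∧ v (label (e' m)) = v (label m) ∧
        e (e' m) = m) := by
    classical
    intro x y
    by_cases h : v x = v y
    · obtain ⟨E, hE⟩ := exists_equiv_of_infinite_fibers (v := fun m => v (label m))
        (sub x y h) (sub y x h.symm) (inf x) (inf y)
      refine ⟨fun m => if hm : r (label m) x then E ⟨m, hm⟩ else 0,
        fun m => if hm : r (label m) y then E.symm ⟨m, hm⟩ else 0,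
        fun _ => ⟨fun m hm => ?_, fun m hm => ?_⟩⟩
      · have h1 : r (label (E ⟨m, hm⟩)) y := (E ⟨m, hm⟩).2
        simpa [hm, h1] using hE ⟨m, hm⟩
      · have h1 : r (label (E.symm ⟨m, hm⟩)) x := (E.symm ⟨m, hm⟩).2
        simpa [hm, h1] using (hE (E.symm ⟨m, hm⟩)).symm
    · exact ⟨id, id, fun h' => absurd h' h⟩
  choose e e' he using ex
  refine treeIso_of_inverse (mapPath label e x x') (mapPath label (fun y x => e' x y) x' x)
    (fun l hl => ?_) (fun l hl => ?_) (fun l hl => ?_) (fun l hl => ?_)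
    (fun l l' h => mapPath_prefix _ h _ _) (fun l l' h => mapPath_prefix _ h _ _)
  · exact path_mapPath (fun x y m h hm => ⟨((he x y h).1 m hm).1, ((he x y h).1 m hm).2.1⟩) h hl
  · exact path_mapPath (e := fun y x => e' x y)
      (fun y x m h hm => ⟨((he x y h.symm).2 m hm).1, ((he x y h.symm).2 m hm).2.1⟩) h.symm hl
  · exact mapPath_mapPath (e' := fun y x => e' x y) (fun x y m h hm => ((he x y h).1 m hm).2.1)
      (fun x y m h hm => ((he x y h).1 m hm).2.2) h hl
  · exact mapPath_mapPath (e := fun y x => e' x y)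
      (fun y x m h hm => ((he x y h.symm).2 m hm).2.1)
      (fun y x m h hm => ((he x y h.symm).2 m hm).2.2) h.symm hl

/-- A tree has an infinite branch. -/
def HasBranch (S : Set (List ℕ)) : Prop :=
  ∃ s : ℕ → List ℕ, ∀ n, s n ∈ S ∧ s n <+: s (n + 1) ∧ s n ≠ s (n + 1)

theorem hasBranch_of_treeIso {S T : Set (List ℕ)} (h : TreeIso S T) (hT : HasBranch T) :
    HasBranch S := by
  obtain ⟨π, hπ⟩ := h
  obtain ⟨s, hs⟩ := hT
  refine ⟨fun n => π.symm ⟨s n, (hs n).1⟩, fun n => ⟨(π.symm _).2, ?_, fun h => (hs n).2.2 ?_⟩⟩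
  · simpa [hπ] using (hs n).2.1
  · simpa using Subtype.ext h

theorem hasBranch_pathTree_of_not_acc (hlabel : Function.Surjective label) {x : X}
    (hx : ¬ Acc r x) : HasBranch (pathTree r label x) := by
  obtain ⟨f, rfl, hf⟩ := not_acc_iff_exists_descending_chain.1 hx
  choose g hg using hlabel
  refine ⟨fun n => (List.range n).map fun i => g (f (i + 1)), fun n => ⟨?_, ?_, fun h => ?_⟩⟩
  · have : ∀ n k, Path r label (f k) ((List.range n).map fun i => g (f (k + i + 1))) := by
      intro n
      induction n with
      | zero => exact fun _ => trivial
      | succ n ih =>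
        intro k
        rw [List.range_succ_eq_map]
        refine ⟨by simpa [hg] using hf k, ?_⟩
        have := ih (k + 1)
        simpa [hg, Function.comp_def, Nat.add_assoc, Nat.add_comm 1] using this
    simpa [pathTree] using this n 0
  · simp [List.range_succ]
  · simpa using congrArg List.length h

theorem not_hasBranch_pathTree_of_acc {x : X} (hx : Acc r x) :
    ¬ HasBranch (pathTree r label x) := by
  induction hx with
  | intro x _ ih =>
    rintro ⟨s, hs⟩
    have pos : ∀ n, s (n + 1) ≠ [] := fun n h => by
      have h1 := (hs n).2
      simp [h] at h1
    obtain ⟨m, t, hm⟩ := List.exists_cons_of_ne_nil (pos 0)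
    have tail : ∀ n, ∃ t, s (n + 1) = m :: t := by
      intro n
      induction n with
      | zero => exact ⟨t, hm⟩
      | succ n ih =>
        obtain ⟨t, ht⟩ := ih
        obtain ⟨u, hu⟩ := (hs (n + 1)).2.1
        exact ⟨t ++ u, by rw [← hu, ht]; rfl⟩
    choose t ht using tail
    have h0 := (hs (0 + 1)).1
    rw [ht 0] at h0
    refine ih (label m) h0.1 ⟨t, fun n => ?_⟩
    have := hs (n + 1)
    rw [ht, ht] at this
    exact ⟨this.1.2, by simpa [List.cons_prefix_cons] using this.2.1, fun h => this.2.2 (by rw [h])⟩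

end Unraveling

section Search

open Nat.Partrec (Code)
open Nat.Partrec.Code

/-- `(c, n, s')` lies below `(c, n, s)` if `s'` properly extends `s` and within `s'.length` steps
the code `c` has not refuted any prefix of `s'` on the parameter `n` by returning `0`. -/
def searchRel (a' a : Code × ℕ × List ℕ) : Prop :=
  a'.1 = a.1 ∧ a'.2.1 = a.2.1 ∧ a.2.2 <+: a'.2.2 ∧ a.2.2.length < a'.2.2.length ∧
    ∀ k ∈ List.range (a'.2.2.length + 1),
      evaln a'.2.2.length a'.1 (Nat.pair a'.2.1 (encode (a'.2.2.take k))) ≠ some 0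

instance : IsTrans (Code × ℕ × List ℕ) searchRel where
  trans := by
    rintro ⟨c, n, s⟩ ⟨c', n', s'⟩ ⟨c'', n'', s''⟩ ⟨h1, h2, h3, h4, h5⟩ ⟨h1', h2', h3', h4', -⟩
    exact ⟨h1.trans h1', h2.trans h2', h3'.trans h3, h4'.trans h4, h5⟩

theorem not_acc_searchRel_iff {c : Code} {n : ℕ} :
    ¬ Acc searchRel (c, n, []) ↔
      ∃ f : ℕ → ℕ, ∀ k, 0 ∉ c.eval (Nat.pair n (encode ((List.range k).map f))) := by
  constructor
  · intro h
    obtain ⟨g, h0, hg⟩ := not_acc_iff_exists_descending_chain.1 h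
    have hc : ∀ m, (g m).1 = c ∧ (g m).2.1 = n := by
      intro m
      induction m with
      | zero => simp [h0]
      | succ m ih => exact ⟨(hg m).1.trans ih.1, (hg m).2.1.trans ih.2⟩
    have hpre : ∀ m k, m ≤ k → (g m).2.2 <+: (g k).2.2 := by
      intro m k hmk
      induction hmk with
      | refl => exact List.prefix_rfl
      | step _ ih => exact ih.trans (hg _).2.2.1
    have hlen : ∀ m, m ≤ (g m).2.2.length := by
      intro m
      induction m with
      | zero => exact Nat.zero_le _
      | succ m ih => exact Nat.succ_le_of_lt (ih.trans_lt (hg m).2.2.2.1)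
    have hf : ∀ k m, k ≤ m →
        (List.range k).map (fun i => (g (i + 1)).2.2.getD i 0) = (g m).2.2.take k := by
      intro k m hkm
      refine List.ext_getElem (by simpa using hkm.trans (hlen m)) fun i h1 h2 => ?_
      simp only [List.length_map, List.length_range] at h1
      have h3 : i < (g (i + 1)).2.2.length := hlen (i + 1)
      simp only [List.getElem_map, List.getElem_range, List.getElem_take,
        List.getD_eq_getElem _ _ h3]
      exact (hpre (i + 1) m (by omega)).getElem h3
    refine ⟨fun i => (g (i + 1)).2.2.getD i 0, fun k h => ?_⟩
    obtain ⟨t, ht⟩ := evaln_complete.1 h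
    have hm := hlen (k + t + 1)
    refine (hg (k + t)).2.2.2.2 k (List.mem_range.2 (by omega)) ?_
    rw [(hc _).1, (hc _).2, ← hf k _ (by omega)]
    exact evaln_mono (by omega) ht
  · rintro ⟨f, hf⟩
    refine not_acc_iff_exists_descending_chain.2
      ⟨fun k => (c, n, (List.range k).map f), rfl, fun k => ⟨rfl, rfl, ?_, by simp, ?_⟩⟩
    · simp [List.range_succ]
    · intro i hi h
      simp only [List.length_map, List.length_range] at hi h
      refine hf i ?_
      have := evaln_sound h
      rwa [← List.map_take, List.take_range,
        min_eq_left (by simpa [Nat.lt_succ_iff] using hi)] at this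

/-- The states from which the path trees are grown. -/
abbrev State := List (Code × ℕ × List ℕ)

/-- The relation between states whose path trees are isomorphic exactly when ranks agree. -/
def stateRel : State → State → Prop := listRel searchRel

/-- Every state is the label of infinitely many naturals. -/
def stateLabel (m : ℕ) : State := (ofNat (State × ℕ) m).1

theorem infinite_stateLabel_eq (x : State) : {m | stateLabel m = x}.Infinite :=
  Set.infinite_of_injective_forall_mem (f := fun k : ℕ => encode (x, k))
    (fun a b h => by simpa using h)
    (fun k => by simp only [stateLabel, Set.mem_ofPred_eq, ofNat_encode])

theorem treeIso_pathTree_state_iff {x : State} :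
    TreeIso (pathTree stateRel stateLabel x) (pathTree stateRel stateLabel []) ↔
      ¬ Acc stateRel x := by
  refine ⟨fun h hx => ?_, fun hx => ?_⟩
  · exact not_hasBranch_pathTree_of_acc hx (hasBranch_of_treeIso h
      (hasBranch_pathTree_of_not_acc (fun x => (infinite_stateLabel_eq x).nonempty)
        not_acc_listRel_nil))
  · refine treeIso_pathTree (v := extRank stateRel) infinite_stateLabel_eq
      (fun x x' y h hy => RankSaturated.exists_rel (r := listRel searchRel)
        (rankSaturated_listRel _) h hy) ?_
    rw [extRank_of_not_acc hx]
    exact (extRank_of_not_acc not_acc_listRel_nil).symm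

end Search

section Primrec

open Nat.Partrec (Code)
open Nat.Partrec.Code

variable {α : Type*} [Primcodable α]

theorem _root_.PrimrecPred.imp {p q : α → Prop} (hp : PrimrecPred p) (hq : PrimrecPred q) :
    PrimrecPred fun a => p a → q a :=
  (hp.not.or hq).of_eq fun _ => imp_iff_not_or.symm

theorem _root_.PrimrecPred.iff {p q : α → Prop} (hp : PrimrecPred p) (hq : PrimrecPred q) :
    PrimrecPred fun a => p a ↔ q a :=
  ((hp.imp hq).and (hq.imp hp)).of_eq fun _ => iff_def.symm

theorem primrecRel_isPrefix : PrimrecRel fun l l' : List ℕ => l <+: l' :=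
  (Primrec.eq.comp Primrec.fst (Primrec.list_take.comp (Primrec.list_length.comp Primrec.fst)
    Primrec.snd)).of_eq fun _ => List.prefix_iff_eq_take.symm

theorem primrecRel_searchRel : PrimrecRel searchRel := by
  have h1 : Primrec fun p : (Code × ℕ × List ℕ) × Code × ℕ × List ℕ => p.1.2.2 :=
    Primrec.snd.comp (Primrec.snd.comp Primrec.fst)
  have h2 : Primrec fun p : (Code × ℕ × List ℕ) × Code × ℕ × List ℕ => p.2.2.2 :=
    Primrec.snd.comp (Primrec.snd.comp Primrec.snd)
  have hR : PrimrecRel fun (k : ℕ) (a : Code × ℕ × List ℕ) =>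
      evaln a.2.2.length a.1 (Nat.pair a.2.1 (encode (a.2.2.take k))) ≠ some 0 := by
    have hs : Primrec fun p : ℕ × Code × ℕ × List ℕ => p.2.2.2 :=
      Primrec.snd.comp (Primrec.snd.comp Primrec.snd)
    refine (Primrec.eq.comp (primrec_evaln.comp (((Primrec.list_length.comp hs).pair
      (Primrec.fst.comp Primrec.snd)).pair (Primrec₂.natPair.comp
        (Primrec.fst.comp (Primrec.snd.comp Primrec.snd))
        (Primrec.encode.comp (Primrec.list_take.comp Primrec.fst hs)))))
      (Primrec.const (some 0))).not
  refine PrimrecPred.and (Primrec.eq.comp (Primrec.fst.comp Primrec.fst)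
    (Primrec.fst.comp Primrec.snd)) (PrimrecPred.and (Primrec.eq.comp
      (Primrec.fst.comp (Primrec.snd.comp Primrec.fst))
      (Primrec.fst.comp (Primrec.snd.comp Primrec.snd))) (PrimrecPred.and
        (primrecRel_isPrefix.comp h2 h1) (PrimrecPred.and
          (Primrec.nat_lt.comp (Primrec.list_length.comp h2) (Primrec.list_length.comp h1)) ?_)))
  exact hR.forall_mem_list.comp
    (Primrec.list_range.comp (Primrec.succ.comp (Primrec.list_length.comp h1))) Primrec.fst

theorem listRel_iff_getD {A : Type*} {b : A → A → Prop} (d : A) {y x : List A} :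
    listRel b y x ↔ x.length ≤ y.length ∧
      ∀ i ∈ List.range x.length, b (y.getD i d) (x.getD i d) := by
  constructor
  · rintro ⟨p, q, rfl, h⟩
    have hl := h.length_eq
    refine ⟨by simp [hl], fun i hi => ?_⟩
    have hi : i < x.length := List.mem_range.1 hi
    rw [List.getD_append _ _ _ _ (hl ▸ hi), List.getD_eq_getElem _ _ hi,
      List.getD_eq_getElem _ _ (hl ▸ hi)]
    exact h.get (hl ▸ hi) hi
  · rintro ⟨hl, h⟩
    refine ⟨y.take x.length, y.drop x.length, (List.take_append_drop _ _).symm, ?_⟩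
    rw [List.forall₂_iff_get]
    refine ⟨by simpa using hl, fun i h1 h2 => ?_⟩
    have := h i (List.mem_range.2 h2)
    rw [List.getD_eq_getElem _ _ h2, List.getD_eq_getElem _ _ (h2.trans_le hl)] at this
    simpa using this

theorem primrecRel_listRel {b : α → α → Prop} (hb : PrimrecRel b) (d : α) :
    PrimrecRel (listRel b) := by
  have hR : PrimrecRel fun (i : ℕ) (p : List α × List α) => b (p.1.getD i d) (p.2.getD i d) :=
    hb.comp ((Primrec.list_getD d).comp (Primrec.fst.comp Primrec.snd) Primrec.fst)
      ((Primrec.list_getD d).comp (Primrec.snd.comp Primrec.snd) Primrec.fst)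
  refine PrimrecPred.of_eq (PrimrecPred.and (Primrec.nat_le.comp
    (Primrec.list_length.comp Primrec.snd) (Primrec.list_length.comp Primrec.fst))
    (hR.forall_mem_list.comp (Primrec.list_range.comp (Primrec.list_length.comp Primrec.snd))
      Primrec.id)) fun p => (listRel_iff_getD d).symm

theorem primrecRel_path {r : α → α → Prop} (hr : PrimrecRel r) {label : ℕ → α}
    (hl : Primrec label) : PrimrecRel (Path r label) := by
  classical
  have hm : Primrec fun p : (α × List ℕ) × (α × Bool) × ℕ => label p.2.2 :=
    hl.comp (Primrec.snd.comp Primrec.snd)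
  have hs : Primrec fun p : (α × List ℕ) × (α × Bool) × ℕ => p.2.1 :=
    Primrec.fst.comp Primrec.snd
  have : Primrec fun p : α × List ℕ => (p.2.foldl (fun (s : α × Bool) m =>
      (label m, s.2 && decide (r (label m) s.1))) (p.1, true)).2 :=
    Primrec.snd.comp (Primrec.list_foldl Primrec.snd (Primrec.fst.pair (Primrec.const true))
      (hm.pair (Primrec.and.comp (Primrec.snd.comp hs)
        (hr.decide.comp hm (Primrec.fst.comp hs)))).to₂)
  exact (Primrec.eq.comp this (Primrec.const true)).of_eq fun p => (path_iff_foldl p.1 p.2).symm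

theorem primrecRel_path_state : PrimrecRel (Path stateRel stateLabel) :=
  primrecRel_path (primrecRel_listRel primrecRel_searchRel (default, 0, []))
    (Primrec.fst.comp (Primrec.ofNat _))

/-- Indices for the path trees can be computed from their starting states. -/
theorem exists_computable_index : ∃ h : State → ℕ, Computable h ∧
    ∀ x, IndexesTree (h x) ∧ TreeOf (h x) = pathTree stateRel stateLabel x := by
  classical
  have hp : Computable fun k : ℕ => (decide (Path stateRel stateLabel
      (ofNat State k.unpair.1) (ofNat (List ℕ) k.unpair.2))).toNat :=
    ((Primrec.dom_bool Bool.toNat).comp (primrecRel_path_state.decide.comp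
      ((Primrec.ofNat _).comp (Primrec.fst.comp Primrec.unpair))
      ((Primrec.ofNat _).comp (Primrec.snd.comp Primrec.unpair)))).to_comp
  obtain ⟨d, hd⟩ := exists_code.1 (Partrec.nat_iff.1 hp)
  have ev : ∀ x l, evalCode (encode (d.curry (encode x))) (encode l) =
      Part.some (decide (Path stateRel stateLabel x l)).toNat := fun x l => by
    simp [evalCode, eval_curry, hd]
  have tr : ∀ x, TreeOf (encode (d.curry (encode x))) = pathTree stateRel stateLabel x :=
    fun x => Set.ext fun l => by
      simp [TreeOf, pathTree, ev]
  refine ⟨fun x => encode (d.curry (encode x)), (Primrec.encode.comp (primrec₂_curry.comp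
    (Primrec.const d) Primrec.encode)).to_comp, fun x => ⟨⟨fun l => ?_, ?_⟩, tr x⟩⟩
  · rw [ev]
    cases decide (Path stateRel stateLabel x l) <;> simp
  · rw [tr]
    exact isTree_pathTree x

/-- Every `Σ¹₁` set reduces to the inaccessible states. -/
theorem exists_state_of_sigma11 {B : Set ℕ} (hB : Sigma11 B) :
    ∃ g : ℕ → State, Computable g ∧ ∀ n, n ∈ B ↔ ¬ Acc stateRel (g n) := by
  obtain ⟨R, hR, rfl⟩ := hB
  have hp : Computable fun k : ℕ => (R k.unpair.1 (ofNat (List ℕ) k.unpair.2)).toNat :=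
    (Primrec.dom_bool Bool.toNat).to_comp.comp (hR.comp
      (Primrec.fst.comp Primrec.unpair).to_comp
      ((Primrec.ofNat _).comp (Primrec.snd.comp Primrec.unpair)).to_comp)
  obtain ⟨c, hc⟩ := exists_code.1 (Partrec.nat_iff.1 hp)
  refine ⟨fun n => [(c, n, [])], (Primrec.list_cons.comp ((Primrec.const c).pair
    (Primrec.id.pair (Primrec.const []))) (Primrec.const [])).to_comp, fun n => ?_⟩
  rw [stateRel, not_acc_listRel_singleton_iff, not_acc_searchRel_iff]
  refine exists_congr fun f => forall_congr' fun k => ?_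
  cases h : R n ((List.range k).map f) <;> simp [hc, h]

end Primrec

section Sigma11

open Nat.Partrec (Code)
open Nat.Partrec.Code

/-- A set defined by a primitive recursive condition on all pairs of values of a function is
`Σ¹₁`. -/
theorem sigma11_of_pairs {P : ℕ × (ℕ × ℕ) × ℕ × ℕ → Prop} (hP : PrimrecPred P) :
    Sigma11 {e | ∃ f : ℕ → ℕ, ∀ i j, P (e, (i, f i), j, f j)} := by
  classical
  let pos : List ℕ → ℕ × ℕ := fun s => (s.length - 1).unpair
  have hpos : Primrec fun p : ℕ × List ℕ => pos p.2 :=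
    Primrec.unpair.comp (Primrec.nat_sub.comp (Primrec.list_length.comp Primrec.snd)
      (Primrec.const 1))
  have hget : ∀ {g : ℕ × List ℕ → ℕ}, Primrec g →
      Primrec fun p : ℕ × List ℕ => (g p, p.2.getD (g p) 0) := fun hg =>
    hg.pair ((Primrec.list_getD 0).comp Primrec.snd hg)
  have hQ : PrimrecPred fun p : ℕ × List ℕ => p.2 = [] ∨ P (p.1,
      ((pos p.2).1, p.2.getD (pos p.2).1 0), (pos p.2).2, p.2.getD (pos p.2).2 0) :=
    (Primrec.eq.comp Primrec.snd (Primrec.const [])).or (hP.comp (Primrec.fst.pair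
      ((hget (Primrec.fst.comp hpos)).pair (hget (Primrec.snd.comp hpos)))))
  refine ⟨fun e s => decide (s = [] ∨ P (e,
      ((pos s).1, s.getD (pos s).1 0), (pos s).2, s.getD (pos s).2 0)),
    hQ.decide.to_comp, Set.ext fun e => exists_congr fun f => ?_⟩
  have get : ∀ {k i}, i ≤ k → ((List.range (k + 1)).map f).getD i 0 = f i := fun {k i} h => by
    rw [List.getD_eq_getElem _ _ (by simpa [Nat.lt_succ_iff] using h)]
    simp
  have step : ∀ k, P (e, (k.unpair.1, f k.unpair.1), k.unpair.2, f k.unpair.2) ↔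
      decide ((List.range (k + 1)).map f = [] ∨ P (e,
        ((pos ((List.range (k + 1)).map f)).1,
          ((List.range (k + 1)).map f).getD (pos ((List.range (k + 1)).map f)).1 0),
        (pos ((List.range (k + 1)).map f)).2,
          ((List.range (k + 1)).map f).getD (pos ((List.range (k + 1)).map f)).2 0)) = true := by
    intro k
    have hk : pos ((List.range (k + 1)).map f) = k.unpair := by simp [pos]
    rw [hk, get (Nat.unpair_left_le k), get (Nat.unpair_right_le k), decide_eq_true_iff]
    simp
  constructor
  · rintro h (_ | k)
    · simp
    · exact (step k).1 (h _ _)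
  · intro h i j
    simpa using (step (Nat.pair i j)).2 (h _)

/-- The list coded by a natural number. -/
def listOf (i : ℕ) : List ℕ := ofNat (List ℕ) i

@[simp]
theorem listOf_encode (l : List ℕ) : listOf (encode l) = l := ofNat_encode l

@[simp]
theorem encode_listOf (i : ℕ) : encode (listOf i) = i := encode_ofNat i

/-- The number of steps recorded by a certificate, which is a code for a number of steps, the image
of an input and the preimage of that input. -/
def certSteps (v : ℕ) : ℕ := (ofNat (ℕ × ℕ × ℕ) v).1

/-- The image recorded by a certificate. -/
def certImage (v : ℕ) : ℕ := (ofNat (ℕ × ℕ × ℕ) v).2.1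

/-- The preimage recorded by a certificate. -/
def certPreimage (v : ℕ) : ℕ := (ofNat (ℕ × ℕ × ℕ) v).2.2

/-- The `e`-th partial computable function returns `b` on the first entry of `p`, within the number
of steps given by the certificate in the second entry. -/
def CertVal (e : ℕ) (p : ℕ × ℕ) (b : ℕ) : Prop :=
  evaln (certSteps p.2) (ofNat Code e) p.1 = some b

/-- The condition on pairs of certificates expressing that they describe an isomorphism between
the tree with index `e` and `T`. -/
def IsoCert (T : Set (List ℕ)) (e : ℕ) (p q : ℕ × ℕ) : Prop :=
  (CertVal e p 0 ∨ CertVal e p 1) ∧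
  (CertVal e p 1 → listOf q.1 <+: listOf p.1 → CertVal e q 1) ∧
  (CertVal e p 1 → listOf (certImage p.2) ∈ T) ∧
  (CertVal e p 1 → CertVal e q 1 →
    (listOf p.1 <+: listOf q.1 ↔ listOf (certImage p.2) <+: listOf (certImage q.2))) ∧
  (listOf p.1 ∈ T → q.1 = certPreimage p.2 → CertVal e q 1 ∧ certImage q.2 = p.1)

theorem CertVal.eval {e b : ℕ} {l : List ℕ} {v : ℕ} (h : CertVal e (encode l, v) b) :
    evalCode e (encode l) = Part.some b :=
  Part.eq_some_iff.2 (evaln_sound h)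

theorem mem_isom_iff {T : Set (List ℕ)} {e : ℕ} :
    e ∈ Isom T ↔ ∃ f : ℕ → ℕ, ∀ i j, IsoCert T e (i, f i) (j, f j) := by
  classical
  constructor
  · rintro ⟨⟨htot, htree⟩, π, hπ⟩
    have ht : ∀ i, ∃ t, evaln t (ofNat Code e) i = some 0 ∨ evaln t (ofNat Code e) i = some 1 := by
      intro i
      have := htot (listOf i)
      rw [encode_listOf] at this
      rcases this with h | h <;> obtain ⟨t, ht⟩ := evaln_complete.1 (Part.eq_some_iff.1 h)
      exacts [⟨t, .inl ht⟩, ⟨t, .inr ht⟩]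
    choose t ht using ht
    let f : ℕ → ℕ := fun i => encode (t i,
      if h : listOf i ∈ TreeOf e then encode (π ⟨_, h⟩ : List ℕ) else 0,
      if h : listOf i ∈ T then encode (π.symm ⟨_, h⟩ : List ℕ) else 0)
    have hval : ∀ i, CertVal e (i, f i) 1 ↔ listOf i ∈ TreeOf e := by
      intro i
      have hs : certSteps (f i) = t i := by simp [f, certSteps]
      constructor
      · intro h
        exact Part.eq_some_iff.2 (evaln_sound (by simpa [CertVal] using h))
      · intro h
        have h : evalCode e (encode (listOf i)) = Part.some 1 := h
        rw [encode_listOf] at h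
        rcases ht i with h0 | h1
        · have := Part.mem_unique (evaln_sound h0) (Part.eq_some_iff.1 h)
          omega
        · simpa [CertVal, hs] using h1
    have him : ∀ i (h : listOf i ∈ TreeOf e), certImage (f i) = encode (π ⟨_, h⟩ : List ℕ) := by
      intro i h
      simp [f, certImage, h]
    refine ⟨f, fun i j => ⟨?_, ?_, ?_, ?_, ?_⟩⟩
    · simpa [CertVal, f, certSteps] using ht i
    · rw [hval, hval]
      exact fun h hp => htree _ h _ hp
    · rw [hval]
      intro h
      simp [him i h]
    · rw [hval, hval]
      intro hi hj
      simpa [him i hi, him j hj] using hπ ⟨_, hi⟩ ⟨_, hj⟩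
    · intro h hj
      have hj : j = encode (π.symm ⟨_, h⟩ : List ℕ) := by
        simpa [f, certPreimage, h] using hj
      have hmem : listOf j ∈ TreeOf e := by
        rw [hj, listOf_encode]
        exact (π.symm _).2
      refine ⟨(hval j).2 hmem, ?_⟩
      have : (⟨listOf j, hmem⟩ : TreeOf e) = π.symm ⟨_, h⟩ := Subtype.ext (by simp [hj])
      simp [him j hmem, this]
  · rintro ⟨f, hf⟩
    have hval : ∀ l, l ∈ TreeOf e ↔ CertVal e (encode l, f (encode l)) 1 := by
      intro l
      refine ⟨fun h => ((hf (encode l) 0).1).resolve_left fun h0 => ?_, CertVal.eval⟩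
      have := Part.some_inj.1 (h0.eval.symm.trans h)
      omega
    refine ⟨⟨fun l => (hf (encode l) 0).1.imp CertVal.eval CertVal.eval, fun l hl l' h => ?_⟩, ?_⟩
    · rw [hval] at hl ⊢
      exact (hf (encode l) (encode l')).2.1 hl (by simpa using h)
    · let φ : TreeOf e → T := fun l => ⟨listOf (certImage (f (encode (l : List ℕ)))),
        (hf _ 0).2.2.1 ((hval _).1 l.2)⟩
      have hφ : ∀ a b : TreeOf e, (a : List ℕ) <+: b ↔ (φ a : List ℕ) <+: φ b := fun a b => by
        simpa using (hf (encode (a : List ℕ)) (encode (b : List ℕ))).2.2.2.1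
          ((hval _).1 a.2) ((hval _).1 b.2)
      refine ⟨Equiv.ofBijective φ ⟨fun a b h => ?_, fun l => ?_⟩, hφ⟩
      · have h1 := (hφ a b).2 (by rw [h])
        have h2 := (hφ b a).2 (by rw [h])
        exact Subtype.ext (h1.eq_of_length (h1.length_le.antisymm h2.length_le))
      · obtain ⟨h1, h2⟩ := (hf (encode (l : List ℕ)) (certPreimage (f (encode (l : List ℕ))))).2.2.2.2
          (by simp) rfl
        refine ⟨⟨listOf (certPreimage (f (encode (l : List ℕ)))), (hval _).2 (by simpa using h1)⟩,
          Subtype.ext ?_⟩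
        simp only at h2
        simp [φ, h2]

theorem sigma11_isom {T : Set (List ℕ)} (hT : PrimrecPred (· ∈ T)) : Sigma11 (Isom T) := by
  have hS : Primrec certSteps := Primrec.fst.comp (Primrec.ofNat _)
  have hI : Primrec certImage := Primrec.fst.comp (Primrec.snd.comp (Primrec.ofNat _))
  have hJ : Primrec certPreimage := Primrec.snd.comp (Primrec.snd.comp (Primrec.ofNat _))
  have hL : Primrec listOf := Primrec.ofNat _
  have hV : ∀ {g : ℕ × (ℕ × ℕ) × ℕ × ℕ → ℕ × ℕ} (b : ℕ), Primrec g →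
      PrimrecPred fun x => CertVal x.1 (g x) b := fun b hg =>
    Primrec.eq.comp (primrec_evaln.comp (((hS.comp (Primrec.snd.comp hg)).pair
      ((Primrec.ofNat Code).comp Primrec.fst)).pair (Primrec.fst.comp hg))) (Primrec.const (some b))
  have hp : Primrec fun x : ℕ × (ℕ × ℕ) × ℕ × ℕ => x.2.1 := Primrec.fst.comp Primrec.snd
  have hq : Primrec fun x : ℕ × (ℕ × ℕ) × ℕ × ℕ => x.2.2 := Primrec.snd.comp Primrec.snd
  have hp1 := Primrec.fst.comp hp
  have hq1 := Primrec.fst.comp hq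
  have hp2 := Primrec.snd.comp hp
  have hq2 := Primrec.snd.comp hq
  have hC : PrimrecPred fun x : ℕ × (ℕ × ℕ) × ℕ × ℕ => IsoCert T x.1 x.2.1 x.2.2 :=
    ((hV 0 hp).or (hV 1 hp)).and <|
    ((hV 1 hp).imp ((primrecRel_isPrefix.comp (hL.comp hq1) (hL.comp hp1)).imp (hV 1 hq))).and <|
    ((hV 1 hp).imp (hT.comp (hL.comp (hI.comp hp2)))).and <|
    ((hV 1 hp).imp ((hV 1 hq).imp ((primrecRel_isPrefix.comp (hL.comp hp1) (hL.comp hq1)).iff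
      (primrecRel_isPrefix.comp (hL.comp (hI.comp hp2)) (hL.comp (hI.comp hq2)))))).and <|
    (hT.comp (hL.comp hp1)).imp ((Primrec.eq.comp hq1 (hJ.comp hp2)).imp
      ((hV 1 hq).and (Primrec.eq.comp (hI.comp hq2) hp1)))
  have h : Isom T = {e | ∃ f : ℕ → ℕ, ∀ i j, IsoCert T e (i, f i) (j, f j)} :=
    Set.ext fun e => mem_isom_iff
  rw [h]
  exact sigma11_of_pairs hC

end Sigma11

end IsomTree

/-- There is a computable tree whose isomorphism index set is `Σ¹₁`-complete. -/
theorem exists_computable_tree_isom_Sigma11_complete :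
    ∃ T : Set (List ℕ), IsTree T ∧ ComputablePred (· ∈ T) ∧ Sigma11Complete (Isom T) := by
  have hT := IsomTree.primrecRel_path_state.comp (Primrec.const []) Primrec.id
  refine ⟨IsomTree.pathTree IsomTree.stateRel IsomTree.stateLabel [], IsomTree.isTree_pathTree _,
    hT.computablePred, IsomTree.sigma11_isom hT, fun B hB => ?_⟩
  obtain ⟨g, hg, hgB⟩ := IsomTree.exists_state_of_sigma11 hB
  obtain ⟨h, hh, hI⟩ := IsomTree.exists_computable_index
  refine ⟨fun n => h (g n), hh.comp hg, fun n => ?_⟩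
  refine (hgB n).trans (IsomTree.treeIso_pathTree_state_iff.symm.trans ?_)
  change _ ↔ _ ∧ _
  rw [(hI (g n)).2]
  exact (and_iff_right (hI (g n)).1).symm
end

section
/- For every computable S : ℕ → ℕ → ℕ → Bool there is a computable R : ℕ → ℕ → ℕ → Bool such that, setting F n x :⟺ (∀ y, R n x y = true): (i) F is single-valued, i.e., for all n, x, x', if F n x and F n x' then x = x'; and (ii) for every n, (∃ x, F n x) ↔ (∃ x, ∀ y, S n x y = true). (Equivalently: every Π⁰₁ relation A(n,x) admits a partial function f with Π⁰₁ graph and dom f = dom A.) -/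
/-- One step of the unbounded search for an `x` with `∀ y, P x y = true`: from the state `(x, y)`,
move to `(x, y + 1)` if `P x y` holds, and restart at `(x + 1, 0)` otherwise. -/
def searchStep (P : ℕ → ℕ → Bool) (s : ℕ × ℕ) : ℕ × ℕ :=
  bif P s.1 s.2 then (s.1, s.2 + 1) else (s.1 + 1, 0)

/-- The state of the search after `t` steps, starting from `(0, 0)`. -/
def searchState (P : ℕ → ℕ → Bool) (t : ℕ) : ℕ × ℕ :=
  Nat.rec (0, 0) (fun _ s => searchStep P s) t

theorem searchState_succ (P : ℕ → ℕ → Bool) (t : ℕ) :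
    searchState P (t + 1) = searchStep P (searchState P t) := rfl

theorem searchState_add {P : ℕ → ℕ → Bool} {t x y : ℕ} (ht : searchState P t = (x, 0))
    (h : ∀ z < y, P x z = true) : searchState P (t + y) = (x, y) := by
  induction y with
  | zero => exact ht
  | succ y ih =>
    rw [← Nat.add_assoc, searchState_succ, ih fun z hz => h z (hz.trans y.lt_succ_self)]
    simp [searchStep, h y y.lt_succ_self]

theorem forall_of_searchState_snd_ne_zero {P : ℕ → ℕ → Bool} {t x : ℕ}
    (ht : searchState P t = (x, 0)) (h : ∀ y, (searchState P (t + y + 1)).2 ≠ 0) (y : ℕ) :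
    P x y = true := by
  induction y using Nat.strong_induction_on with
  | _ y ih =>
    have hy := h y
    rw [searchState_succ, searchState_add ht ih] at hy
    by_contra hP
    simp [searchStep, Bool.eq_false_of_not_eq_true hP] at hy

theorem exists_searchState_eq {P : ℕ → ℕ → Bool} (x : ℕ)
    (h : ∀ k < x, ∃ y, P k y = false) : ∃ t, searchState P t = (x, 0) := by
  induction x with
  | zero => exact ⟨0, rfl⟩
  | succ x ih =>
    obtain ⟨t, ht⟩ := ih fun k hk => h k (hk.trans x.lt_succ_self)
    have hx := h x x.lt_succ_self
    refine ⟨t + Nat.find hx + 1, ?_⟩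
    rw [searchState_succ, searchState_add ht fun z hz => by simpa using Nat.find_min hx hz]
    simp [searchStep, Nat.find_spec hx]

theorem computable_searchStep {S : ℕ → ℕ → ℕ → Bool}
    (hS : Computable fun p : ℕ × ℕ × ℕ => S p.1 p.2.1 p.2.2) :
    Computable fun p : ℕ × ℕ × ℕ => searchStep (S p.1) p.2 := by
  have hx : Computable fun p : ℕ × ℕ × ℕ => p.2.1 := Computable.fst.comp Computable.snd
  have hy : Computable fun p : ℕ × ℕ × ℕ => p.2.2 := Computable.snd.comp Computable.snd
  exact Computable.cond hS (hx.pair (Computable.succ.comp hy))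
    ((Computable.succ.comp hx).pair (Computable.const 0))

theorem computable_searchState {S : ℕ → ℕ → ℕ → Bool}
    (hS : Computable fun p : ℕ × ℕ × ℕ => S p.1 p.2.1 p.2.2) :
    Computable fun p : ℕ × ℕ => searchState (S p.1) p.2 := by
  have hn : Computable fun q : (ℕ × ℕ) × ℕ × ℕ × ℕ => q.1.1 :=
    Computable.fst.comp Computable.fst
  have hs : Computable fun q : (ℕ × ℕ) × ℕ × ℕ × ℕ => q.2.2 :=
    Computable.snd.comp Computable.snd
  have hstep : Computable₂ fun (p : ℕ × ℕ) (q : ℕ × ℕ × ℕ) => searchStep (S p.1) q.2 :=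
    ((computable_searchStep hS).comp (hn.pair hs)).to₂
  have hrec := Computable.nat_rec (f := fun p : ℕ × ℕ => p.2) (g := fun _ => ((0, 0) : ℕ × ℕ))
    (h := fun p q => searchStep (S p.1) q.2) Computable.snd (Computable.const (0, 0)) hstep
  exact hrec.of_eq fun _ => rfl

/-- Partial uniformization for `Π⁰₁` relations: every `Π⁰₁` relation `A(n,x)` admits a
partial function with `Π⁰₁` graph and the same domain. -/
theorem pi01_uniformization (S : ℕ → ℕ → ℕ → Bool)
    (hS : Computable fun p : ℕ × ℕ × ℕ => S p.1 p.2.1 p.2.2) :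
    ∃ R : ℕ → ℕ → ℕ → Bool,
      Computable (fun p : ℕ × ℕ × ℕ => R p.1 p.2.1 p.2.2) ∧
      (∀ n x x' : ℕ, (∀ y : ℕ, R n x y = true) → (∀ y : ℕ, R n x' y = true) → x = x') ∧
      (∀ n : ℕ, (∃ x : ℕ, ∀ y : ℕ, R n x y = true) ↔ (∃ x : ℕ, ∀ y : ℕ, S n x y = true)) := by
  -- `R n t` says that the search restarts at time `t` and never again.
  let R : ℕ → ℕ → ℕ → Bool := fun n t y =>
    decide ((searchState (S n) t).2 = 0 ∧ (searchState (S n) (t + y + 1)).2 ≠ 0)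
  have hR (n t y : ℕ) : R n t y = true ↔
      (searchState (S n) t).2 = 0 ∧ (searchState (S n) (t + y + 1)).2 ≠ 0 := by
    simp only [R, decide_eq_true_eq]
  refine ⟨R, ?_, fun n t t' h h' => ?_, fun n => ⟨?_, ?_⟩⟩
  · have hc := computable_searchState hS
    have ht : Computable fun p : ℕ × ℕ × ℕ => p.2.1 := Computable.fst.comp Computable.snd
    have hy : Computable fun p : ℕ × ℕ × ℕ => p.2.2 := Computable.snd.comp Computable.snd
    have ha : Computable fun p : ℕ × ℕ × ℕ => p.2.1 + p.2.2 + 1 :=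
      Computable.succ.comp (Primrec.nat_add.to_comp.comp ht hy)
    have h1 := Computable.snd.comp (hc.comp (Computable.fst.pair ht))
    have h2 := Computable.snd.comp (hc.comp (Computable.fst.pair ha))
    have hdec : Primrec₂ fun a b : ℕ => decide (a = 0 ∧ b ≠ 0) :=
      PrimrecPred.decide <| (Primrec.eq.comp Primrec.fst (Primrec.const 0)).and
        (Primrec.eq.comp Primrec.snd (Primrec.const 0)).not
    exact hdec.to_comp.comp h1 h2
  · simp only [hR] at h h'
    rcases lt_trichotomy t t' with hlt | heq | hlt
    · obtain ⟨k, rfl⟩ := Nat.exists_eq_add_of_lt hlt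
      exact absurd (h' 0).1 (h k).2
    · exact heq
    · obtain ⟨k, rfl⟩ := Nat.exists_eq_add_of_lt hlt
      exact absurd (h 0).1 (h' k).2
  · rintro ⟨t, h⟩
    simp only [hR] at h
    exact ⟨_, forall_of_searchState_snd_ne_zero (Prod.ext rfl (h 0).1) fun y => (h y).2⟩
  · intro h
    classical
    obtain ⟨t, ht⟩ := exists_searchState_eq (P := S n) (Nat.find h) fun k hk => by
      simpa using Nat.find_min h hk
    refine ⟨t, fun y => (hR n t y).2 ⟨by rw [ht], ?_⟩⟩
    rw [Nat.add_assoc, searchState_add ht fun z _ => Nat.find_spec h z]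
    exact y.succ_ne_zero
end

section
/- Isom(T_{Π₂}) is Π⁰₂-complete: it is a Π⁰₂ subset of ℕ, and every Π⁰₂ set A ⊆ ℕ is many-one reducible to it. -/
/-- `T_{Π₂}`: the infinite tree of height 1. -/
def TPi2 : Set (List ℕ) := {l | l.length ≤ 1}

/-- `A ⊆ ℕ` is `Π⁰₂`. -/
def Pi02 (A : Set ℕ) : Prop :=
  ∃ R : ℕ → ℕ → ℕ → Bool, Computable (fun p : ℕ × ℕ × ℕ => R p.1 p.2.1 p.2.2) ∧
    A = {n | ∀ x : ℕ, ∃ y : ℕ, R n x y = true}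

lemma treeIso_TPi2_iff {T : Set (List ℕ)} (hT : IsTree T) :
    TreeIso T TPi2 ↔ [] ∈ T ∧ (∀ l ∈ T, l.length ≤ 1) ∧ {n : ℕ | [n] ∈ T}.Infinite := by
  constructor
  · rintro ⟨π, hπ⟩
    have nil_mem : [] ∈ T := hT _ (π.symm ⟨[], by simp [TPi2]⟩).2 _ List.nil_prefix
    have eq_nil_of_apply (a : T) (ha : (π a : List ℕ) = []) : (a : List ℕ) = [] := by
      have h : (a : List ℕ) <+: [] := (hπ a ⟨[], nil_mem⟩).2 (by simp [ha])
      simpa using h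
    have length_le : ∀ l ∈ T, l.length ≤ 1 := by
      intro l hl
      match l, hl with
      | [], _ => simp
      | [_], _ => simp
      | a :: b :: l, hl =>
        exfalso
        have hp : [a] <+: a :: b :: l := ⟨b :: l, rfl⟩
        have ha : [a] ∈ T := hT _ hl _ hp
        have hpre := (hπ ⟨[a], ha⟩ ⟨_, hl⟩).1 hp
        have hne : (π ⟨[a], ha⟩ : List ℕ) ≠ [] := fun h => by
          simpa using eq_nil_of_apply _ h
        have hpos := List.length_pos_iff.2 hne
        have hle : (π ⟨_, hl⟩ : List ℕ).length ≤ 1 := (π ⟨_, hl⟩).2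
        have heq := hpre.eq_of_length (by have := hpre.length_le; omega)
        have := π.injective (Subtype.ext heq)
        simp at this
    refine ⟨nil_mem, length_le, fun hfin => ?_⟩
    have hTfin : T.Finite := by
      refine ((hfin.image fun n => [n]).insert []).subset fun l hl => ?_
      match l, hl, length_le l hl with
      | [], _, _ => simp
      | [n], hn, _ => exact Or.inr ⟨n, hn, rfl⟩
    have : Finite TPi2 := @Finite.of_equiv _ _ hTfin.to_subtype π
    exact not_injective_infinite_finite (fun n : ℕ => (⟨[n], by simp [TPi2]⟩ : TPi2))
      fun a b h => by simpa using congrArg Subtype.val h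
  · rintro ⟨nil_mem, length_le, hinf⟩
    let σ : ℕ → ℕ := Nat.nth fun n => [n] ∈ T
    have σ_inj : Function.Injective σ := Nat.nth_injective hinf
    have map_mem (l : List ℕ) (hl : l ∈ TPi2) : l.map σ ∈ T := by
      match l, hl with
      | [], _ => exact nil_mem
      | [n], _ => exact Nat.nth_mem_of_infinite hinf n
      | _ :: _ :: _, hl => simp [TPi2] at hl
    let f : TPi2 → T := fun l => ⟨(l : List ℕ).map σ, map_mem l l.2⟩
    have f_bij : Function.Bijective f := by
      refine ⟨fun a b h => Subtype.ext (List.map_injective_iff.2 σ_inj (congrArg Subtype.val h)),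
        fun ⟨l, hl⟩ => ?_⟩
      match l, hl, length_le l hl with
      | [], _, _ => exact ⟨⟨[], by simp [TPi2]⟩, rfl⟩
      | [n], hn, _ =>
        obtain ⟨m, hm⟩ : n ∈ Set.range σ := by rw [Nat.range_nth_of_infinite hinf]; exact hn
        exact ⟨⟨[m], by simp [TPi2]⟩, Subtype.ext (by simp [f, hm])⟩
    refine ⟨(Equiv.ofBijective f f_bij).symm, fun a b => ?_⟩
    obtain ⟨a, rfl⟩ := (Equiv.ofBijective f f_bij).surjective a
    obtain ⟨b, rfl⟩ := (Equiv.ofBijective f f_bij).surjective b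
    simpa [f] using List.prefix_map_iff_of_injective σ_inj

lemma mem_Isom_TPi2_iff (e : ℕ) :
    e ∈ Isom TPi2 ↔
      (∀ l : List ℕ, 0 ∈ evalCode e (Encodable.encode l) ∧ l ≠ [] ∨
        1 ∈ evalCode e (Encodable.encode l) ∧ l.length ≤ 1) ∧
      ∀ N : ℕ, ∃ n : ℕ, N ≤ n ∧ 1 ∈ evalCode e (Encodable.encode [n]) := by
  simp only [← Part.eq_some_iff]
  constructor
  · rintro ⟨⟨total, tree⟩, iso⟩
    obtain ⟨nil_mem, length_le, hinf⟩ := (treeIso_TPi2_iff tree).1 iso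
    refine ⟨fun l => ?_, fun N => ?_⟩
    · rcases total l with h | h
      · refine Or.inl ⟨h, ?_⟩
        rintro rfl
        have := h.symm.trans nil_mem
        simp at this
      · exact Or.inr ⟨h, length_le l h⟩
    · obtain ⟨n, hn, hlt⟩ := hinf.exists_gt N
      exact ⟨n, hlt.le, hn⟩
  · rintro ⟨total, unbounded⟩
    have length_le : ∀ l ∈ TreeOf e, l.length ≤ 1 := fun l hl => by
      rcases total l with h | h
      · have := h.1.symm.trans hl
        simp at this
      · exact h.2
    have nil_mem : [] ∈ TreeOf e := by
      rcases total [] with h | h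
      · exact absurd rfl h.2
      · exact h.1
    have tree : IsTree (TreeOf e) := by
      intro l hl l' hl'
      by_cases h0 : l' = []
      · exact h0 ▸ nil_mem
      · have := List.length_pos_iff.2 h0
        have := length_le l hl
        have h := hl'.eq_of_length (by have := hl'.length_le; omega)
        exact h ▸ hl
    refine ⟨⟨fun l => (total l).imp And.left And.left, tree⟩,
      (treeIso_TPi2_iff tree).2 ⟨nil_mem, length_le, ?_⟩⟩
    refine Set.infinite_of_not_bddAbove fun ⟨B, hB⟩ => ?_
    obtain ⟨n, hn, h⟩ := unbounded (B + 1)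
    have := hB h
    omega

open Nat.Partrec (Code)

open Nat.Partrec.Code in
lemma primrecPred_evaln {α : Type*} [Primcodable α] {k x v : α → ℕ} {c : α → Code}
    (hk : Primrec k) (hc : Primrec c) (hx : Primrec x) (hv : Primrec v) :
    PrimrecPred fun a => evaln (k a) (c a) (x a) = some (v a) :=
  Primrec.eq.comp (primrec_evaln.comp ((hk.pair hc).pair hx)) (Primrec.option_some.comp hv)

lemma primrecRel_exists_lt {α : Type*} [Primcodable α] {R : ℕ → α → Prop} (hR : PrimrecRel R) :
    PrimrecRel fun n a => ∃ i < n, R i a :=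
  (hR.exists_mem_list.comp (Primrec.list_range.comp Primrec.fst) Primrec.snd).of_eq (by simp)

lemma primrecRel_forall_lt {α : Type*} [Primcodable α] {R : ℕ → α → Prop} (hR : PrimrecRel R) :
    PrimrecRel fun n a => ∀ i < n, R i a :=
  (hR.forall_mem_list.comp (Primrec.list_range.comp Primrec.fst) Primrec.snd).of_eq (by simp)

lemma Pi02_of_primrecPred {A : Set ℕ} {P : ℕ × ℕ × ℕ → Prop} (hP : PrimrecPred P)
    (hA : ∀ n, n ∈ A ↔ ∀ x, ∃ y, P (n, x, y)) : Pi02 A := by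
  classical
  exact ⟨fun n x y => decide (P (n, x, y)), hP.decide.to_comp, by ext n; simp [hA]⟩

/-- The matrix of a `Π⁰₂` definition can be taken primitive recursive. -/
lemma Pi02.exists_primrecPred {A : Set ℕ} (hA : Pi02 A) :
    ∃ P : ℕ × ℕ × ℕ → Prop, PrimrecPred P ∧ ∀ n, n ∈ A ↔ ∀ x, ∃ y, P (n, x, y) := by
  obtain ⟨R, hR, rfl⟩ := hA
  obtain ⟨c, hc⟩ := Code.exists_code.1 hR
  have hc' (p : ℕ × ℕ × ℕ) (v : ℕ) : v ∈ c.eval (Encodable.encode p) ↔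
      v = Encodable.encode (R p.1 p.2.1 p.2.2) := by
    simp only [hc, Encodable.encodek]
    simp [-Encodable.encode_prod_val]
  refine ⟨fun p => Code.evaln p.2.2.unpair.1 c (Encodable.encode (p.1, p.2.1, p.2.2.unpair.2))
    = some 1, ?_, fun n => forall_congr' fun x => ?_⟩
  · have hu : Primrec fun p : ℕ × ℕ × ℕ => p.2.2.unpair :=
      Primrec.unpair.comp (Primrec.snd.comp Primrec.snd)
    exact primrecPred_evaln (Primrec.fst.comp hu) (Primrec.const c)
      (Primrec.encode.comp (Primrec.fst.pair
        ((Primrec.fst.comp Primrec.snd).pair (Primrec.snd.comp hu)))) (Primrec.const 1)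
  · constructor
    · rintro ⟨y, hy⟩
      obtain ⟨k, hk⟩ := Code.evaln_complete.1 ((hc' (n, x, y) 1).2 (by simp [hy]))
      exact ⟨Nat.pair k y, by simpa using hk⟩
    · rintro ⟨z, hz⟩
      have h := (hc' _ _).1 (Code.evaln_sound hz)
      refine ⟨z.unpair.2, ?_⟩
      cases hRz : R n x z.unpair.2
      · simp [hRz] at h
      · rfl

lemma Pi02_Isom_TPi2 : Pi02 (Isom TPi2) := by
  let c (p : ℕ × ℕ × ℕ) : Code := Denumerable.ofNat Code p.1
  let l (p : ℕ × ℕ × ℕ) : List ℕ := Denumerable.ofNat (List ℕ) p.2.1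
  let k (p : ℕ × ℕ × ℕ) : ℕ := p.2.2.unpair.1
  let m (p : ℕ × ℕ × ℕ) : ℕ := p.2.1 + p.2.2.unpair.2
  let P (p : ℕ × ℕ × ℕ) : Prop :=
    (Code.evaln (k p) (c p) p.2.1 = some 0 ∧ ¬ (l p).length = 0 ∨
      Code.evaln (k p) (c p) p.2.1 = some 1 ∧ (l p).length ≤ 1) ∧
    Code.evaln (k p) (c p) (Encodable.encode [m p]) = some 1
  have hP : PrimrecPred P := by
    have hc : Primrec c := (Primrec.ofNat Code).comp Primrec.fst
    have hx : Primrec fun p : ℕ × ℕ × ℕ => p.2.1 := Primrec.fst.comp Primrec.snd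
    have hl : Primrec fun p => (l p).length :=
      Primrec.list_length.comp ((Primrec.ofNat (List ℕ)).comp hx)
    have hu : Primrec fun p : ℕ × ℕ × ℕ => p.2.2.unpair :=
      Primrec.unpair.comp (Primrec.snd.comp Primrec.snd)
    have hk : Primrec k := Primrec.fst.comp hu
    have hm : Primrec m := Primrec.nat_add.comp hx (Primrec.snd.comp hu)
    refine PrimrecPred.and (PrimrecPred.or (PrimrecPred.and ?_ ?_) (PrimrecPred.and ?_ ?_)) ?_
    · exact primrecPred_evaln hk hc hx (Primrec.const 0)
    · exact (Primrec.eq.comp hl (Primrec.const 0)).not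
    · exact primrecPred_evaln hk hc hx (Primrec.const 1)
    · exact Primrec.nat_le.comp hl (Primrec.const 1)
    · exact primrecPred_evaln hk hc (Primrec.encode.comp
        (Primrec.list_cons.comp hm (Primrec.const []))) (Primrec.const 1)
  refine Pi02_of_primrecPred hP fun e => ?_
  rw [mem_Isom_TPi2_iff]
  constructor
  · rintro ⟨total, unbounded⟩ x
    obtain ⟨n, hn, h1⟩ := unbounded x
    obtain ⟨k₁, hk₁⟩ := Code.evaln_complete.1 h1
    have h := total (Denumerable.ofNat (List ℕ) x)
    simp only [Denumerable.encode_ofNat, evalCode, Code.evaln_complete] at h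
    obtain ⟨k₂, hk₂⟩ : ∃ k₂, Code.evaln k₂ (c (e, x, 0)) x = some 0 ∧ ¬ (l (e, x, 0)).length = 0 ∨
        Code.evaln k₂ (c (e, x, 0)) x = some 1 ∧ (l (e, x, 0)).length ≤ 1 := by
      rcases h with ⟨⟨k₂, hk₂⟩, hl⟩ | ⟨⟨k₂, hk₂⟩, hl⟩
      · exact ⟨k₂, Or.inl ⟨hk₂, by simpa using hl⟩⟩
      · exact ⟨k₂, Or.inr ⟨hk₂, hl⟩⟩
    refine ⟨Nat.pair (max k₁ k₂) (n - x), ?_⟩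
    simp only [P, k, m, Nat.unpair_pair, Nat.add_sub_cancel' hn]
    exact ⟨hk₂.imp (And.imp_left (Code.evaln_mono (le_max_right _ _)))
      (And.imp_left (Code.evaln_mono (le_max_right _ _))), Code.evaln_mono (le_max_left _ _) hk₁⟩
  · intro h
    refine ⟨fun l' => ?_, fun N => ?_⟩
    · obtain ⟨y, hy, -⟩ := h (Encodable.encode l')
      refine hy.imp ?_ ?_
      · rintro ⟨h0, hl⟩
        exact ⟨Code.evaln_sound h0, by simpa [l] using hl⟩
      · rintro ⟨h1, hl⟩
        exact ⟨Code.evaln_sound h1, by simpa [l] using hl⟩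
    · obtain ⟨y, -, hy⟩ := h N
      exact ⟨_, Nat.le_add_right _ _, Code.evaln_sound hy⟩

/-- Every uniformly primitive recursive family of sets of lists has a computable family of
indices. -/
lemma exists_index_of_primrecPred {P : ℕ × List ℕ → Prop} (hP : PrimrecPred P) :
    ∃ f : ℕ → ℕ, Computable f ∧ ∀ n l,
      (P (n, l) → evalCode (f n) (Encodable.encode l) = Part.some 1) ∧
      (¬ P (n, l) → evalCode (f n) (Encodable.encode l) = Part.some 0) := by
  classical
  have hg : Primrec fun p : ℕ × List ℕ => if P p then 1 else 0 :=
    Primrec.ite hP (Primrec.const 1) (Primrec.const 0)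
  obtain ⟨c, hc⟩ := Code.exists_code.1 hg.to_comp
  refine ⟨fun n => Encodable.encode (c.curry n), (Primrec.encode.comp
    (Code.primrec₂_curry.comp (Primrec.const c) Primrec.id)).to_comp, fun n l => ?_⟩
  have h : evalCode (Encodable.encode (c.curry n)) (Encodable.encode l) =
      Part.some (if P (n, l) then 1 else 0) := by
    rw [evalCode, Denumerable.ofNat_encode, Code.eval_curry, ← Encodable.encode_nat n,
      ← Encodable.encode_prod_val, hc]
    simp
  constructor <;> intro hPn <;> simp [h, hPn]

lemma Pi02.manyOneReducible_Isom_TPi2 {A : Set ℕ} (hA : Pi02 A) :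
    ManyOneReducible (· ∈ A) (· ∈ Isom TPi2) := by
  obtain ⟨Q, hQ, hAQ⟩ := hA.exists_primrecPred
  -- All the requirements up to `x` have witnesses below `s`.
  let D (n x s : ℕ) : Prop := ∀ i < x + 1, ∃ y < s, Q (n, i, y)
  have D_mono {n x s t : ℕ} (hst : s ≤ t) (h : D n x s) : D n x t := fun i hi =>
    let ⟨y, hy, hQy⟩ := h i hi
    ⟨y, hy.trans_le hst, hQy⟩
  have hD : PrimrecPred fun p : ℕ × ℕ × ℕ => D p.1 p.2.1 p.2.2 := by
    have h₁ : PrimrecRel fun (y : ℕ) (q : ℕ × ℕ) => Q (q.2, q.1, y) :=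
      PrimrecPred.comp hQ ((Primrec.snd.comp Primrec.snd).pair
        ((Primrec.fst.comp Primrec.snd).pair Primrec.fst))
    have h₂ : PrimrecRel fun (i : ℕ) (q : ℕ × ℕ) => ∃ y < q.2, Q (q.1, i, y) :=
      PrimrecRel.comp (f := fun p : ℕ × ℕ × ℕ => p.2.2) (g := fun p => (p.1, p.2.1))
        (primrecRel_exists_lt h₁) (Primrec.snd.comp Primrec.snd)
        (Primrec.fst.pair (Primrec.fst.comp Primrec.snd))
    exact (primrecRel_forall_lt h₂).comp (Primrec.succ.comp (Primrec.fst.comp Primrec.snd))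
      (Primrec.fst.pair (Primrec.snd.comp Primrec.snd))
  let S (n m : ℕ) : Prop := D n m.unpair.1 (m.unpair.2 + 1) ∧ ¬ D n m.unpair.1 m.unpair.2
  let P (p : ℕ × List ℕ) : Prop :=
    p.2.length = 0 ∨ p.2.length = 1 ∧ S p.1 p.2.headI
  have hP : PrimrecPred P := by
    have hlen : Primrec fun p : ℕ × List ℕ => p.2.length := Primrec.list_length.comp Primrec.snd
    have hu : Primrec fun p : ℕ × List ℕ => p.2.headI.unpair :=
      Primrec.unpair.comp (Primrec.list_headI.comp Primrec.snd)
    refine (Primrec.eq.comp hlen (Primrec.const 0)).or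
      ((Primrec.eq.comp hlen (Primrec.const 1)).and (PrimrecPred.and ?_ (PrimrecPred.not ?_)))
    · exact hD.comp (Primrec.fst.pair ((Primrec.fst.comp hu).pair
        (Primrec.succ.comp (Primrec.snd.comp hu))))
    · exact hD.comp (Primrec.fst.pair hu)
  obtain ⟨f, hf, hfP⟩ := exists_index_of_primrecPred hP
  refine ⟨f, hf, fun n => ?_⟩
  have mem_iff (l : List ℕ) : 1 ∈ evalCode (f n) (Encodable.encode l) ↔ P (n, l) := by
    by_cases h : P (n, l)
    · simp [(hfP n l).1 h, h]
    · simp [(hfP n l).2 h, h]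
  have total (l : List ℕ) : 0 ∈ evalCode (f n) (Encodable.encode l) ∧ l ≠ [] ∨
      1 ∈ evalCode (f n) (Encodable.encode l) ∧ l.length ≤ 1 := by
    by_cases h : P (n, l)
    · refine Or.inr ⟨(mem_iff l).2 h, ?_⟩
      rcases h with h | h <;> simp_all
    · refine Or.inl ⟨by simp [(hfP n l).2 h], ?_⟩
      rintro rfl
      exact h (Or.inl rfl)
  change n ∈ A ↔ f n ∈ Isom TPi2
  rw [mem_Isom_TPi2_iff, and_iff_right total, hAQ]
  simp only [mem_iff]
  have P_singleton (m : ℕ) : P (n, [m]) ↔ S n m := by simp [P]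
  simp only [P_singleton]
  constructor
  · intro h N
    have exists_stage : ∃ s, D n N s := by
      choose y hy using h
      refine ⟨(Finset.range (N + 1)).sup y + 1, fun i hi => ⟨y i, ?_, hy i⟩⟩
      exact Nat.lt_succ_of_le (Finset.le_sup (Finset.mem_range.2 hi))
    classical
    obtain ⟨s, hs⟩ : ∃ s, Nat.find exists_stage = s + 1 :=
      Nat.exists_eq_succ_of_ne_zero fun h0 => by
        obtain ⟨y, hy, -⟩ := (h0 ▸ Nat.find_spec exists_stage : D n N 0) 0 (by omega)
        omega
    refine ⟨Nat.pair N s, Nat.left_le_pair N s, ?_⟩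
    simp only [S, Nat.unpair_pair]
    exact ⟨hs ▸ Nat.find_spec exists_stage, Nat.find_min exists_stage (by omega)⟩
  · intro h x
    by_contra hx
    have hfin : {m | S n m}.Finite := by
      refine Set.Finite.of_injOn (f := fun m => m.unpair.1) (t := Set.Iio x) ?_ ?_
        (Set.finite_Iio x)
      · intro m hm
        by_contra hlt
        obtain ⟨y, -, hy⟩ := hm.1 x (by simpa [Nat.lt_succ_iff] using hlt)
        exact hx ⟨y, hy⟩
      · intro a ha b hb hab
        have stage_le {a b : ℕ} (ha : S n a) (hb : S n b) (hab : a.unpair.1 = b.unpair.1) :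
            a.unpair.2 ≤ b.unpair.2 := by
          by_contra hlt
          exact ha.2 (hab ▸ D_mono (not_le.1 hlt) hb.1)
        rw [← Nat.pair_unpair a, ← Nat.pair_unpair b, show a.unpair.1 = b.unpair.1 from hab,
          (stage_le ha hb hab).antisymm (stage_le hb ha hab.symm)]
    obtain ⟨B, hB⟩ := hfin.bddAbove
    obtain ⟨m, hm, hSm⟩ := h (B + 1)
    have := hB hSm
    omega

/-- `Isom(T_{Π₂})` is `Π⁰₂`-complete. -/
theorem isom_TPi2_Pi02_complete :
    Pi02 (Isom TPi2) ∧ ∀ A : Set ℕ, Pi02 A → ManyOneReducible (· ∈ A) (· ∈ Isom TPi2) :=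
  ⟨Pi02_Isom_TPi2, fun _ hA => hA.manyOneReducible_Isom_TPi2⟩
end

section
/- Isom(T_{Π₃}) is a Π⁰₃ subset of ℕ, and Isom(T_{Σ₃}) is the intersection of a Π⁰₃ set and a Σ⁰₃ set. -/
/-- `T_{Π₃}`: the tree of height 2 in which, for every `n`, infinitely many length-1 nodes
have exactly `n` children, and no length-1 node has infinitely many children. -/
def TPi3 : Set (List ℕ) :=
  {l | l = [] ∨ (∃ p : ℕ, l = [p]) ∨ ∃ p j : ℕ, j < (Nat.unpair p).1 ∧ l = [p, j]}

/-- `T_{Σ₃}`: `T_{Π₃}` together with one extra length-1 node with infinitely many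
children. -/
def TSig3 : Set (List ℕ) :=
  {l | l = [] ∨ (∃ p : ℕ, l = [p]) ∨ (∃ j : ℕ, l = [0, j]) ∨
    ∃ p j : ℕ, j < (Nat.unpair p).1 ∧ l = [p + 1, j]}

/-- `A ⊆ ℕ` is `Π⁰₃`. -/
def Pi03 (A : Set ℕ) : Prop :=
  ∃ R : ℕ → ℕ → ℕ → ℕ → Bool,
    Computable (fun p : ℕ × ℕ × ℕ × ℕ => R p.1 p.2.1 p.2.2.1 p.2.2.2) ∧
    A = {n | ∀ x : ℕ, ∃ y : ℕ, ∀ z : ℕ, R n x y z = true}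

/-- `A ⊆ ℕ` is `Σ⁰₃`. -/
def Sigma03 (A : Set ℕ) : Prop := Pi03 Aᶜ

/-! ### Isomorphism invariants of trees of height at most two -/

/-- The labels of the children of the node `[p]`. -/
def childLabels (T : Set (List ℕ)) (p : ℕ) : Set ℕ := {j | [p, j] ∈ T}

/-- The labels of the length-1 nodes with exactly `k` children. -/
def nodesWith (T : Set (List ℕ)) (k : ℕ∞) : Set ℕ :=
  {p | [p] ∈ T ∧ (childLabels T p).encard = k}

/-- A nonempty tree all of whose nodes have length at most two. -/
structure IsFlat (T : Set (List ℕ)) : Prop where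
  isTree : IsTree T
  nil_mem : [] ∈ T
  length_le : ∀ l ∈ T, l.length ≤ 2

theorem TreeIso.symm {S T : Set (List ℕ)} (h : TreeIso S T) : TreeIso T S := by
  obtain ⟨π, hπ⟩ := h
  exact ⟨π.symm, fun a b => by simpa using (hπ (π.symm a) (π.symm b)).symm⟩

theorem encard_prefixes_eq (l : List ℕ) : {x | x <+: l}.encard = l.length + 1 := by
  have : {x | x <+: l} = l.take '' (Finset.range (l.length + 1) : Set ℕ) := by
    ext x
    simp only [Set.mem_ofPred_eq, Set.mem_image, Finset.coe_range, Set.mem_Iio]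
    constructor
    · intro h
      exact ⟨x.length, by have := h.length_le; omega, (List.prefix_iff_eq_take.1 h).symm⟩
    · rintro ⟨n, -, rfl⟩
      exact List.prefix_iff_eq_take.2 (by simp)
  rw [this, Set.InjOn.encard_image, Set.encard_coe_eq_coe_finsetCard, Finset.card_range]
  · norm_cast
  · intro a ha b hb hab
    have := congrArg List.length hab
    simp only [List.length_take, Finset.coe_range, Set.mem_Iio] at this ha hb
    omega

theorem encard_node_prefixes_eq {T : Set (List ℕ)} (hT : IsTree T) (a : T) :
    {b : T | (b : List ℕ) <+: a}.encard = (a : List ℕ).length + 1 := by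
  rw [← encard_prefixes_eq, ← Subtype.val_injective.encard_image]
  congr 1
  ext x
  simp only [Set.mem_image, Set.mem_ofPred_eq, Subtype.exists, exists_and_left, exists_prop,
    exists_eq_right_right]
  exact ⟨fun h => h.1, fun h => ⟨h, hT _ a.2 _ h⟩⟩

section Iso

variable {S T : Set (List ℕ)}

theorem length_apply_of_iso (hT : IsTree T) (hS : IsTree S) (π : T ≃ S)
    (hπ : ∀ a b : T, (a : List ℕ) <+: b ↔ (π a : List ℕ) <+: π b) (a : T) :
    (π a : List ℕ).length = (a : List ℕ).length := by
  have h : π '' {b : T | (b : List ℕ) <+: a} = {c : S | (c : List ℕ) <+: π a} := by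
    ext c
    simp only [Set.mem_image, Set.mem_ofPred_eq]
    constructor
    · rintro ⟨b, hb, rfl⟩
      exact (hπ _ _).1 hb
    · intro hc
      exact ⟨π.symm c, (hπ _ _).2 (by simpa using hc), by simp⟩
  have h2 := encard_node_prefixes_eq hS (π a)
  rw [← h, π.injective.encard_image, encard_node_prefixes_eq hT] at h2
  have h3 : (a : List ℕ).length + 1 = (π a : List ℕ).length + 1 := by exact_mod_cast h2
  omega

theorem encard_childLabels_le_of_iso (hT : IsTree T) (hS : IsTree S) (π : T ≃ S)
    (hπ : ∀ a b : T, (a : List ℕ) <+: b ↔ (π a : List ℕ) <+: π b) {p q : ℕ} (hp : [p] ∈ T)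
    (hpq : (π ⟨[p], hp⟩ : List ℕ) = [q]) :
    (childLabels T p).encard ≤ (childLabels S q).encard := by
  have H : ∀ j, ∃ i, ∀ h : [p, j] ∈ T, (π ⟨[p, j], h⟩ : List ℕ) = [q, i] := by
    intro j
    by_cases h : [p, j] ∈ T
    · have h1 := length_apply_of_iso hT hS π hπ ⟨[p, j], h⟩
      have h2 := (hπ ⟨[p], hp⟩ ⟨[p, j], h⟩).1 (by simp)
      rw [hpq] at h2
      obtain ⟨t, ht⟩ := h2
      rw [← ht] at h1
      simp only [List.length_append, List.length_cons, List.length_nil] at h1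
      obtain ⟨i, rfl⟩ := List.length_eq_one_iff.1 (by omega : t.length = 1)
      exact ⟨i, fun _ => ht.symm⟩
    · exact ⟨0, fun h' => absurd h' h⟩
  choose f hf using H
  refine Set.encard_le_encard_of_injOn (f := f) ?_ ?_
  · intro j (hj : [p, j] ∈ T)
    change [q, f j] ∈ S
    rw [← hf j hj]
    exact (π _).2
  · intro i (hi : [p, i] ∈ T) j (hj : [p, j] ∈ T) hij
    have := (hf i hi).trans ((congrArg (fun x => [q, x]) hij).trans (hf j hj).symm)
    simpa using π.injective (Subtype.ext this)

theorem encard_nodesWith_le_of_iso (hT : IsTree T) (hS : IsTree S) (h : TreeIso T S) (k : ℕ∞) :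
    (nodesWith T k).encard ≤ (nodesWith S k).encard := by
  obtain ⟨π, hπ⟩ := h
  have H : ∀ p, ∃ q, ∀ h : [p] ∈ T, (π ⟨[p], h⟩ : List ℕ) = [q] := by
    intro p
    by_cases h : [p] ∈ T
    · obtain ⟨q, hq⟩ := List.length_eq_one_iff.1 (length_apply_of_iso hT hS π hπ ⟨[p], h⟩)
      exact ⟨q, fun _ => hq⟩
    · exact ⟨0, fun h' => absurd h' h⟩
  choose f hf using H
  refine Set.encard_le_encard_of_injOn (f := f) ?_ ?_
  · rintro p ⟨hp, rfl⟩
    have hq : [f p] ∈ S := by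
      rw [← hf p hp]
      exact (π _).2
    refine ⟨hq, le_antisymm ?_ (encard_childLabels_le_of_iso hT hS π hπ hp (hf p hp))⟩
    refine encard_childLabels_le_of_iso hS hT π.symm
      (fun a b => by simpa using (hπ (π.symm a) (π.symm b)).symm) hq ?_
    have : (⟨[f p], hq⟩ : S) = π ⟨[p], hp⟩ := Subtype.ext (hf p hp).symm
    rw [this, Equiv.symm_apply_apply]
  · intro i hi j hj hij
    have := (hf i hi.1).trans ((congrArg (fun x => [x]) hij).trans (hf j hj.1).symm)
    simpa using π.injective (Subtype.ext this)

end Iso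

theorem IsFlat.of_iso {S T : Set (List ℕ)} (hS : IsFlat S) (hT : IsTree T) (h : TreeIso T S) :
    IsFlat T := by
  obtain ⟨π, hπ⟩ := h
  refine ⟨hT, hT _ (π.symm ⟨[], hS.nil_mem⟩).2 _ (by simp), fun l hl => ?_⟩
  rw [← length_apply_of_iso hT hS.isTree π hπ ⟨l, hl⟩]
  exact hS.length_le _ (π _).2

theorem nonempty_equiv_of_encard_eq {s t : Set ℕ} (h : s.encard = t.encard) :
    Nonempty (s ≃ t) := by
  rw [← Cardinal.eq]
  exact Cardinal.toENat_injOn (Cardinal.mk_le_aleph0) (Cardinal.mk_le_aleph0) h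

/-- The nodes of a flat tree `T`: the root, the length-1 nodes and their children. -/
abbrev FlatNode (T : Set (List ℕ)) : Type :=
  Option (Σ p : {p // [p] ∈ T}, Option (childLabels T p))

/-- The list represented by a node. -/
def FlatNode.toList {T : Set (List ℕ)} : FlatNode T → List ℕ
  | none => []
  | some ⟨p, none⟩ => [p]
  | some ⟨p, some j⟩ => [p, j]

theorem FlatNode.toList_injective {T : Set (List ℕ)} :
    Function.Injective (FlatNode.toList (T := T)) := by
  rintro (_ | ⟨⟨p, hp⟩, _ | ⟨i, hi⟩⟩) (_ | ⟨⟨q, hq⟩, _ | ⟨j, hj⟩⟩) h <;>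
    simp only [FlatNode.toList, List.cons.injEq, reduceCtorEq, and_true, and_false] at h ⊢
  · subst h; rfl
  · obtain ⟨rfl, rfl⟩ := h; rfl

theorem FlatNode.range_toList {T : Set (List ℕ)} (hT : IsFlat T) :
    Set.range (FlatNode.toList (T := T)) = T := by
  ext l
  constructor
  · rintro ⟨_ | ⟨⟨p, hp⟩, _ | ⟨i, hi⟩⟩, rfl⟩
    exacts [hT.nil_mem, hp, hi]
  · intro hl
    match l, hl, hT.length_le l hl with
    | [], _, _ => exact ⟨none, rfl⟩
    | [p], hl, _ => exact ⟨some ⟨⟨p, hl⟩, none⟩, rfl⟩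
    | [p, j], hl, _ =>
      exact ⟨some ⟨⟨p, hT.isTree _ hl _ (by simp)⟩, some ⟨j, hl⟩⟩, rfl⟩
    | _ :: _ :: _ :: _, _, h => simp at h

theorem IsFlat.treeIso_of_encard_eq {S T : Set (List ℕ)} (hS : IsFlat S) (hT : IsFlat T)
    (h : ∀ k, (nodesWith T k).encard = (nodesWith S k).encard) : TreeIso T S := by
  let fT : {p // [p] ∈ T} → ℕ∞ := fun p => (childLabels T p).encard
  let fS : {p // [p] ∈ S} → ℕ∞ := fun p => (childLabels S p).encard
  have e : ∀ k, Nonempty ({a // fT a = k} ≃ {b // fS b = k}) := fun k => by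
    obtain ⟨e⟩ := nonempty_equiv_of_encard_eq (h k)
    exact ⟨(Equiv.subtypeSubtypeEquivSubtypeInter (fun p => [p] ∈ T)
      (fun p => (childLabels T p).encard = k)).trans (e.trans
      (Equiv.subtypeSubtypeEquivSubtypeInter (fun p => [p] ∈ S)
      (fun p => (childLabels S p).encard = k)).symm)⟩
  let σ : {p // [p] ∈ T} ≃ {p // [p] ∈ S} := Equiv.ofFiberEquiv fun k => (e k).some
  have τ : ∀ p : {p // [p] ∈ T}, Nonempty (childLabels T p ≃ childLabels S (σ p)) := fun p =>
    nonempty_equiv_of_encard_eq (Equiv.ofFiberEquiv_map (fun k => (e k).some) p).symm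
  let ψ : FlatNode T ≃ FlatNode S :=
    Equiv.optionCongr (Equiv.sigmaCongr σ fun p => Equiv.optionCongr (τ p).some)
  let eT : FlatNode T ≃ T := (Equiv.ofInjective _ FlatNode.toList_injective).trans
    (Equiv.setCongr (FlatNode.range_toList hT))
  let eS : FlatNode S ≃ S := (Equiv.ofInjective _ FlatNode.toList_injective).trans
    (Equiv.setCongr (FlatNode.range_toList hS))
  have hψ : ∀ a b : FlatNode T, a.toList <+: b.toList ↔ (ψ a).toList <+: (ψ b).toList := by
    have hσ : ∀ p q, ((σ p : ℕ) = σ q) ↔ (p : ℕ) = q := fun p q => by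
      rw [← Subtype.ext_iff, ← Subtype.ext_iff, σ.apply_eq_iff_eq]
    rintro (_ | ⟨p, _ | i⟩) (_ | ⟨q, _ | j⟩) <;>
      simp [ψ, Equiv.sigmaCongr, FlatNode.toList, List.cons_prefix_cons, hσ]
    intro hpq
    obtain rfl := Subtype.ext hpq
    rw [← Subtype.ext_iff, ← Subtype.ext_iff, Equiv.apply_eq_iff_eq]
  refine ⟨eT.symm.trans (ψ.trans eS), fun a b => ?_⟩
  have hT' : ∀ x, (eT x : List ℕ) = x.toList := fun x => rfl
  have hS' : ∀ x, (eS x : List ℕ) = x.toList := fun x => rfl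
  obtain ⟨a, rfl⟩ := eT.surjective a
  obtain ⟨b, rfl⟩ := eT.surjective b
  simp only [Equiv.trans_apply, Equiv.symm_apply_apply, hT', hS']
  exact hψ a b

theorem IsFlat.treeIso_iff {S T : Set (List ℕ)} (hS : IsFlat S) (hT : IsTree T) :
    TreeIso T S ↔ IsFlat T ∧ ∀ k, (nodesWith T k).encard = (nodesWith S k).encard :=
  ⟨fun h => ⟨hS.of_iso hT h, fun k => le_antisymm (encard_nodesWith_le_of_iso hT hS.isTree h k)
    (encard_nodesWith_le_of_iso hS.isTree hT h.symm k)⟩,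
    fun h => hS.treeIso_of_encard_eq h.1 h.2⟩

/-! ### The trees `T_{Π₃}` and `T_{Σ₃}` -/

theorem mem_TPi3_one {p : ℕ} : [p] ∈ TPi3 := by simp [TPi3]

theorem mem_TSig3_one {p : ℕ} : [p] ∈ TSig3 := by simp [TSig3]

theorem mem_TPi3_two {p j : ℕ} : [p, j] ∈ TPi3 ↔ j < (Nat.unpair p).1 := by simp [TPi3]

theorem mem_TSig3_two_zero {j : ℕ} : [0, j] ∈ TSig3 := by simp [TSig3]

theorem mem_TSig3_two_succ {p j : ℕ} : [p + 1, j] ∈ TSig3 ↔ j < (Nat.unpair p).1 := by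
  simp [TSig3]

theorem isTree_of_length_le {T : Set (List ℕ)} (h0 : [] ∈ T) (h1 : ∀ p, [p] ∈ T)
    (h2 : ∀ l ∈ T, l.length ≤ 2) : IsTree T := by
  intro l hl l' h
  match l', h with
  | [], _ => exact h0
  | [p], _ => exact h1 p
  | p :: q :: l', h =>
    rwa [h.eq_of_length_le ((h2 l hl).trans (by simp))]

theorem isFlat_TPi3 : IsFlat TPi3 := by
  have h2 : ∀ l ∈ TPi3, l.length ≤ 2 := by
    rintro l (rfl | ⟨p, rfl⟩ | ⟨p, j, -, rfl⟩) <;> simp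
  exact ⟨isTree_of_length_le (Or.inl rfl) (fun _ => mem_TPi3_one) h2, Or.inl rfl, h2⟩

theorem isFlat_TSig3 : IsFlat TSig3 := by
  have h2 : ∀ l ∈ TSig3, l.length ≤ 2 := by
    rintro l (rfl | ⟨p, rfl⟩ | ⟨j, rfl⟩ | ⟨p, j, -, rfl⟩) <;> simp
  exact ⟨isTree_of_length_le (Or.inl rfl) (fun _ => mem_TSig3_one) h2, Or.inl rfl, h2⟩

theorem encard_setOf_lt (n : ℕ) : {j | j < n}.encard = n := by
  have : {j | j < n} = (Finset.range n : Set ℕ) := by ext; simp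
  rw [this, Set.encard_coe_eq_coe_finsetCard, Finset.card_range]

theorem encard_childLabels_TPi3 (p : ℕ) : (childLabels TPi3 p).encard = (Nat.unpair p).1 := by
  simp only [childLabels, mem_TPi3_two, encard_setOf_lt]

theorem encard_childLabels_TSig3_zero : (childLabels TSig3 0).encard = ⊤ := by
  simp [childLabels, mem_TSig3_two_zero, Set.infinite_univ]

theorem encard_childLabels_TSig3_succ (p : ℕ) :
    (childLabels TSig3 (p + 1)).encard = (Nat.unpair p).1 := by
  simp only [childLabels, mem_TSig3_two_succ, encard_setOf_lt]

theorem encard_nodesWith_TPi3_coe (n : ℕ) : (nodesWith TPi3 n).encard = ⊤ := by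
  rw [Set.encard_eq_top_iff]
  refine Set.infinite_of_injective_forall_mem (f := fun m => Nat.pair n m) ?_ ?_
  · intro a b h
    exact (Nat.pair_eq_pair.1 h).2
  · intro m
    exact ⟨mem_TPi3_one, by simp [encard_childLabels_TPi3]⟩

theorem encard_nodesWith_TPi3_top : (nodesWith TPi3 ⊤).encard = 0 := by
  rw [Set.encard_eq_zero, Set.eq_empty_iff_forall_notMem]
  rintro p ⟨-, h⟩
  simp [encard_childLabels_TPi3] at h

theorem encard_nodesWith_TSig3_coe (n : ℕ) : (nodesWith TSig3 n).encard = ⊤ := by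
  rw [Set.encard_eq_top_iff]
  refine Set.infinite_of_injective_forall_mem (f := fun m => Nat.pair n m + 1) ?_ ?_
  · intro a b h
    exact (Nat.pair_eq_pair.1 (Nat.succ_injective h)).2
  · intro m
    exact ⟨mem_TSig3_one, by simp [encard_childLabels_TSig3_succ]⟩

theorem encard_nodesWith_TSig3_top : (nodesWith TSig3 ⊤).encard = 1 := by
  rw [Set.encard_eq_one]
  refine ⟨0, Set.eq_singleton_iff_unique_mem.2
    ⟨⟨mem_TSig3_one, encard_childLabels_TSig3_zero⟩, ?_⟩⟩
  rintro (_ | p) ⟨-, h⟩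
  · rfl
  · simp [encard_childLabels_TSig3_succ] at h

/-! ### The arithmetical hierarchy -/

theorem Pi03.inter {A B : Set ℕ} (hA : Pi03 A) (hB : Pi03 B) : Pi03 (A ∩ B) := by
  obtain ⟨Q, hQ, rfl⟩ := hA
  obtain ⟨R, hR, rfl⟩ := hB
  refine ⟨fun n x y z => Q n x.unpair.1 y.unpair.1 z.unpair.1 &&
    R n x.unpair.2 y.unpair.2 z.unpair.2, ?_, ?_⟩
  · have hu : Computable Nat.unpair := Primrec.unpair.to_comp
    have hx : Computable fun p : ℕ × ℕ × ℕ × ℕ => p.2.1.unpair :=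
      hu.comp (Computable.fst.comp Computable.snd)
    have hy : Computable fun p : ℕ × ℕ × ℕ × ℕ => p.2.2.1.unpair :=
      hu.comp (Computable.fst.comp (Computable.snd.comp Computable.snd))
    have hz : Computable fun p : ℕ × ℕ × ℕ × ℕ => p.2.2.2.unpair :=
      hu.comp (Computable.snd.comp (Computable.snd.comp Computable.snd))
    have hQ' : Computable fun p : ℕ × ℕ × ℕ × ℕ =>
        Q p.1 p.2.1.unpair.1 p.2.2.1.unpair.1 p.2.2.2.unpair.1 :=
      hQ.comp (g := fun p : ℕ × ℕ × ℕ × ℕ =>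
          (p.1, p.2.1.unpair.1, p.2.2.1.unpair.1, p.2.2.2.unpair.1))
        (Computable.fst.pair ((Computable.fst.comp hx).pair
          ((Computable.fst.comp hy).pair (Computable.fst.comp hz))))
    have hR' : Computable fun p : ℕ × ℕ × ℕ × ℕ =>
        R p.1 p.2.1.unpair.2 p.2.2.1.unpair.2 p.2.2.2.unpair.2 :=
      hR.comp (g := fun p : ℕ × ℕ × ℕ × ℕ =>
          (p.1, p.2.1.unpair.2, p.2.2.1.unpair.2, p.2.2.2.unpair.2))
        (Computable.fst.pair ((Computable.snd.comp hx).pair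
          ((Computable.snd.comp hy).pair (Computable.snd.comp hz))))
    exact Primrec.and.to_comp.comp hQ' hR'
  · ext n
    simp only [Set.mem_inter_iff, Set.mem_ofPred_eq, Bool.and_eq_true]
    constructor
    · rintro ⟨h1, h2⟩ x
      obtain ⟨a, ha⟩ := h1 x.unpair.1
      obtain ⟨b, hb⟩ := h2 x.unpair.2
      exact ⟨Nat.pair a b, fun z => by simpa using ⟨ha _, hb _⟩⟩
    · intro h
      constructor
      · intro x
        obtain ⟨y, hy⟩ := h (Nat.pair x 0)
        exact ⟨y.unpair.1, fun z => by simpa using (hy (Nat.pair z 0)).1⟩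
      · intro x
        obtain ⟨y, hy⟩ := h (Nat.pair 0 x)
        exact ⟨y.unpair.2, fun z => by simpa using (hy (Nat.pair 0 z)).2⟩

/-- The quantifiers in a `Π⁰₃` definition may range over arbitrary `Primcodable` types. -/
theorem pi03_of_primrecPred {α β γ : Type} [Primcodable α] [Primcodable β] [Primcodable γ]
    {R : ℕ → α → β → γ → Prop}
    (hR : PrimrecPred fun q : ℕ × α × β × γ => R q.1 q.2.1 q.2.2.1 q.2.2.2) :
    Pi03 {n | ∀ x, ∃ y, ∀ z, R n x y z} := by
  classical
  have hR' := hR.decide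
  refine ⟨fun n x y z => Option.casesOn (motive := fun _ => Bool) (Encodable.decode (α := α) x)
    true fun a => Option.casesOn (motive := fun _ => Bool) (Encodable.decode (α := β) y)
    false fun b => Option.casesOn (motive := fun _ => Bool) (Encodable.decode (α := γ) z)
    true fun c => decide (R n a b c), ?_, ?_⟩
  · apply Primrec.to_comp
    have hx : Primrec fun q : ℕ × ℕ × ℕ × ℕ => Encodable.decode (α := α) q.2.1 :=
      Primrec.decode.comp (.comp .fst .snd)
    have hy : Primrec fun q : (ℕ × ℕ × ℕ × ℕ) × α => Encodable.decode (α := β) q.1.2.2.1 :=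
      Primrec.decode.comp (.comp .fst (.comp .snd (.comp .snd .fst)))
    have hz : Primrec fun q : ((ℕ × ℕ × ℕ × ℕ) × α) × β =>
        Encodable.decode (α := γ) q.1.1.2.2.2 :=
      Primrec.decode.comp (.comp .snd (.comp .snd (.comp .snd (.comp .fst .fst))))
    have hd : Primrec fun q : (((ℕ × ℕ × ℕ × ℕ) × α) × β) × γ =>
        decide (R q.1.1.1.1 q.1.1.2 q.1.2 q.2) :=
      hR'.comp (f := fun q : ℕ × α × β × γ => decide (R q.1 q.2.1 q.2.2.1 q.2.2.2))
        (g := fun q : (((ℕ × ℕ × ℕ × ℕ) × α) × β) × γ => (q.1.1.1.1, q.1.1.2, q.1.2, q.2))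
        (.pair (.comp .fst (.comp .fst (.comp .fst .fst)))
        (.pair (.comp .snd (.comp .fst .fst)) (.pair (.comp .snd .fst) .snd)))
    exact .option_casesOn hx (.const true)
      (.to₂ (.option_casesOn hy (.const false) (.to₂ (.option_casesOn hz (.const true) (.to₂ hd)))))
  · ext n
    constructor
    · intro h x
      cases hx : Encodable.decode (α := α) x with
      | none => exact ⟨0, fun z => by simp [hx]⟩
      | some a =>
        obtain ⟨b, hb⟩ := h a
        refine ⟨Encodable.encode b, fun z => ?_⟩
        cases hz : Encodable.decode (α := γ) z with
        | none => simp [hx, hz]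
        | some c => simpa [hx, hz] using hb c
    · intro h a
      obtain ⟨y, hy⟩ := h (Encodable.encode a)
      cases hb : Encodable.decode (α := β) y with
      | none => simp [hb] at hy
      | some b => exact ⟨b, fun c => by simpa [hb] using hy (Encodable.encode c)⟩

/-! ### Stagewise approximation of `TreeOf e` -/

/-- The value of the `e`-th partial computable function on `l`, if it is found by stage `s`. -/
def stageEval (e s : ℕ) (l : List ℕ) : Option ℕ :=
  Nat.Partrec.Code.evaln s (Denumerable.ofNat Nat.Partrec.Code e) (Encodable.encode l)

theorem evalCode_eq_some_iff {e v : ℕ} {l : List ℕ} :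
    evalCode e (Encodable.encode l) = Part.some v ↔ ∃ s, stageEval e s l = some v :=
  Part.eq_some_iff.trans Nat.Partrec.Code.evaln_complete

theorem mem_treeOf_iff {e : ℕ} {l : List ℕ} :
    l ∈ TreeOf e ↔ ∃ s, stageEval e s l = some 1 :=
  evalCode_eq_some_iff

theorem notMem_treeOf_iff {e : ℕ} {l : List ℕ} :
    l ∉ TreeOf e ↔ ∀ s, stageEval e s l ≠ some 1 := by
  rw [mem_treeOf_iff, not_exists]

/-- The `e`-th partial computable function takes the values `0` and `1` only, on every list. -/
def TotalBinary (e : ℕ) : Prop := ∀ l, ∃ s, stageEval e s l = some 0 ∨ stageEval e s l = some 1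

theorem indexesTree_iff {e : ℕ} : IndexesTree e ↔ TotalBinary e ∧ IsTree (TreeOf e) := by
  simp only [IndexesTree, TotalBinary, evalCode_eq_some_iff, exists_or]

theorem TotalBinary.mem_treeOf_iff {e : ℕ} (h : TotalBinary e) {l : List ℕ} :
    l ∈ TreeOf e ↔ ∀ s, stageEval e s l ≠ some 0 := by
  constructor
  · intro h1 s hs
    have h0 : evalCode e (Encodable.encode l) = Part.some 0 := evalCode_eq_some_iff.2 ⟨s, hs⟩
    have h1 : evalCode e (Encodable.encode l) = Part.some 1 := h1
    rw [h0] at h1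
    simpa using Part.some_injective h1
  · intro h1
    obtain ⟨s, hs | hs⟩ := h l
    · exact absurd hs (h1 s)
    · exact _root_.mem_treeOf_iff.2 ⟨s, hs⟩

theorem primrec_stageEval {δ : Type} [Primcodable δ] {e s : δ → ℕ} {l : δ → List ℕ}
    (he : Primrec e) (hs : Primrec s) (hl : Primrec l) :
    Primrec fun q => stageEval (e q) (s q) (l q) :=
  Nat.Partrec.Code.primrec_evaln.comp
    ((hs.pair ((Primrec.ofNat Nat.Partrec.Code).comp he)).pair (Primrec.encode.comp hl))

theorem primrecPred_stageEval_eq {δ : Type} [Primcodable δ] {e s : δ → ℕ} {l : δ → List ℕ}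
    (he : Primrec e) (hs : Primrec s) (hl : Primrec l) (v : ℕ) :
    PrimrecPred fun q => stageEval (e q) (s q) (l q) = some v :=
  Primrec.eq.comp (primrec_stageEval he hs hl) (Primrec.const _)

theorem primrec_pairList {δ : Type} [Primcodable δ] {p j : δ → ℕ} (hp : Primrec p)
    (hj : Primrec j) : Primrec fun q => [p q, j q] :=
  Primrec.list_cons.comp hp (Primrec.list_cons.comp hj (Primrec.const []))

theorem primrec_singletonList {δ : Type} [Primcodable δ] {p : δ → ℕ} (hp : Primrec p) :
    Primrec fun q => [p q] :=
  Primrec.list_cons.comp hp (Primrec.const [])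

theorem pi03_totalBinary : Pi03 {e | TotalBinary e} := by
  have : Pi03 {e | ∀ l : List ℕ, ∃ s : ℕ, ∀ _ : ℕ,
      stageEval e s l = some 0 ∨ stageEval e s l = some 1} := by
    have he : Primrec fun q : ℕ × List ℕ × ℕ × ℕ => q.1 := .fst
    have hs : Primrec fun q : ℕ × List ℕ × ℕ × ℕ => q.2.2.1 := .comp .fst (.comp .snd .snd)
    have hl : Primrec fun q : ℕ × List ℕ × ℕ × ℕ => q.2.1 := .comp .fst .snd
    exact pi03_of_primrecPred
      ((primrecPred_stageEval_eq he hs hl 0).or (primrecPred_stageEval_eq he hs hl 1))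
  simpa [TotalBinary] using this

theorem pi03_isFlat : Pi03 {e | TotalBinary e ∧ IsFlat (TreeOf e)} := by
  have : Pi03 {e | ∀ x : List ℕ × List ℕ, ∃ _ : ℕ, ∀ z : ℕ × ℕ,
      (¬ stageEval e z.1 (x.1 ++ x.2) = some 1 ∨ ¬ stageEval e z.2 x.1 = some 0) ∧
      ¬ stageEval e z.1 [] = some 0 ∧
      (¬ stageEval e z.1 x.1 = some 1 ∨ x.1.length ≤ 2)} := by
    let δ := ℕ × (List ℕ × List ℕ) × ℕ × (ℕ × ℕ)
    have he : Primrec fun q : δ => q.1 := .fst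
    have hl : Primrec fun q : δ => q.2.1.1 := .comp .fst (.comp .fst .snd)
    have hl' : Primrec fun q : δ => q.2.1.2 := .comp .snd (.comp .fst .snd)
    have hs : Primrec fun q : δ => q.2.2.2.1 := .comp .fst (.comp .snd (.comp .snd .snd))
    have hs' : Primrec fun q : δ => q.2.2.2.2 := .comp .snd (.comp .snd (.comp .snd .snd))
    exact pi03_of_primrecPred
      (((primrecPred_stageEval_eq he hs (Primrec.list_append.comp hl hl') 1).not.or
        (primrecPred_stageEval_eq he hs' hl 0).not).and
      ((primrecPred_stageEval_eq he hs (.const []) 0).not.and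
        ((primrecPred_stageEval_eq he hs hl 1).not.or
          (Primrec.nat_le.comp (Primrec.list_length.comp hl) (.const 2)))))
  convert pi03_totalBinary.inter this using 1
  ext e
  refine and_congr_right fun (he : TotalBinary e) => ?_
  simp only [Set.mem_ofPred_eq, exists_const]
  constructor
  · rintro ⟨h1, h2, h3⟩ ⟨l, l'⟩ ⟨s, s'⟩
    refine ⟨?_, he.mem_treeOf_iff.1 h2 s, ?_⟩
    · rw [or_iff_not_imp_left, not_not]
      exact fun h => he.mem_treeOf_iff.1
        (h1 _ (mem_treeOf_iff.2 ⟨s, h⟩) l (List.prefix_append l l')) s'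
    · rw [or_iff_not_imp_left, not_not]
      exact fun h => h3 _ (mem_treeOf_iff.2 ⟨s, h⟩)
  · intro h
    refine ⟨?_, he.mem_treeOf_iff.2 fun s => (h ([], []) (s, 0)).2.1, ?_⟩
    · rintro _ hl l ⟨l', rfl⟩
      obtain ⟨s, hs⟩ := mem_treeOf_iff.1 hl
      exact he.mem_treeOf_iff.2 fun s' => (h (l, l') (s, s')).1.resolve_left (not_not.2 hs)
    · intro l hl
      obtain ⟨s, hs⟩ := mem_treeOf_iff.1 hl
      exact (h (l, []) (s, 0)).2.2.resolve_left (not_not.2 hs)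

theorem encard_eq_coe_iff_exists_list {A : Set ℕ} {n : ℕ} :
    A.encard = n ↔ ∃ L : List ℕ, L.length = n ∧ (∀ i a, L[i]? = some a → L.idxOf a = i) ∧
      ∀ j, j ∈ A ↔ L.idxOf j < L.length := by
  constructor
  · intro h
    obtain ⟨F, rfl⟩ := (Set.finite_of_encard_eq_coe h).exists_finset_coe
    rw [Set.encard_coe_eq_coe_finsetCard] at h
    refine ⟨F.toList, by simpa using h, fun i a hi => ?_, fun j => by
      rw [List.idxOf_lt_length_iff, Finset.mem_toList, Finset.mem_coe]⟩
    obtain ⟨hi', rfl⟩ := List.getElem?_eq_some_iff.1 hi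
    exact F.nodup_toList.idxOf_getElem i hi'
  · rintro ⟨L, rfl, h1, h2⟩
    have hL : L.Nodup := List.nodup_iff_injective_get.2 fun i j hij => by
      have hi := h1 i (L.get i) (by simp)
      have hj := h1 j (L.get j) (by simp)
      rw [hij, hj] at hi
      exact Fin.ext hi.symm
    have : A = (L.toFinset : Set ℕ) := by
      ext j
      simp [h2, List.idxOf_lt_length_iff]
    rw [this, Set.encard_coe_eq_coe_finsetCard, List.toFinset_card_of_nodup hL]

/-- For every `n`, infinitely many length-1 nodes have exactly `n` children. -/
def AllFiniteInfinitelyOften (T : Set (List ℕ)) : Prop :=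
  ∀ n : ℕ, (nodesWith T n).encard = ⊤

theorem allFiniteInfinitelyOften_iff {T : Set (List ℕ)} : AllFiniteInfinitelyOften T ↔
    ∀ x : ℕ × ℕ, ∃ y : ℕ × List ℕ, (x.2 ≤ y.1 ∧ y.2.length = x.1) ∧ [y.1] ∈ T ∧
      (∀ i a, y.2[i]? = some a → y.2.idxOf a = i) ∧
      ∀ j, [y.1, j] ∈ T ↔ y.2.idxOf j < y.2.length := by
  simp only [AllFiniteInfinitelyOften, Set.encard_eq_top_iff, Prod.forall]
  refine forall_congr' fun n => ?_
  rw [← Set.ofPred_mem_eq (s := nodesWith T n), ← Nat.frequently_atTop_iff_infinite,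
    Filter.frequently_atTop]
  refine forall_congr' fun m => ?_
  constructor
  · rintro ⟨p, hm, hp, hn⟩
    obtain ⟨L, h1, h2, h3⟩ := encard_eq_coe_iff_exists_list.1 hn
    exact ⟨(p, L), ⟨hm, h1⟩, hp, h2, h3⟩
  · rintro ⟨⟨p, L⟩, ⟨hm, h1⟩, hp, h2, h3⟩
    exact ⟨p, hm, hp, encard_eq_coe_iff_exists_list.2 ⟨L, h1, h2, h3⟩⟩

theorem pi03_allFiniteInfinitelyOften :
    Pi03 {e | TotalBinary e ∧ AllFiniteInfinitelyOften (TreeOf e)} := by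
  have : Pi03 {e | ∀ x : ℕ × ℕ, ∃ y : ℕ × List ℕ, ∀ z : ℕ × ℕ × ℕ,
      (x.2 ≤ y.1 ∧ y.2.length = x.1) ∧ ¬ stageEval e z.1 [y.1] = some 0 ∧
      (¬ y.2[z.2.1]? = some z.2.2 ∨ y.2.idxOf z.2.2 = z.2.1) ∧
      (y.2.idxOf z.2.2 < y.2.length ∨ ¬ stageEval e z.1 [y.1, z.2.2] = some 1) ∧
      (¬ y.2.idxOf z.2.2 < y.2.length ∨ ¬ stageEval e z.1 [y.1, z.2.2] = some 0)} := by
    let δ := ℕ × (ℕ × ℕ) × (ℕ × List ℕ) × (ℕ × ℕ × ℕ)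
    have he : Primrec fun q : δ => q.1 := .fst
    have hn : Primrec fun q : δ => q.2.1.1 := .comp .fst (.comp .fst .snd)
    have hm : Primrec fun q : δ => q.2.1.2 := .comp .snd (.comp .fst .snd)
    have hy : Primrec fun q : δ => q.2.2.1 := .comp .fst (.comp .snd .snd)
    have hz : Primrec fun q : δ => q.2.2.2 := .comp .snd (.comp .snd .snd)
    have hp : Primrec fun q : δ => q.2.2.1.1 := .comp .fst hy
    have hL : Primrec fun q : δ => q.2.2.1.2 := .comp .snd hy
    have hs : Primrec fun q : δ => q.2.2.2.1 := .comp .fst hz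
    have hi : Primrec fun q : δ => q.2.2.2.2.1 := .comp .fst (.comp .snd hz)
    have ha : Primrec fun q : δ => q.2.2.2.2.2 := .comp .snd (.comp .snd hz)
    have hlen : Primrec fun q : δ => q.2.2.1.2.length := Primrec.list_length.comp hL
    have hidx : Primrec fun q : δ => q.2.2.1.2.idxOf q.2.2.2.2.2 := Primrec.list_idxOf.comp ha hL
    have hlt : PrimrecPred fun q : δ => q.2.2.1.2.idxOf q.2.2.2.2.2 < q.2.2.1.2.length :=
      Primrec.nat_lt.comp hidx hlen
    have hget : PrimrecPred fun q : δ => q.2.2.1.2[q.2.2.2.2.1]? = some q.2.2.2.2.2 :=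
      Primrec.eq.comp (Primrec.list_getElem?.comp hL hi) (Primrec.option_some.comp ha)
    have hpair := primrec_pairList hp ha
    exact pi03_of_primrecPred
      (((Primrec.nat_le.comp hm hp).and (Primrec.eq.comp hlen hn)).and
      ((primrecPred_stageEval_eq he hs (primrec_singletonList hp) 0).not.and
      ((hget.not.or (Primrec.eq.comp hidx hi)).and
      ((hlt.or (primrecPred_stageEval_eq he hs hpair 1).not).and
      (hlt.not.or (primrecPred_stageEval_eq he hs hpair 0).not)))))
  convert pi03_totalBinary.inter this using 1
  ext e
  refine and_congr_right fun (he : TotalBinary e) => ?_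
  simp only [Set.mem_ofPred_eq, allFiniteInfinitelyOften_iff]
  refine forall_congr' fun x => exists_congr fun y => ?_
  constructor
  · rintro ⟨h1, h2, h3, h4⟩ ⟨s, i, a⟩
    refine ⟨h1, he.mem_treeOf_iff.1 h2 s, or_iff_not_imp_left.2 fun h => h3 i a (not_not.1 h),
      or_iff_not_imp_left.2 fun h => notMem_treeOf_iff.1 (mt (h4 a).1 h) s,
      or_iff_not_imp_left.2 fun h => he.mem_treeOf_iff.1 ((h4 a).2 (not_not.1 h)) s⟩
  · intro h
    refine ⟨(h (0, 0, 0)).1, he.mem_treeOf_iff.2 fun s => (h (s, 0, 0)).2.1,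
      fun i a hia => (h (0, i, a)).2.2.1.resolve_left (not_not.2 hia), fun j => ⟨?_, ?_⟩⟩
    · intro hj
      by_contra hlt
      exact notMem_treeOf_iff.2 (fun s => (h (s, 0, j)).2.2.2.1.resolve_left hlt) hj
    · intro hj
      exact he.mem_treeOf_iff.2 fun s => (h (s, 0, j)).2.2.2.2.resolve_left (not_not.2 hj)

theorem encard_childLabels_ne_top_iff {T : Set (List ℕ)} {p : ℕ} :
    (childLabels T p).encard ≠ ⊤ ↔ ∃ b, ∀ j, b ≤ j → [p, j] ∉ T := by
  rw [Ne, Set.encard_eq_top_iff, ← Set.ofPred_mem_eq (s := childLabels T p),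
    ← Nat.frequently_atTop_iff_infinite, Filter.not_frequently, Filter.eventually_atTop]
  rfl

theorem pi03_forall_encard_ne_top :
    Pi03 {e | ∀ p, (childLabels (TreeOf e) p).encard ≠ ⊤} := by
  have : Pi03 {e | ∀ p : ℕ, ∃ b : ℕ, ∀ z : ℕ × ℕ,
      ¬ b ≤ z.1 ∨ ¬ stageEval e z.2 [p, z.1] = some 1} := by
    let δ := ℕ × ℕ × ℕ × (ℕ × ℕ)
    have he : Primrec fun q : δ => q.1 := .fst
    have hp : Primrec fun q : δ => q.2.1 := .comp .fst .snd
    have hb : Primrec fun q : δ => q.2.2.1 := .comp .fst (.comp .snd .snd)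
    have hj : Primrec fun q : δ => q.2.2.2.1 := .comp .fst (.comp .snd (.comp .snd .snd))
    have hs : Primrec fun q : δ => q.2.2.2.2 := .comp .snd (.comp .snd (.comp .snd .snd))
    exact pi03_of_primrecPred ((Primrec.nat_le.comp hb hj).not.or
      (primrecPred_stageEval_eq he hs (primrec_pairList hp hj) 1).not)
  simpa only [encard_childLabels_ne_top_iff, notMem_treeOf_iff, Prod.forall, imp_iff_not_or,
    forall_or_left] using this

theorem pi03_subsingleton_encard_top :
    Pi03 {e | {p | (childLabels (TreeOf e) p).encard = ⊤}.Subsingleton} := by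
  have : Pi03 {e | ∀ x : ℕ × ℕ, ∃ y : ℕ × ℕ, ∀ z : ℕ × ℕ,
      x.1 = x.2 ∨ (y.1 = x.1 ∨ y.1 = x.2) ∧
        (¬ y.2 ≤ z.1 ∨ ¬ stageEval e z.2 [y.1, z.1] = some 1)} := by
    let δ := ℕ × (ℕ × ℕ) × (ℕ × ℕ) × (ℕ × ℕ)
    have he : Primrec fun q : δ => q.1 := .fst
    have hp : Primrec fun q : δ => q.2.1.1 := .comp .fst (.comp .fst .snd)
    have hp' : Primrec fun q : δ => q.2.1.2 := .comp .snd (.comp .fst .snd)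
    have hr : Primrec fun q : δ => q.2.2.1.1 := .comp .fst (.comp .fst (.comp .snd .snd))
    have hb : Primrec fun q : δ => q.2.2.1.2 := .comp .snd (.comp .fst (.comp .snd .snd))
    have hj : Primrec fun q : δ => q.2.2.2.1 := .comp .fst (.comp .snd (.comp .snd .snd))
    have hs : Primrec fun q : δ => q.2.2.2.2 := .comp .snd (.comp .snd (.comp .snd .snd))
    exact pi03_of_primrecPred ((Primrec.eq.comp hp hp').or
      (((Primrec.eq.comp hr hp).or (Primrec.eq.comp hr hp')).and
        ((Primrec.nat_le.comp hb hj).not.or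
          (primrecPred_stageEval_eq he hs (primrec_pairList hr hj) 1).not)))
  convert this using 1
  ext e
  have key : ∀ r b, (∀ z : ℕ × ℕ, ¬ b ≤ z.1 ∨ ¬ stageEval e z.2 [r, z.1] = some 1) ↔
      ∀ j, b ≤ j → [r, j] ∉ TreeOf e := fun r b => by
    simp only [notMem_treeOf_iff, Prod.forall, imp_iff_not_or, forall_or_left, ne_eq]
  simp only [Set.mem_ofPred_eq, forall_or_left, forall_and, forall_const, key]
  constructor
  · rintro h ⟨p, q⟩
    by_cases hpq : p = q
    · exact ⟨(0, 0), Or.inl hpq⟩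
    · by_cases hp : (childLabels (TreeOf e) p).encard = ⊤
      · obtain ⟨b, hb⟩ := encard_childLabels_ne_top_iff.1 fun hq => hpq (h hp hq)
        exact ⟨(q, b), Or.inr ⟨Or.inr rfl, hb⟩⟩
      · obtain ⟨b, hb⟩ := encard_childLabels_ne_top_iff.1 hp
        exact ⟨(p, b), Or.inr ⟨Or.inl rfl, hb⟩⟩
  · intro h p hp q hq
    obtain ⟨⟨r, b⟩, hpq | ⟨rfl | rfl, hb⟩⟩ := h (p, q)
    · exact hpq
    · exact absurd hp (encard_childLabels_ne_top_iff.2 ⟨b, hb⟩)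
    · exact absurd hq (encard_childLabels_ne_top_iff.2 ⟨b, hb⟩)

theorem IsTree.mem_of_encard_eq_top {T : Set (List ℕ)} (hT : IsTree T) {p : ℕ}
    (hp : (childLabels T p).encard = ⊤) : [p] ∈ T := by
  obtain ⟨j, hj⟩ := (Set.encard_eq_top_iff.1 hp).nonempty
  exact hT _ hj _ (by simp)

theorem IsTree.nodesWith_top {T : Set (List ℕ)} (hT : IsTree T) :
    nodesWith T ⊤ = {p | (childLabels T p).encard = ⊤} := by
  ext p
  exact and_iff_right_of_imp hT.mem_of_encard_eq_top

theorem mem_isom_iff_of_isFlat {S : Set (List ℕ)} (hS : IsFlat S)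
    (h : AllFiniteInfinitelyOften S) {e : ℕ} :
    e ∈ Isom S ↔ (TotalBinary e ∧ IsFlat (TreeOf e)) ∧
      (TotalBinary e ∧ AllFiniteInfinitelyOften (TreeOf e)) ∧
      {p | (childLabels (TreeOf e) p).encard = ⊤}.encard = (nodesWith S ⊤).encard := by
  change IndexesTree e ∧ TreeIso (TreeOf e) S ↔ _
  rw [indexesTree_iff]
  constructor
  · rintro ⟨⟨he, hT⟩, hiso⟩
    obtain ⟨hflat, hk⟩ := (hS.treeIso_iff hT).1 hiso
    exact ⟨⟨he, hflat⟩, ⟨he, fun n => (hk n).trans (h n)⟩, by rw [← hT.nodesWith_top, hk]⟩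
  · rintro ⟨⟨he, hflat⟩, ⟨-, hn⟩, htop⟩
    refine ⟨⟨he, hflat.isTree⟩, (hS.treeIso_iff hflat.isTree).2 ⟨hflat, fun k => ?_⟩⟩
    induction k with
    | top => rw [hflat.isTree.nodesWith_top, htop]
    | coe n => rw [hn n, h n]

/-- `Isom(T_{Π₃})` is `Π⁰₃`, and `Isom(T_{Σ₃})` is the intersection of a `Π⁰₃` set and a
`Σ⁰₃` set. -/
theorem isom_TPi3_TSig3_complexity :
    Pi03 (Isom TPi3) ∧
    ∃ P S : Set ℕ, Pi03 P ∧ Sigma03 S ∧ Isom TSig3 = P ∩ S := by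
  have hbase := pi03_isFlat.inter pi03_allFiniteInfinitelyOften
  refine ⟨?_, _, {e | ∀ p, (childLabels (TreeOf e) p).encard ≠ ⊤}ᶜ,
    hbase.inter pi03_subsingleton_encard_top, ?_, ?_⟩
  · convert hbase.inter pi03_forall_encard_ne_top using 1
    ext e
    rw [mem_isom_iff_of_isFlat isFlat_TPi3 encard_nodesWith_TPi3_coe, ← and_assoc,
      encard_nodesWith_TPi3_top, Set.encard_eq_zero, Set.eq_empty_iff_forall_notMem]
    rfl
  · rw [Sigma03, compl_compl]
    exact pi03_forall_encard_ne_top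
  · ext e
    rw [mem_isom_iff_of_isFlat isFlat_TSig3 encard_nodesWith_TSig3_coe, ← and_assoc,
      encard_nodesWith_TSig3_top, Set.encard_eq_one, Set.exists_eq_singleton_iff_nonempty_subsingleton,
      and_comm (b := Set.Subsingleton _), ← and_assoc]
    refine and_congr_right fun _ => ?_
    simp only [Set.Nonempty, Set.mem_compl_iff, Set.mem_ofPred_eq, not_forall, not_not]
end
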